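/- Let d > 2 be an integer, c₀ ∈ (0,1], and ε ∈ (0,1). There exist constants c, C > 0 depending only on (d, c₀), and δ ∈ (0,1/2] depending only on (d, c₀, ε), such that for every admissible kernel J on ℤ^d with constant c₀ and every family G ∈ 𝒢 such that (J,G) satisfies Assumption G, for every β ∈ [0, β(δ)] and every x ∈ ℤ^d, F_β(x) ≤ (1/2)·(C/σ_J^d) · (σ_J/(σ_J ∨ |x|))^{d−2−ε} · exp(−c·|x|/ξ(β)). -/

import Mathlib

open scoped ENNReal

noncomputable section

namespace Blackbox

/-- Supremum norm of a lattice point. -/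
def supNorm {d : ℕ} (x : Fin d → ℤ) : ℝ :=
  ((Finset.univ.sup fun i => (x i).natAbs : ℕ) : ℝ)

/-- Squared Euclidean norm of a lattice point. -/
def sqNorm {d : ℕ} (x : Fin d → ℤ) : ℝ :=
  ∑ i, ((x i : ℝ)) ^ 2

/-- Invariance under coordinate permutations and sign flips of individual coordinates. -/
def IsSymmFun {d : ℕ} {α : Type*} (f : (Fin d → ℤ) → α) : Prop :=
  ∀ (π : Equiv.Perm (Fin d)) (e : Fin d → Bool) (x : Fin d → ℤ),
    f (fun i => (if e i then -1 else 1) * x (π i)) = f x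

/-- First coordinate (dot product with `e₁`). -/
def e1 {d : ℕ} {α : Type*} [Zero α] (y : Fin d → α) : α :=
  if h : 0 < d then y ⟨0, h⟩ else 0

/-- An admissible kernel on `ℤ^d` with constant `c₀`. -/
structure AdmissibleKernel (d : ℕ) (c₀ : ℝ) where
  J : (Fin d → ℤ) → ℝ
  nonneg : ∀ x, 0 ≤ J x
  zero_at_zero : J 0 = 0
  summable : Summable J
  norm_one : ∑' x, J x = 1
  symm : IsSymmFun J
  R : ℝ
  R_ge_one : 1 ≤ R
  range_le : ∀ x, 0 < J x → supNorm x ≤ R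
  range_attained : ∃ x, 0 < J x ∧ supNorm x = R
  summable_sq : Summable fun x => sqNorm x * J x
  sigma_lower : c₀ * R ≤ Real.sqrt (∑' x, sqNorm x * J x)
  J_upper : ∀ x, J x ≤ c₀⁻¹ / R ^ d

/-- `σ_J`, the square root of the variance of the kernel. -/
def AdmissibleKernel.sigma {d : ℕ} {c₀ : ℝ} (K : AdmissibleKernel d c₀) : ℝ :=
  Real.sqrt (∑' x, sqNorm x * K.J x)

/-- A family `G ∈ 𝒢` together with an admissible kernel `J` such that `(J,G)` satisfies
Assumption G (with error-term family `H`). -/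
structure Model (d : ℕ) (c₀ : ℝ) where
  K : AdmissibleKernel d c₀
  G : ℝ → (Fin d → ℤ) → ℝ≥0∞
  βc : ℝ≥0∞
  βc_pos : 0 < βc
  init : ∀ x, G 0 x = if x = 0 then 1 else 0
  G' : ℝ → (Fin d → ℤ) → ℝ
  mono : ∀ (x : Fin d → ℤ) ⦃β₁ β₂ : ℝ⦄, 0 ≤ β₁ → β₁ ≤ β₂ →
    ENNReal.ofReal β₂ ≤ βc → G β₁ x ≤ G β₂ x
  deriv : ∀ (x : Fin d → ℤ) ⦃β : ℝ⦄, 0 ≤ β → ENNReal.ofReal β < βc →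
    HasDerivWithinAt (fun t => (G t x).toReal) (G' β x) (Set.Ici 0) β
  symm : ∀ β, IsSymmFun (G β)
  expDecay : ∀ ⦃β : ℝ⦄, 0 ≤ β → ENNReal.ofReal β < βc →
    ∃ C > (0:ℝ), ∃ c > (0:ℝ), ∀ x, G β x ≤ ENNReal.ofReal (C * Real.exp (-c * supNorm x))
  limit : βc ≠ ⊤ → ∀ x, G βc.toReal x = ⨆ β ∈ Set.Ico (0 : ℝ) βc.toReal, G β x
  I1 : ∀ ⦃β' β : ℝ⦄, 0 ≤ β' → β' ≤ β → ENNReal.ofReal β < βc →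
    ∀ x, G β x ≤ G β' x + ENNReal.ofReal (β - β') *
      ∑' p : (Fin d → ℤ) × (Fin d → ℤ),
        G β' p.1 * ENNReal.ofReal (K.J p.2) * G β (x - p.1 - p.2)
  H : ℝ → (Fin d → ℤ) → ℝ
  H_nonneg : ∀ β x, 0 ≤ H β x
  H_zero : ∀ x, H 0 x = 0
  H_symm : ∀ β x, H β (-x) = H β x
  H_cont : ∀ x, ContinuousOn (fun β => H β x)
    {β : ℝ | 0 ≤ β ∧ ENNReal.ofReal β < βc}
  H_expDecay : ∀ ⦃β : ℝ⦄, 0 ≤ β → ENNReal.ofReal β < βc →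
    ∃ C > (0:ℝ), ∃ c > (0:ℝ), ∀ x, H β x ≤ C * Real.exp (-c * supNorm x)
  I2 : ∀ ⦃β : ℝ⦄, 0 ≤ β → ENNReal.ofReal β < βc → ∀ x,
    (∑' p : (Fin d → ℤ) × (Fin d → ℤ),
      (G β p.1).toReal * (K.J p.2 - H β p.2) * (G β (x - p.1 - p.2)).toReal)
      ≤ G' β x

namespace Model

variable {d : ℕ} {c₀ : ℝ}

def sigma (M : Model d c₀) : ℝ := M.K.sigma

/-- `F_β = J * G_β`. -/
def F (M : Model d c₀) (β : ℝ) (x : Fin d → ℤ) : ℝ≥0∞ :=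
  ∑' y, ENNReal.ofReal (M.K.J y) * M.G β (x - y)

/-- The susceptibility `χ(β)`. -/
def chi (M : Model d c₀) (β : ℝ) : ℝ≥0∞ := ∑' x, M.G β x

/-- `ξ(β)²`. -/
def xiSq (M : Model d c₀) (β : ℝ) : ℝ≥0∞ :=
  (∑' x, ENNReal.ofReal (sqNorm x) * M.F β x) / M.chi β

/-- The correlation length of order two, `ξ(β)`. -/
def xi (M : Model d c₀) (β : ℝ) : ℝ := Real.sqrt (M.xiSq β).toReal

/-- The error term `E(β)`. -/
def E (M : Model d c₀) (β : ℝ) : ℝ≥0∞ :=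
  ⨆ t ∈ Set.Icc (0 : ℝ) β,
    (ENNReal.ofReal (∑' x, M.H t x) +
      ENNReal.ofReal (∑' x, sqNorm x * M.H t x) / M.xiSq t)

/-- `β(δ)`. -/
def betaOf (M : Model d c₀) (δ : ℝ) : ℝ :=
  sSup {β : ℝ | 0 ≤ β ∧ ENNReal.ofReal β < M.βc ∧ M.E β < ENNReal.ofReal δ}

/-- One-step distribution of the effective random walk at parameter `β`. -/
def effStep (M : Model d c₀) (β : ℝ) (y : Fin d → ℤ) : ℝ≥0∞ :=
  M.F β y / M.chi β

/-- `k`-step distribution of the effective random walk at parameter `β`. -/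
def effIter (M : Model d c₀) (β : ℝ) : ℕ → (Fin d → ℤ) → ℝ≥0∞
  | 0 => fun x => if x = 0 then 1 else 0
  | n + 1 => fun x => ∑' y, M.effStep β y * M.effIter β n (x - y)

/-- Moment generating function `M_β(s)` of the first coordinate of one step of the
effective random walk. -/
def Mgf (M : Model d c₀) (β s : ℝ) : ℝ≥0∞ :=
  ∑' y : Fin d → ℤ, M.effStep β y * ENNReal.ofReal (Real.exp (s / M.xi β * ((e1 y : ℤ) : ℝ)))

end Model

end Blackbox
open Blackbox

namespace NC

abbrev Zd (d : ℕ) := Fin d → ℤ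

def Cv (d : ℕ) := Zd d → ℝ≥0∞

variable {d : ℕ}

instance : AddCommMonoid (Cv d) := inferInstanceAs (AddCommMonoid (Zd d → ℝ≥0∞))
instance : PartialOrder (Cv d) := inferInstanceAs (PartialOrder (Zd d → ℝ≥0∞))
instance : Module ℝ≥0∞ (Cv d) := inferInstanceAs (Module ℝ≥0∞ (Zd d → ℝ≥0∞))

def conv (f g : Cv d) : Cv d := fun x => ∑' y, f y * g (x - y)
def dl : Cv d := fun x => if x = 0 then 1 else 0

theorem conv_comm (f g : Cv d) : conv f g = conv g f := by
  funext x
  unfold conv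
  rw [← (Equiv.subLeft x).tsum_eq]
  simp [mul_comm]

theorem conv_assoc (f g h : Cv d) : conv (conv f g) h = conv f (conv g h) := by
  funext x
  unfold conv
  simp_rw [← ENNReal.tsum_mul_right, ← ENNReal.tsum_mul_left]
  rw [ENNReal.tsum_comm]
  refine tsum_congr fun z => ?_
  rw [← (Equiv.addRight z).tsum_eq]
  refine tsum_congr fun y => ?_
  simp [mul_assoc, sub_sub, add_comm]

theorem dl_conv (f : Cv d) : conv dl f = f := by
  funext x
  unfold conv dl
  rw [tsum_eq_single 0]
  · simp
  · intro b hb; simp [hb]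

theorem conv_add (f g h : Cv d) : conv f (g + h) = conv f g + conv f h := by
  funext x
  show ∑' y, f y * (g (x-y) + h (x-y)) = (∑' y, f y * g (x-y)) + ∑' y, f y * h (x-y)
  simp_rw [mul_add]
  rw [ENNReal.tsum_add]

theorem conv_zero (f : Cv d) : conv f 0 = 0 := by
  funext x
  show ∑' y, f y * (0:ℝ≥0∞) = 0
  simp

instance : CommSemiring (Cv d) :=
  { (inferInstance : AddCommMonoid (Cv d)) with
    mul := conv
    one := dl
    mul_assoc := conv_assoc
    mul_comm := conv_comm
    one_mul := dl_conv
    mul_one := fun f => (conv_comm f dl).trans (dl_conv f)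
    zero_mul := fun f => (conv_comm 0 f).trans (conv_zero f)
    mul_zero := conv_zero
    left_distrib := conv_add
    right_distrib := fun f g h => by
      show conv (f+g) h = conv f h + conv g h
      rw [conv_comm, conv_add, conv_comm h f, conv_comm h g] }

theorem mul_apply (f g : Cv d) (x : Zd d) : (f * g) x = ∑' y, f y * g (x - y) := rfl
theorem one_apply (x : Zd d) : (1 : Cv d) x = if x = 0 then 1 else 0 := rfl
theorem add_apply (f g : Cv d) (x : Zd d) : (f + g) x = f x + g x := rfl
theorem smul_apply (c : ℝ≥0∞) (f : Cv d) (x : Zd d) : (c • f) x = c * f x := rfl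

instance : Algebra ℝ≥0∞ (Cv d) := Algebra.ofModule
  (fun c f g => by
    funext x
    rw [smul_apply, mul_apply, mul_apply, ← ENNReal.tsum_mul_left]
    simp_rw [smul_apply, mul_assoc])
  (fun c f g => by
    funext x
    rw [smul_apply, mul_apply, mul_apply, ← ENNReal.tsum_mul_left]
    simp_rw [smul_apply]
    exact tsum_congr fun y => by ring)

theorem sum_apply {ι : Type*} (s : Finset ι) (f : ι → Cv d) (x : Zd d) :
    (∑ i ∈ s, f i) x = ∑ i ∈ s, f i x := Finset.sum_apply x s f

theorem cmul_le {f f' g g' : Cv d} (h : f ≤ f') (h' : g ≤ g') : f * g ≤ f' * g' := by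
  intro x
  rw [mul_apply, mul_apply]
  exact ENNReal.tsum_le_tsum fun y => mul_le_mul' (h _) (h' _)

theorem cadd_le {f f' g g' : Cv d} (h : f ≤ f') (h' : g ≤ g') : f + g ≤ f' + g' :=
  fun x => add_le_add (h x) (h' x)

theorem csmul_le {c c' : ℝ≥0∞} {f f' : Cv d} (hc : c ≤ c') (h : f ≤ f') : c • f ≤ c' • f' :=
  fun x => mul_le_mul' hc (h x)

theorem cpow_le {f f' : Cv d} (h : f ≤ f') (n : ℕ) : f ^ n ≤ f' ^ n := by
  induction n with
  | zero => simp
  | succ n ih => rw [pow_succ, pow_succ]; exact cmul_le ih h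

/-- weighted sums -/
def cs (w : Zd d → ℝ≥0∞) (f : Cv d) : ℝ≥0∞ := ∑' x, f x * w x

theorem cs_mono {w : Zd d → ℝ≥0∞} {f g : Cv d} (h : f ≤ g) : cs w f ≤ cs w g :=
  ENNReal.tsum_le_tsum fun x => mul_le_mul_left (h x) _

theorem cs_add (w : Zd d → ℝ≥0∞) (f g : Cv d) : cs w (f + g) = cs w f + cs w g := by
  unfold cs; simp_rw [add_apply, add_mul]; rw [ENNReal.tsum_add]

theorem cs_smul (w : Zd d → ℝ≥0∞) (c : ℝ≥0∞) (f : Cv d) : cs w (c • f) = c * cs w f := by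
  unfold cs; simp_rw [smul_apply, mul_assoc]; rw [ENNReal.tsum_mul_left]

theorem cs_mul' (w : Zd d → ℝ≥0∞) (f g : Cv d) :
    cs w (f * g) = ∑' y, ∑' z, f y * g z * w (y + z) := by
  unfold cs
  simp_rw [mul_apply, ← ENNReal.tsum_mul_right]
  rw [ENNReal.tsum_comm]
  refine tsum_congr fun y => ?_
  rw [← (Equiv.addLeft y).tsum_eq]
  refine tsum_congr fun z => ?_
  simp

structure IsChar (w : Zd d → ℝ≥0∞) : Prop where
  zero : w 0 = 1
  add : ∀ x y, w (x + y) = w x * w y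

theorem cs_mul {w : Zd d → ℝ≥0∞} (hw : IsChar w) (f g : Cv d) :
    cs w (f * g) = cs w f * cs w g := by
  rw [cs_mul']
  unfold cs
  rw [← ENNReal.tsum_mul_right]
  refine tsum_congr fun y => ?_
  rw [← ENNReal.tsum_mul_left]
  refine tsum_congr fun z => ?_
  rw [hw.add]; ring

theorem cs_one {w : Zd d → ℝ≥0∞} (hw : IsChar w) : cs w (1 : Cv d) = 1 := by
  unfold cs
  rw [tsum_eq_single 0]
  · simp [one_apply, hw.zero]
  · intro b hb; simp [one_apply, hb]

theorem cs_pow {w : Zd d → ℝ≥0∞} (hw : IsChar w) (f : Cv d) (n : ℕ) :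
    cs w (f ^ n) = cs w f ^ n := by
  induction n with
  | zero => simp [cs_one hw]
  | succ n ih => rw [pow_succ, cs_mul hw, ih, pow_succ]

def mass (f : Cv d) : ℝ≥0∞ := cs (fun _ => 1) f

theorem char_one : IsChar (fun _ : Zd d => (1:ℝ≥0∞)) := ⟨rfl, fun _ _ => by simp⟩

theorem mul_le_mass (f g : Cv d) (B : ℝ≥0∞) (h : ∀ x, g x ≤ B) (x : Zd d) :
    (f * g) x ≤ mass f * B := by
  rw [mul_apply]; unfold mass cs
  rw [← ENNReal.tsum_mul_right]
  refine ENNReal.tsum_le_tsum fun y => ?_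
  simp only [mul_one]
  gcongr; exact h _

theorem apply_le_mass (f : Cv d) (x : Zd d) : f x ≤ mass f := by
  unfold mass cs; simp only [mul_one]; exact ENNReal.le_tsum x

/-- geometric series -/
def geo (c : ℝ≥0∞) (f : Cv d) : Cv d := fun x => ∑' k : ℕ, c ^ k * (f ^ k) x

theorem mul_geo_apply (g : Cv d) (c : ℝ≥0∞) (f : Cv d) (x : Zd d) :
    (g * geo c f) x = ∑' k : ℕ, c ^ k * (g * f ^ k) x := by
  rw [mul_apply]
  simp_rw [mul_apply, ← ENNReal.tsum_mul_left]
  rw [ENNReal.tsum_comm]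
  refine tsum_congr fun y => ?_
  unfold geo
  rw [← ENNReal.tsum_mul_left]
  exact tsum_congr fun k => by ring

theorem geo_eq (c : ℝ≥0∞) (f : Cv d) : geo c f = 1 + c • (f * geo c f) := by
  funext x
  rw [add_apply, smul_apply, mul_geo_apply, ← ENNReal.tsum_mul_left]
  unfold geo
  rw [tsum_eq_zero_add' ENNReal.summable]
  simp only [pow_zero, one_mul]
  congr 1
  refine tsum_congr fun k => ?_
  rw [pow_succ', pow_succ']; ring

theorem cs_geo {w : Zd d → ℝ≥0∞} (hw : IsChar w) (c : ℝ≥0∞) (f : Cv d) :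
    cs w (geo c f) = ∑' k : ℕ, (c * cs w f) ^ k := by
  unfold cs geo
  simp_rw [← ENNReal.tsum_mul_right]
  rw [ENNReal.tsum_comm]
  refine tsum_congr fun k => ?_
  simp_rw [mul_assoc]
  rw [ENNReal.tsum_mul_left, mul_pow]
  congr 1
  exact cs_pow hw f k

theorem iter_le {f g : Cv d} {c : ℝ≥0∞} (h : f ≤ g + c • (g * f)) (N : ℕ) :
    f ≤ (∑ k ∈ Finset.range N, c ^ k • (g * g ^ k)) + c ^ N • (g ^ N * f) := by
  induction N with
  | zero => simp
  | succ N ih =>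
    refine ih.trans ?_
    have : c ^ N • (g ^ N * f) ≤ c ^ N • (g ^ N * (g + c • (g * f))) :=
      csmul_le le_rfl (cmul_le le_rfl h)
    refine (cadd_le le_rfl this).trans (le_of_eq ?_)
    rw [Finset.sum_range_succ, add_assoc]
    congr 1
    rw [mul_add, smul_add, mul_smul_comm, smul_smul, ← pow_succ, ← mul_assoc, ← pow_succ,
      ← pow_succ', pow_succ g N]

theorem le_geo {f g : Cv d} {c : ℝ≥0∞} (h : f ≤ g + c • (g * f)) (hc : c * mass g < 1)
    (hf : mass f ≠ ∞) : f ≤ g * geo c g := by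
  intro x
  have key : ∀ N : ℕ, f x ≤ (g * geo c g) x + (c * mass g) ^ N * mass f := by
    intro N
    refine (iter_le h N x).trans ?_
    rw [add_apply, sum_apply, mul_geo_apply]
    refine add_le_add ?_ ?_
    · exact ENNReal.sum_le_tsum (f := fun k => c ^ k * (g * g ^ k) x) _
    · rw [smul_apply, mul_pow, mul_assoc]
      gcongr
      refine (mul_le_mass _ _ (mass f) (apply_le_mass f) x).trans ?_
      simp only [mass]; rw [cs_pow char_one]
  have lim : Filter.Tendsto (fun N : ℕ => (g * geo c g) x + (c * mass g) ^ N * mass f)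
      Filter.atTop (nhds ((g * geo c g) x + 0 * mass f)) := by
    refine Filter.Tendsto.add tendsto_const_nhds ?_
    exact ENNReal.Tendsto.mul_const (ENNReal.tendsto_pow_atTop_nhds_zero_of_lt_one hc) (Or.inr hf)
  have := ge_of_tendsto' lim key
  simpa using this

end NC

namespace NC

theorem norm_exp_sub_one_le_of_re (w : ℂ) (hw : w.re ≤ 0) : ‖Complex.exp w - 1‖ ≤ ‖w‖ := by
  have hconv : Convex ℝ {z : ℂ | z.re ≤ 0} := convex_halfSpace_re_le 0
  have := hconv.norm_image_sub_le_of_norm_deriv_le (f := Complex.exp) (C := 1)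
    (fun z _ => Complex.differentiableAt_exp)
    (fun z hz => by
      rw [Complex.deriv_exp, Complex.norm_exp]
      exact Real.exp_le_one_iff.mpr hz) (x := 0) (y := w) (by simp) hw
  simpa using this

def zA (a : ℝ) (N : ℕ) (y : ℝ) : ℂ := Complex.exp ((-1 + (a * y : ℝ) * Complex.I) / N)

theorem zA_lower (a : ℝ) (ha : 0 ≤ a) (N : ℕ) (hN : 1 ≤ N) (y : ℝ) :
    1 / (2 * (1 + a * |y|)) ≤ ‖(1 / (N:ℂ)) * ∑ l : Fin N, zA a N y ^ (l : ℕ)‖ := by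
  have hNpos : (0:ℝ) < N := by exact_mod_cast hN
  have hNc : (N:ℂ) ≠ 0 := by exact_mod_cast hNpos.ne'
  set z := zA a N y with hz
  have h1 : (∑ l : Fin N, z ^ (l : ℕ)) * (z - 1) = z ^ N - 1 := by
    rw [Fin.sum_univ_eq_sum_range (fun l => z ^ l) N]
    exact geom_sum_mul z N
  have hzN : z ^ N = Complex.exp (-1 + (a * y : ℝ) * Complex.I) := by
    rw [hz, zA, ← Complex.exp_nat_mul]; congr 1; field_simp
  have h2 : (1/2 : ℝ) ≤ ‖z ^ N - 1‖ := by
    have hn : ‖z ^ N‖ = Real.exp (-1) := by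
      rw [hzN, Complex.norm_exp]; simp
    have : Real.exp (-1) ≤ 1/2 := by
      have := Real.exp_neg_one_lt_half
      linarith
    have h3 := norm_sub_norm_le (1:ℂ) (z ^ N)
    rw [norm_sub_rev, norm_one, hn] at h3
    linarith
  have h3 : ‖z - 1‖ ≤ (1 + a * |y|) / N := by
    refine (norm_exp_sub_one_le_of_re _ ?_).trans ?_
    · have : ((-1 + ((a * y : ℝ):ℂ) * Complex.I) / N).re = -1 / N := by
        rw [Complex.div_natCast_re]; simp
      rw [this]; apply div_nonpos_of_nonpos_of_nonneg <;> simp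
    · rw [norm_div, Complex.norm_natCast]
      gcongr
      refine (norm_add_le _ _).trans ?_
      simp [abs_of_nonneg ha]
  have h4 : ‖∑ l : Fin N, z ^ (l : ℕ)‖ * ‖z - 1‖ = ‖z ^ N - 1‖ := by rw [← h1, norm_mul]
  rw [norm_mul, norm_div, norm_one, Complex.norm_natCast]
  set Q := ‖∑ l : Fin N, z ^ (l : ℕ)‖
  have hp : 0 < 1 + a * |y| := by positivity
  have h5 : (1/2:ℝ) ≤ Q * ((1 + a * |y|) / N) := by
    calc (1/2:ℝ) ≤ Q * ‖z - 1‖ := by rw [h4]; exact h2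
      _ ≤ _ := by gcongr
  have h6 : Q * ((1 + a * |y|) / N) = (1 / N * Q) * (1 + a * |y|) := by ring
  rw [h6] at h5
  rw [div_le_iff₀ (by positivity)]
  linarith

/-- Fourier transform -/
def hat {d : ℕ} (w : Zd d → ℝ) (k : Fin d → ℝ) : ℂ :=
  ∑' y, (w y : ℂ) * Complex.exp (Complex.I * ((∑ i, k i * (y i : ℝ) : ℝ) : ℂ))

theorem norm_cis (r : ℝ) : ‖Complex.exp (Complex.I * (r : ℂ))‖ = 1 := by
  rw [mul_comm]; exact Complex.norm_exp_ofReal_mul_I r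

theorem smooth1 {d : ℕ} (w : Zd d → ℝ) (hw : ∀ y, 0 ≤ w y) (hs : Summable w) (a : ℝ) (ha : 0 ≤ a)
    (N : ℕ) (hN : 1 ≤ N) (x : Zd d) :
    ∑' y, w (x - y) * ∏ i, (1 + a * |(y i : ℝ)|)⁻¹ ^ 2 ≤
      4 ^ d * ((1 / (N:ℝ)) ^ d * (1 / (N:ℝ)) ^ d * ∑ u : Fin d → Fin N, ∑ v : Fin d → Fin N,
        ‖hat w (fun i => a / N * (((v i : ℕ):ℝ) - ((u i : ℕ):ℝ)))‖) := by
  classical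
  have hNpos : (0:ℝ) < N := by exact_mod_cast hN
  have hNc : (N:ℂ) ≠ 0 := by exact_mod_cast hNpos.ne'
  have hs' : Summable fun y => w (x - y) := hs.comp_injective (Equiv.subLeft x).injective
  -- pointwise comparison
  let A : ℝ → ℂ := fun y => (1 / (N:ℂ)) * ∑ l : Fin N, zA a N y ^ (l : ℕ)
  have hA : ∀ y : Zd d, ∏ i, (1 + a * |(y i : ℝ)|)⁻¹ ^ 2 ≤ 4 ^ d * ∏ i, ‖A (y i)‖ ^ 2 := by
    intro y
    have : (4:ℝ) ^ d * ∏ i, ‖A (y i)‖ ^ 2 = ∏ i : Fin d, (4 * ‖A (y i)‖ ^ 2) := by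
      rw [Finset.prod_mul_distrib]; simp
    rw [this]
    refine Finset.prod_le_prod (fun i _ => by positivity) fun i _ => ?_
    have h := zA_lower a ha N hN (y i)
    have hp : 0 < 1 + a * |(y i : ℝ)| := by positivity
    have h' : (1 + a * |(y i : ℝ)|)⁻¹ ≤ 2 * ‖A (y i)‖ := by
      have e : 1 / (2 * (1 + a * |(y i : ℝ)|)) = (1 + a * |(y i : ℝ)|)⁻¹ / 2 := by
        rw [one_div, mul_inv]; ring
      rw [e] at h
      show _ ≤ 2 * ‖(1 / (N:ℂ)) * ∑ l : Fin N, zA a N (y i) ^ (l : ℕ)‖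
      linarith
    calc (1 + a * |(y i : ℝ)|)⁻¹ ^ 2 ≤ (2 * ‖A (y i)‖) ^ 2 := by gcongr
      _ = _ := by ring
  let c : (Fin d → Fin N) → Zd d → ℂ := fun u y => ∏ i, zA a N (y i) ^ (u i : ℕ)
  have hprod : ∀ y : Zd d, ∏ i, A (y i) = (1 / (N:ℂ)) ^ d * ∑ u : Fin d → Fin N, c u y := by
    intro y
    simp only [A, c]
    rw [Finset.prod_mul_distrib, Finset.prod_univ_sum, Fintype.piFinset_univ]
    simp
  -- the coefficients
  let e : (Fin d → Fin N) → (Fin d → Fin N) → ℝ := fun u v =>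
    Real.exp (-(∑ i, (((u i : ℕ):ℝ) + ((v i : ℕ):ℝ)) / N))
  let kk : (Fin d → Fin N) → (Fin d → Fin N) → Fin d → ℝ := fun u v i =>
    a / N * (((v i : ℕ):ℝ) - ((u i : ℕ):ℝ))
  have he : ∀ u v, e u v ≤ 1 := by
    intro u v
    refine Real.exp_le_one_iff.mpr ?_
    have : 0 ≤ ∑ i, (((u i : ℕ):ℝ) + ((v i : ℕ):ℝ)) / N := Finset.sum_nonneg fun i _ => by positivity
    linarith
  have hcc : ∀ u v y, c u y * (starRingEnd ℂ) (c v y) =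
      (e u v : ℂ) * Complex.exp (Complex.I * ((-(∑ i, kk u v i * (y i : ℝ)) : ℝ) : ℂ)) := by
    intro u v y
    simp only [c, zA, e, kk, map_prod, map_pow, ← Complex.exp_conj]
    rw [← Finset.prod_mul_distrib, Complex.ofReal_exp, ← Complex.exp_add]
    simp_rw [← Complex.exp_nat_mul, ← Complex.exp_add]
    rw [← Complex.exp_sum]
    congr 1
    push_cast
    rw [← Finset.sum_neg_distrib, ← Finset.sum_neg_distrib, Finset.mul_sum, ← Finset.sum_add_distrib]
    refine Finset.sum_congr rfl fun i _ => ?_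
    simp
    field_simp
    ring
  have hsq : ∀ y : Zd d, ((∏ i, ‖A (y i)‖ ^ 2 : ℝ) : ℂ) = (1 / (N:ℂ)) ^ d * (1 / (N:ℂ)) ^ d *
      ∑ u : Fin d → Fin N, ∑ v : Fin d → Fin N, (e u v : ℂ) *
        Complex.exp (Complex.I * ((-(∑ i, kk u v i * (y i : ℝ)) : ℝ) : ℂ)) := by
    intro y
    have : ((∏ i, ‖A (y i)‖ ^ 2 : ℝ) : ℂ) = (∏ i, A (y i)) * (starRingEnd ℂ) (∏ i, A (y i)) := by
      rw [Complex.mul_conj, Complex.normSq_eq_norm_sq, norm_prod, Finset.prod_pow]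
    rw [this, hprod]
    simp only [map_mul, map_pow, map_sum, map_div₀, map_one, Complex.conj_natCast]
    simp_rw [← hcc]
    rw [mul_mul_mul_comm, Finset.sum_mul_sum]
  -- sum
  have hB : ∀ y : Zd d, ∏ i, ‖A (y i)‖ ^ 2 ≤ 1 := by
    intro y
    refine Finset.prod_le_one (fun i _ => by positivity) fun i _ => ?_
    have : ‖A (y i)‖ ≤ 1 := by
      simp only [A]
      rw [norm_mul, norm_div, norm_one, Complex.norm_natCast, one_div, inv_mul_le_iff₀ hNpos, mul_one]
      refine (norm_sum_le _ _).trans ?_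
      have : ∀ l : Fin N, ‖zA a N (y i) ^ (l:ℕ)‖ ≤ 1 := by
        intro l
        rw [norm_pow]
        refine pow_le_one₀ (norm_nonneg _) ?_
        rw [zA, Complex.norm_exp, Complex.div_natCast_re]
        refine Real.exp_le_one_iff.mpr ?_
        apply div_nonpos_of_nonpos_of_nonneg <;> simp
      refine (Finset.sum_le_sum fun l _ => this l).trans ?_
      simp
    exact pow_le_one₀ (norm_nonneg _) this
  have hsum1 : Summable fun y => w (x - y) * ∏ i, ‖A (y i)‖ ^ 2 :=
    Summable.of_nonneg_of_le (fun y => mul_nonneg (hw _) (Finset.prod_nonneg fun i _ => by positivity))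
      (fun y => mul_le_of_le_one_right (hw _) (hB y)) hs'
  have step1 : ∑' y, w (x - y) * ∏ i, (1 + a * |(y i : ℝ)|)⁻¹ ^ 2 ≤
      4 ^ d * ∑' y, w (x - y) * ∏ i, ‖A (y i)‖ ^ 2 := by
    rw [← tsum_mul_left]
    have hle : ∀ y, w (x - y) * ∏ i, (1 + a * |(y i : ℝ)|)⁻¹ ^ 2 ≤
        4 ^ d * (w (x - y) * ∏ i, ‖A (y i)‖ ^ 2) := by
      intro y
      calc _ ≤ w (x - y) * (4 ^ d * ∏ i, ‖A (y i)‖ ^ 2) :=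
            mul_le_mul_of_nonneg_left (hA y) (hw _)
        _ = _ := by ring
    refine Summable.tsum_le_tsum hle ?_ (hsum1.mul_left _)
    exact Summable.of_nonneg_of_le
      (fun y => mul_nonneg (hw _) (Finset.prod_nonneg fun i _ => by positivity)) hle (hsum1.mul_left _)
  refine step1.trans ?_
  gcongr
  -- complex computation
  have hterm : ∀ u v, Summable fun y : Zd d => (w (x - y) : ℂ) * ((e u v : ℂ) *
        Complex.exp (Complex.I * ((-(∑ i, kk u v i * (y i : ℝ)) : ℝ) : ℂ))) := by
    intro u v
    refine Summable.of_norm ?_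
    refine Summable.of_nonneg_of_le (fun _ => norm_nonneg _) (fun y => ?_) hs'
    rw [norm_mul, norm_mul, norm_cis, Complex.norm_real, Complex.norm_real, mul_one,
      Real.norm_of_nonneg (hw _), Real.norm_of_nonneg (Real.exp_nonneg _)]
    exact mul_le_of_le_one_right (hw _) (he u v)
  have hcomp : ((∑' y, w (x - y) * ∏ i, ‖A (y i)‖ ^ 2 : ℝ) : ℂ) =
      (1 / (N:ℂ)) ^ d * (1 / (N:ℂ)) ^ d * ∑ u : Fin d → Fin N, ∑ v : Fin d → Fin N,
        ∑' y : Zd d, (w (x - y) : ℂ) * ((e u v : ℂ) *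
        Complex.exp (Complex.I * ((-(∑ i, kk u v i * (y i : ℝ)) : ℝ) : ℂ))) := by
    rw [Complex.ofReal_tsum]
    simp_rw [← Summable.tsum_finsetSum (fun v _ => hterm _ v)]
    rw [← Summable.tsum_finsetSum (fun u _ => summable_sum fun v _ => hterm u v), ← tsum_mul_left]
    refine tsum_congr fun y => ?_
    rw [Complex.ofReal_mul, hsq]
    simp_rw [Finset.mul_sum]
    refine Finset.sum_congr rfl fun u _ => Finset.sum_congr rfl fun v _ => ?_
    ring
  have hfin : ∀ u v, ‖∑' y : Zd d, (w (x - y) : ℂ) * ((e u v : ℂ) *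
        Complex.exp (Complex.I * ((-(∑ i, kk u v i * (y i : ℝ)) : ℝ) : ℂ)))‖ ≤
        ‖hat w (kk u v)‖ := by
    intro u v
    have : (∑' y : Zd d, (w (x - y) : ℂ) * ((e u v : ℂ) *
        Complex.exp (Complex.I * ((-(∑ i, kk u v i * (y i : ℝ)) : ℝ) : ℂ)))) =
        (e u v : ℂ) * Complex.exp (Complex.I * ((-(∑ i, kk u v i * (x i : ℝ)) : ℝ) : ℂ)) *
          hat w (kk u v) := by
      rw [hat, ← tsum_mul_left, ← (Equiv.subLeft x).tsum_eq]
      refine tsum_congr fun y => ?_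
      simp only [Equiv.subLeft_apply, sub_sub_cancel]
      have : Complex.exp (Complex.I * ((-(∑ i, kk u v i * (((x - y) i : ℤ) : ℝ)) : ℝ) : ℂ)) =
          Complex.exp (Complex.I * ((-(∑ i, kk u v i * (x i : ℝ)) : ℝ) : ℂ)) *
          Complex.exp (Complex.I * ((∑ i, kk u v i * (y i : ℝ) : ℝ) : ℂ)) := by
        rw [← Complex.exp_add, ← mul_add, ← Complex.ofReal_add]
        congr 3
        simp only [Pi.sub_apply, Int.cast_sub, mul_sub, Finset.sum_sub_distrib]
        ring
      rw [this]; ring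
    rw [this, norm_mul, norm_mul, norm_cis, Complex.norm_real,
      Real.norm_of_nonneg (Real.exp_nonneg _), mul_one]
    exact mul_le_of_le_one_left (norm_nonneg _) (he u v)
  have hnn : 0 ≤ ∑' y, w (x - y) * ∏ i, ‖A (y i)‖ ^ 2 :=
    tsum_nonneg fun y => mul_nonneg (hw _) (Finset.prod_nonneg fun i _ => by positivity)
  rw [← Real.norm_of_nonneg hnn, ← Complex.norm_real, hcomp, norm_mul]
  have : ‖(1 / (N:ℂ)) ^ d * (1 / (N:ℂ)) ^ d‖ = (1 / (N:ℝ)) ^ d * (1 / (N:ℝ)) ^ d := by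
    simp
  rw [this]
  gcongr
  refine (norm_sum_le _ _).trans (Finset.sum_le_sum fun u _ => ?_)
  exact (norm_sum_le _ _).trans (Finset.sum_le_sum fun v _ => hfin u v)

theorem sum_cauchy (κ : ℝ) (hκ : 0 < κ) (M : ℕ) :
    ∑ m ∈ Finset.range M, 1 / (1 + (κ * ((m:ℝ) + 1)) ^ 2) ≤ 2 / κ := by
  have : ∀ M : ℕ, ∑ m ∈ Finset.range M, 1 / (1 + (κ * ((m:ℝ) + 1)) ^ 2) ≤
      2 / κ * (1 - 1 / (1 + κ * M)) := by
    intro M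
    induction M with
    | zero => simp
    | succ M ih =>
      rw [Finset.sum_range_succ]
      refine (add_le_add_left ih _).trans ?_
      push_cast
      have h1 : 0 < 1 + κ * M := by positivity
      have h2 : 0 < 1 + κ * (M + 1) := by positivity
      have h3 : 1 / (1 + (κ * ((M:ℝ) + 1)) ^ 2) ≤ 2 / κ * (1 / (1 + κ * M) - 1 / (1 + κ * (M + 1))) := by
        have e : 2 / κ * (1 / (1 + κ * M) - 1 / (1 + κ * (M + 1))) = 2 / ((1 + κ * M) * (1 + κ * (M + 1))) := by
          field_simp; ring
        rw [e, div_le_div_iff₀ (by positivity) (by positivity)]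
        have h4 : (1 + κ * M) * (1 + κ * (M + 1)) ≤ (1 + κ * (M + 1)) * (1 + κ * (M + 1)) := by
          apply mul_le_mul_of_nonneg_right _ h2.le; nlinarith
        nlinarith [sq_nonneg (1 - κ * (M + 1))]
      have h5 : 2 / κ * (1 - 1 / (1 + κ * M)) + 2 / κ * (1 / (1 + κ * M) - 1 / (1 + κ * (M + 1))) =
        2 / κ * (1 - 1 / (1 + κ * (M + 1))) := by ring
      linarith
  refine (this M).trans ?_
  have : 0 ≤ 1 / (1 + κ * M) := by positivity
  have h2 : 0 < 2 / κ := by positivity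
  nlinarith

theorem sum_cauchy2 (κ : ℝ) (hκ : 0 < κ) (N : ℕ) (l : Fin N) :
    ∑ m : Fin N, 1 / (1 + (κ * (((m:ℕ):ℝ) - ((l:ℕ):ℝ))) ^ 2) ≤ 1 + 4 / κ := by
  rw [Fin.sum_univ_eq_sum_range (fun m => 1 / (1 + (κ * ((m:ℝ) - ((l:ℕ):ℝ))) ^ 2)) N]
  obtain ⟨l, hl⟩ := l
  obtain ⟨M, hM⟩ : ∃ M, N = (l:ℕ) + 1 + M := ⟨N - (l+1), by omega⟩
  subst hM
  simp only
  rw [Finset.sum_range_add, Finset.sum_range_succ]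
  have h1 : ∑ m ∈ Finset.range (l:ℕ), 1 / (1 + (κ * ((m:ℝ) - ((l:ℕ):ℝ))) ^ 2) ≤ 2 / κ := by
    rw [← Finset.sum_range_reflect]
    refine le_trans (le_of_eq ?_) (sum_cauchy κ hκ l)
    refine Finset.sum_congr rfl fun j hj => ?_
    have hj := Finset.mem_range.mp hj
    have : ((((l:ℕ) - 1 - j : ℕ)):ℝ) = (l:ℕ) - 1 - j := by
      rw [Nat.cast_sub (by omega), Nat.cast_sub (by omega)]; simp
    rw [this]; congr 2; ring
  have h2 : ∑ m ∈ Finset.range M, 1 / (1 + (κ * ((((l:ℕ) + 1 + m : ℕ):ℝ) - ((l:ℕ):ℝ))) ^ 2) ≤ 2 / κ := by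
    refine le_trans (le_of_eq ?_) (sum_cauchy κ hκ M)
    refine Finset.sum_congr rfl fun j hj => ?_
    push_cast; congr 3; ring
  have e : 4 / κ = 2 / κ + 2 / κ := by ring
  simp only [sub_self, mul_zero]
  norm_num at h1 h2 ⊢
  linarith

theorem smooth2 {d : ℕ} (w : Zd d → ℝ) (hw : ∀ y, 0 ≤ w y) (hs : Summable w) (a b A0 : ℝ)
    (ha : 0 < a) (hb : 0 < b) (hA0 : 0 ≤ A0)
    (hh : ∀ k : Fin d → ℝ, (∀ i, |k i| ≤ a) → ‖hat w k‖ ≤ ∏ i, (A0 * (1 / (1 + (b * k i) ^ 2))))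
    (x : Zd d) :
    ∑' y, w (x - y) * ∏ i, (1 + a * |(y i : ℝ)|)⁻¹ ^ 2 ≤ (20 * A0 / (a * b)) ^ d := by
  obtain ⟨N, hN⟩ := exists_nat_ge (max 1 (a * b))
  have hN1 : 1 ≤ N := by exact_mod_cast (le_max_left _ _).trans hN
  have hNab : a * b ≤ N := (le_max_right _ _).trans hN
  have hNpos : (0:ℝ) < N := by exact_mod_cast hN1
  refine (smooth1 w hw hs a ha.le N hN1 x).trans ?_
  set κ := a * b / N with hκ
  have hκ0 : 0 < κ := by positivity
  have h1 : ∀ u v : Fin d → Fin N, ‖hat w (fun i => a / N * (((v i : ℕ):ℝ) - ((u i : ℕ):ℝ)))‖ ≤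
      ∏ i, (A0 * (1 / (1 + (κ * (((v i : ℕ):ℝ) - ((u i : ℕ):ℝ))) ^ 2))) := by
    intro u v
    refine (hh _ ?_).trans (le_of_eq ?_)
    · intro i
      have hu := (u i).2
      have hv := (v i).2
      have hu' : ((u i : ℕ):ℝ) ≤ N := by exact_mod_cast hu.le
      have hv' : ((v i : ℕ):ℝ) ≤ N := by exact_mod_cast hv.le
      have hu0 : (0:ℝ) ≤ ((u i : ℕ):ℝ) := by positivity
      have hv0 : (0:ℝ) ≤ ((v i : ℕ):ℝ) := by positivity
      rw [abs_mul, abs_of_pos (by positivity : 0 < a / N), div_mul_eq_mul_div, div_le_iff₀ hNpos]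
      gcongr
      rw [abs_le]; constructor <;> linarith
    · refine Finset.prod_congr rfl fun i _ => ?_
      rw [hκ]; congr 4; ring
  have h2 : ∑ u : Fin d → Fin N, ∑ v : Fin d → Fin N,
      ∏ i, (A0 * (1 / (1 + (κ * (((v i : ℕ):ℝ) - ((u i : ℕ):ℝ))) ^ 2))) ≤
      (N * (A0 * (5 / κ))) ^ d := by
    have e1 : ∀ u : Fin d → Fin N, ∑ v : Fin d → Fin N,
      ∏ i, (A0 * (1 / (1 + (κ * (((v i : ℕ):ℝ) - ((u i : ℕ):ℝ))) ^ 2))) =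
      ∏ i, ∑ m : Fin N, (A0 * (1 / (1 + (κ * (((m : ℕ):ℝ) - ((u i : ℕ):ℝ))) ^ 2))) := by
      intro u
      rw [Finset.prod_univ_sum, Fintype.piFinset_univ]
    have e2 : ∀ u : Fin d → Fin N, 
      ∏ i, ∑ m : Fin N, (A0 * (1 / (1 + (κ * (((m : ℕ):ℝ) - ((u i : ℕ):ℝ))) ^ 2))) ≤
      (A0 * (5 / κ)) ^ d := by
      intro u
      have : (A0 * (5 / κ)) ^ d = ∏ i : Fin d, (A0 * (5 / κ)) := by simp
      rw [this]
      refine Finset.prod_le_prod (fun i _ => Finset.sum_nonneg fun m _ => by positivity) fun i _ => ?_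
      rw [← Finset.mul_sum]
      gcongr
      refine (sum_cauchy2 κ hκ0 N (u i)).trans ?_
      have : 1 ≤ 1 / κ := by
        rw [one_le_div hκ0, hκ, div_le_one hNpos]; exact hNab
      have e : 5 / κ = 1 / κ + 4 / κ := by ring
      linarith
    simp_rw [e1]
    refine (Finset.sum_le_sum fun u _ => e2 u).trans (le_of_eq ?_)
    simp [mul_pow]
  calc _ ≤ 4 ^ d * ((1 / (N:ℝ)) ^ d * (1 / (N:ℝ)) ^ d * (N * (A0 * (5 / κ))) ^ d) := by
        gcongr
        exact (Finset.sum_le_sum fun u _ => Finset.sum_le_sum fun v _ => h1 u v).trans h2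
    _ = _ := by
        rw [← mul_pow, ← mul_pow, ← mul_pow]
        congr 1
        rw [hκ]; field_simp; ring

end NC

namespace NC
variable {d : ℕ}

/-- signed permutation as an equivalence -/
def sgn (b : Bool) : ℤ := if b then -1 else 1

theorem sgn_mul_sgn (b : Bool) : sgn b * sgn b = 1 := by cases b <;> simp [sgn]

def act (π : Equiv.Perm (Fin d)) (e : Fin d → Bool) : Zd d ≃+ Zd d where
  toFun x := fun i => sgn (e i) * x (π i)
  invFun x := fun i => sgn (e (π.symm i)) * x (π.symm i)
  left_inv x := by funext i; simp [← mul_assoc, sgn_mul_sgn]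
  right_inv x := by funext i; simp [← mul_assoc, sgn_mul_sgn]
  map_add' x y := by funext i; simp [mul_add]

theorem act_apply (π : Equiv.Perm (Fin d)) (e : Fin d → Bool) (x : Zd d) (i : Fin d) :
    act π e x i = sgn (e i) * x (π i) := rfl

theorem symm_iff {α : Type*} (f : Zd d → α) : IsSymmFun f ↔ ∀ π e x, f (act π e x) = f x := Iff.rfl

theorem symm_mul {f g : Cv d} (hf : IsSymmFun f) (hg : IsSymmFun g) : IsSymmFun (f * g) := by
  replace hf := (symm_iff _).1 hf
  replace hg := (symm_iff _).1 hg
  refine (symm_iff _).2 ?_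
  intro π e x
  rw [mul_apply, mul_apply, ← (act π e).toEquiv.tsum_eq]
  refine tsum_congr fun y => ?_
  show f (act π e y) * g (act π e x - act π e y) = _
  rw [← map_sub, hf, hg]

theorem symm_one : IsSymmFun (1 : Cv d) := by
  refine (symm_iff _).2 ?_
  intro π e x
  rw [one_apply, one_apply]
  simp

theorem symm_pow {f : Cv d} (hf : IsSymmFun f) (n : ℕ) : IsSymmFun (f ^ n) := by
  induction n with
  | zero => simpa using symm_one
  | succ n ih => rw [pow_succ]; exact symm_mul ih hf

theorem symm_neg {α : Type*} {f : Zd d → α} (hf : IsSymmFun f) (x : Zd d) : f (-x) = f x := by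
  have := hf (Equiv.refl _) (fun _ => true) x
  rw [← this]; congr 1; funext i; simp

/-- squared norm weight -/
def sq (x : Zd d) : ℝ≥0∞ := ENNReal.ofReal (sqNorm x)

theorem sqNorm_nonneg (x : Zd d) : 0 ≤ sqNorm x := Finset.sum_nonneg fun _ _ => sq_nonneg _

theorem sq_par (y z : Zd d) : sq (y + z) + sq (-y + z) = 2 * sq y + 2 * sq z := by
  unfold sq
  rw [← ENNReal.ofReal_ofNat, ← ENNReal.ofReal_mul (by norm_num), ← ENNReal.ofReal_mul (by norm_num),
    ← ENNReal.ofReal_add (sqNorm_nonneg _) (sqNorm_nonneg _),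
    ← ENNReal.ofReal_add (mul_nonneg (by norm_num) (sqNorm_nonneg _)) (mul_nonneg (by norm_num) (sqNorm_nonneg _))]
  congr 1
  unfold sqNorm
  simp only [Finset.mul_sum, ← Finset.sum_add_distrib]
  refine Finset.sum_congr rfl fun i _ => ?_
  simp; ring

theorem cs_sq_mul (f g : Cv d) (hf : ∀ x, f (-x) = f x) :
    cs sq (f * g) = cs sq f * mass g + mass f * cs sq g := by
  have h1 : cs sq (f * g) = ∑' y, ∑' z, f y * g z * sq (-y + z) := by
    rw [cs_mul', ← (Equiv.neg _).tsum_eq]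
    refine tsum_congr fun y => tsum_congr fun z => ?_
    simp [hf]
  have h2 : 2 * cs sq (f * g) = 2 * (cs sq f * mass g + mass f * cs sq g) := by
    rw [two_mul]
    nth_rw 1 [cs_mul']
    rw [h1, ← ENNReal.tsum_add]
    simp_rw [← ENNReal.tsum_add, ← mul_add, sq_par]
    unfold cs mass cs
    rw [mul_add, ← ENNReal.tsum_mul_right, ← ENNReal.tsum_mul_right, ← ENNReal.tsum_mul_left,
      ← ENNReal.tsum_mul_left, ← ENNReal.tsum_add]
    refine tsum_congr fun y => ?_
    simp_rw [← ENNReal.tsum_mul_left]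
    rw [← ENNReal.tsum_add]
    refine tsum_congr fun z => ?_
    ring
  exact (ENNReal.mul_right_inj (by simp) (by simp)).mp h2

/-- sum of coordinates -/
def ell (x : Zd d) : ℝ := ∑ i, (x i : ℝ)

theorem ell_add (x y : Zd d) : ell (x + y) = ell x + ell y := by
  simp [ell, Finset.sum_add_distrib]

theorem ell_zero : ell (0 : Zd d) = 0 := by simp [ell]

def ew (s : ℝ) (x : Zd d) : ℝ≥0∞ := ENNReal.ofReal (Real.exp (s * ell x))

theorem ew_char (s : ℝ) : IsChar (ew (d := d) s) where
  zero := by simp [ew, ell_zero]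
  add x y := by
    unfold ew
    rw [ell_add, mul_add, Real.exp_add, ENNReal.ofReal_mul (Real.exp_pos _).le]

def tilt (s : ℝ) (f : Cv d) : Cv d := fun x => f x * ew s x

theorem tilt_mono (s : ℝ) {f g : Cv d} (h : f ≤ g) : tilt s f ≤ tilt s g :=
  fun x => mul_le_mul_left (h x) _

theorem tilt_mul (s : ℝ) (f g : Cv d) : tilt s (f * g) = tilt s f * tilt s g := by
  funext x
  rw [mul_apply]
  unfold tilt
  rw [mul_apply, ← ENNReal.tsum_mul_right]
  refine tsum_congr fun y => ?_
  have : ew s x = ew s y * ew s (x - y) := by rw [← (ew_char s).add]; simp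
  rw [this]; ring

theorem tilt_one (s : ℝ) : tilt s (1 : Cv d) = 1 := by
  funext x
  unfold tilt
  rw [one_apply]
  split_ifs with h
  · simp [h, (ew_char s).zero]
  · simp

theorem tilt_pow (s : ℝ) (f : Cv d) (n : ℕ) : tilt s (f ^ n) = (tilt s f) ^ n := by
  induction n with
  | zero => simp [tilt_one]
  | succ n ih => rw [pow_succ, pow_succ, tilt_mul, ih]

theorem tilt_geo (s : ℝ) (c : ℝ≥0∞) (f : Cv d) : tilt s (geo c f) = geo c (tilt s f) := by
  funext x
  unfold geo
  simp_rw [← tilt_pow]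
  unfold tilt
  rw [← ENNReal.tsum_mul_right]
  exact tsum_congr fun k => by ring

theorem mass_tilt (s : ℝ) (f : Cv d) : mass (tilt s f) = cs (ew s) f := by
  unfold mass cs tilt; simp

/-- real version -/
def re (f : Cv d) : Zd d → ℝ := fun x => (f x).toReal

theorem re_nonneg (f : Cv d) (x : Zd d) : 0 ≤ re f x := ENNReal.toReal_nonneg

theorem mass_eq (f : Cv d) : mass f = ∑' x, f x := by simp [mass, cs]

theorem re_summable {f : Cv d} (hf : mass f ≠ ∞) : Summable (re f) :=
  ENNReal.summable_toReal (by rwa [mass_eq] at hf)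

theorem apply_ne_top {f : Cv d} (hf : mass f ≠ ∞) (x : Zd d) : f x ≠ ∞ :=
  ne_top_of_le_ne_top hf (apply_le_mass f x)

def ph (k : Fin d → ℝ) (y : Zd d) : ℂ := Complex.exp (Complex.I * ((∑ i, k i * (y i : ℝ) : ℝ) : ℂ))

theorem ph_add (k : Fin d → ℝ) (y z : Zd d) : ph k (y + z) = ph k y * ph k z := by
  unfold ph
  rw [← Complex.exp_add]
  congr 1
  rw [← mul_add]
  congr 1
  push_cast
  rw [← Finset.sum_add_distrib]
  refine Finset.sum_congr rfl fun i _ => ?_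
  simp; ring

theorem hat_def (w : Zd d → ℝ) (k : Fin d → ℝ) : hat w k = ∑' y, (w y : ℂ) * ph k y := rfl

theorem norm_ph (k : Fin d → ℝ) (y : Zd d) : ‖ph k y‖ = 1 := norm_cis _

theorem hat_summable {w : Zd d → ℝ} (hw : Summable w) (k : Fin d → ℝ) :
    Summable fun y => (w y : ℂ) * ph k y := by
  refine Summable.of_norm ?_
  simp only [norm_mul, norm_ph, mul_one, Complex.norm_real]
  exact hw.norm

def shear (d : ℕ) : Zd d × Zd d ≃ Zd d × Zd d where
  toFun := fun p => (p.2, p.1 - p.2)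
  invFun := fun p => (p.1 + p.2, p.1)
  left_inv := fun p => by simp
  right_inv := fun p => by simp

theorem shear_apply (x y : Zd d) : shear d (x, y) = (y, x - y) := rfl

theorem re_mul_apply {f g : Cv d} (hf : mass f ≠ ∞) (hg : mass g ≠ ∞) (x : Zd d) :
    re (f * g) x = ∑' y, re f y * re g (x - y) := by
  unfold re
  rw [mul_apply, ENNReal.tsum_toReal_eq]
  · simp [ENNReal.toReal_mul]
  · exact fun y => ENNReal.mul_ne_top (apply_ne_top hf _) (apply_ne_top hg _)

theorem tsum_conv (a b : Zd d → ℂ) (ha : Summable fun y => ‖a y‖) (hb : Summable fun y => ‖b y‖) :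
    (∑' y, a y) * ∑' y, b y = ∑' x, ∑' y, a y * b (x - y) := by
  rw [tsum_mul_tsum_of_summable_norm ha hb]
  have hs : Summable fun z : Zd d × Zd d => a z.1 * b z.2 :=
    summable_mul_of_summable_norm ha hb
  rw [← (shear d).tsum_eq]
  exact Summable.tsum_prod (((shear d).summable_iff).mpr hs)

theorem hat_mul {f g : Cv d} (hf : mass f ≠ ∞) (hg : mass g ≠ ∞) (k : Fin d → ℝ) :
    hat (re (f * g)) k = hat (re f) k * hat (re g) k := by
  rw [hat_def, hat_def, hat_def]
  have sf : Summable fun y => ‖(re f y : ℂ) * ph k y‖ := by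
    simp only [norm_mul, norm_ph, mul_one, Complex.norm_real]
    exact (re_summable hf).norm
  have sg : Summable fun y => ‖(re g y : ℂ) * ph k y‖ := by
    simp only [norm_mul, norm_ph, mul_one, Complex.norm_real]
    exact (re_summable hg).norm
  rw [tsum_conv _ _ sf sg]
  refine tsum_congr fun x => ?_
  rw [re_mul_apply hf hg, Complex.ofReal_tsum, ← tsum_mul_right]
  refine tsum_congr fun y => ?_
  have : ph k x = ph k y * ph k (x - y) := by rw [← ph_add]; simp
  rw [this]; push_cast; ring

theorem hat_one (k : Fin d → ℝ) : hat (re (1 : Cv d)) k = 1 := by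
  rw [hat_def, tsum_eq_single 0]
  · simp [re, one_apply, ph]
  · intro b hb; simp [re, one_apply, hb]

theorem mass_pow (f : Cv d) (n : ℕ) : mass (f ^ n) = mass f ^ n := cs_pow char_one f n
theorem mass_mul (f g : Cv d) : mass (f * g) = mass f * mass g := cs_mul char_one f g

theorem hat_pow {f : Cv d} (hf : mass f ≠ ∞) (n : ℕ) (k : Fin d → ℝ) :
    hat (re (f ^ n)) k = hat (re f) k ^ n := by
  induction n with
  | zero => simp [hat_one]
  | succ n ih =>
    rw [pow_succ, hat_mul _ hf, ih, pow_succ]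
    rw [mass_pow]; exact ENNReal.pow_ne_top hf

theorem mass_geo {c : ℝ≥0∞} {f : Cv d} : mass (geo c f) = (1 - c * mass f)⁻¹ := by
  unfold mass
  rw [cs_geo char_one, ENNReal.tsum_geometric]

theorem hat_geo {θ : ℝ} (hθ : 0 ≤ θ) {f : Cv d} (hf : mass f ≠ ∞) (h1 : ENNReal.ofReal θ * mass f < 1)
    (k : Fin d → ℝ) :
    hat (re (geo (ENNReal.ofReal θ) f)) k * (1 - θ * hat (re f) k) = 1 := by
  set V := geo (ENNReal.ofReal θ) f with hV
  have hVm : mass V ≠ ∞ := by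
    rw [hV, mass_geo]; simpa using (tsub_pos_of_lt h1).ne'
  have e : ∀ x, re V x = re (1 : Cv d) x + θ * re (f * V) x := by
    intro x
    have h2 : mass (f * V) ≠ ∞ := by rw [mass_mul]; exact ENNReal.mul_ne_top hf hVm
    unfold re
    conv_lhs => rw [hV, geo_eq, add_apply, smul_apply, ← hV]
    rw [ENNReal.toReal_add, ENNReal.toReal_mul, ENNReal.toReal_ofReal hθ]
    · rw [one_apply]; split_ifs <;> simp
    · exact ENNReal.mul_ne_top ENNReal.ofReal_ne_top (apply_ne_top h2 x)
  have h3 : hat (re V) k = 1 + θ * (hat (re f) k * hat (re V) k) := by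
    rw [← hat_mul hf hVm, ← hat_one k, hat_def (re V), hat_def, hat_def, ← tsum_mul_left,
      ← Summable.tsum_add]
    · refine tsum_congr fun y => ?_
      rw [e]; push_cast; ring
    · exact hat_summable (re_summable (by simp [mass, cs_one char_one])) k
    · exact (hat_summable (re_summable (by rw [mass_mul]; exact ENNReal.mul_ne_top hf hVm)) k).mul_left _
  linear_combination h3

end NC

namespace NC
variable {d : ℕ}

theorem cos_le_quartic (x : ℝ) : Real.cos x ≤ 1 - x ^ 2 / 2 + x ^ 4 / 2 := by
  by_cases h : |x| ≤ 1
  · have := Real.cos_bound h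
    rw [abs_le] at this
    have h4 : |x| ^ 4 = x ^ 4 := by rw [show (4:ℕ) = 2 * 2 from rfl, pow_mul, pow_mul, sq_abs]
    rw [h4] at this
    have : 0 ≤ x ^ 4 := by positivity
    linarith
  · have h1 : 1 ≤ x ^ 2 := by
      rw [← sq_abs]; nlinarith [not_le.mp h]
    nlinarith [Real.cos_le_one x]

theorem cosh_ge_quartic (x : ℝ) : 1 + x ^ 2 / 2 + x ^ 4 / 24 ≤ Real.cosh x := by
  have h := Real.hasSum_cosh x
  have := h.summable.sum_le_tsum (Finset.range 3) (fun i _ => by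
    rw [pow_mul]; positivity)
  rw [h.tsum_eq] at this
  refine le_trans (le_of_eq ?_) this
  simp [Finset.sum_range_succ, Nat.factorial]

theorem cosh_scale (l v : ℝ) (hl0 : 0 ≤ l) (hl : l ≤ 1) :
    Real.cosh (l * v) ≤ 1 + l ^ 2 * v ^ 2 / 2 + l ^ 4 * Real.cosh v := by
  have h1 := Real.hasSum_cosh (l * v)
  have h2 := (Real.hasSum_cosh v).mul_left (l ^ 4)
  have h3 : HasSum (fun n : ℕ => if n = 0 then (1:ℝ) else if n = 1 then l ^ 2 * v ^ 2 / 2 else 0)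
      (1 + l ^ 2 * v ^ 2 / 2) := by
    have := hasSum_sum_of_ne_finset_zero (L := SummationFilter.unconditional ℕ) (f := fun n : ℕ => if n = 0 then (1:ℝ) else if n = 1 then l ^ 2 * v ^ 2 / 2 else 0)
      (s := Finset.range 2) (by
        intro b hb; simp at hb
        rw [if_neg (by omega), if_neg (by omega)])
    simpa [Finset.sum_range_succ] using this
  refine hasSum_le ?_ h1 (h3.add h2)
  intro n
  have hv : 0 ≤ v ^ (2 * n) / ((2 * n).factorial : ℝ) := by rw [pow_mul]; positivity
  rcases n with _ | _ | n
  · simp; positivity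
  · have : 0 ≤ l ^ 4 * (v ^ (2 * 1) / ((2 * 1).factorial : ℝ)) := by positivity
    simp [mul_pow] at this ⊢
    linarith
  · simp only [Nat.add_eq_zero_iff]
    rw [if_neg (by omega), if_neg (by omega), zero_add, mul_pow, mul_div_assoc]
    refine mul_le_mul_of_nonneg_right ?_ hv
    exact pow_le_pow_of_le_one hl0 hl (by omega)

theorem cosh_small (v : ℝ) (hv : |v| ≤ 1) : Real.cosh v ≤ 1 + v ^ 2 := by
  have h := cosh_scale |v| 1 (abs_nonneg _) hv
  rw [mul_one, Real.cosh_abs, sq_abs] at h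
  have h4 : |v| ^ 4 = v ^ 2 * v ^ 2 := by
    rw [show (4:ℕ) = 2 * 2 from rfl, pow_mul, sq_abs]; ring
  have h1 : v ^ 2 ≤ 1 := by rw [← sq_abs]; exact pow_le_one₀ (abs_nonneg _) hv
  have hc : Real.cosh 1 ≤ 1.6 := by
    rw [Real.cosh_eq]
    have := Real.exp_one_lt_d9
    have h2 : Real.exp (-1) ≤ 0.4 := by
      rw [Real.exp_neg]
      have := Real.exp_one_gt_d9
      rw [inv_le_comm₀ (by positivity) (by norm_num)]
      linarith
    linarith
  rw [h4] at h
  by_cases hs : v ^ 2 ≤ 0.3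
  · nlinarith [sq_nonneg v, mul_nonneg (sq_nonneg v) (sq_nonneg v)]
  · have h5 := cosh_scale |v| 1 (abs_nonneg _) hv
    have h6 : Real.cosh v ≤ 1 + v ^ 2 * (Real.cosh 1 - 1) := by
      -- via series comparison
      have g1 := Real.hasSum_cosh v
      have g2 := (Real.hasSum_cosh 1).mul_left (v ^ 2)
      have g3 : HasSum (fun n : ℕ => if n = 0 then (1 - v ^ 2:ℝ) else 0) (1 - v ^ 2) := hasSum_ite_eq 0 _
      have g4 := hasSum_le (f := fun n : ℕ => v ^ (2 * n) / ((2 * n).factorial : ℝ)) ?_ g1 (g3.add g2)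
      · linarith
      intro n
      rcases n with _ | n
      · simp
      · simp only [Nat.add_eq_zero_iff]
        rw [if_neg (by omega), zero_add, mul_div_assoc']
        gcongr
        rw [one_pow, mul_one, pow_mul]
        exact pow_le_of_le_one (sq_nonneg _) h1 (by omega)
    nlinarith [sq_nonneg v]

section
variable {p : Zd d → ℝ}

theorem ex_act (hsym : IsSymmFun p) (π : Equiv.Perm (Fin d)) (e : Fin d → Bool) (f : Zd d → ℝ) :
    ∑' y, p y * f (act π e y) = ∑' y, p y * f y := by
  rw [← (act π e).toEquiv.tsum_eq (fun y => p y * f y)]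
  refine tsum_congr fun y => ?_
  show _ = p (act π e y) * f (act π e y)
  rw [(symm_iff p).1 hsym]

theorem sum_act (hsym : IsSymmFun p) (π : Equiv.Perm (Fin d)) (e : Fin d → Bool) {f : Zd d → ℝ}
    (h : Summable fun y => p y * f y) : Summable fun y => p y * f (act π e y) := by
  have := ((act π e).toEquiv.summable_iff).mpr h
  refine this.congr fun y => ?_
  show p (act π e y) * f (act π e y) = _
  rw [(symm_iff p).1 hsym]

def flip (i : Fin d) : Zd d ≃+ Zd d := act (Equiv.refl _) (fun j => decide (j = i))

theorem flip_same (i : Fin d) (y : Zd d) : flip i y i = - y i := by simp [flip, act_apply, sgn]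
theorem flip_ne {i j : Fin d} (h : j ≠ i) (y : Zd d) : flip i y j = y j := by
  simp [flip, act_apply, sgn, h]

theorem ell_flip (i : Fin d) (y : Zd d) : ell (flip i y) = ell y - 2 * y i := by
  unfold ell
  rw [← Finset.add_sum_erase _ _ (Finset.mem_univ i), ← Finset.add_sum_erase _ (fun i => (y i : ℝ)) (Finset.mem_univ i),
    flip_same]
  have : ∑ x ∈ Finset.univ.erase i, ((flip i y x : ℤ) : ℝ) = ∑ x ∈ Finset.univ.erase i, (y x : ℝ) :=
    Finset.sum_congr rfl fun j hj => by rw [flip_ne (Finset.ne_of_mem_erase hj)]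
  rw [this]; push_cast; ring

theorem cosh_coord (s : ℝ) (i : Fin d) (y : Zd d) :
    Real.cosh (s * y i) ≤ (Real.cosh (s * ell y) + Real.cosh (s * ell (flip i y))) / 2 := by
  rw [ell_flip]
  have e1 : s * ell y = s * y i + s * (ell y - y i) := by ring
  have e2 : s * (ell y - 2 * y i) = - (s * y i - s * (ell y - y i)) := by ring
  rw [e1, e2, Real.cosh_neg, Real.cosh_add, Real.cosh_sub]
  have h1 := Real.one_le_cosh (s * (ell y - y i))
  have h2 := Real.cosh_pos (s * y i)
  nlinarith

variable (hp0 : ∀ y, 0 ≤ p y) (hsym : IsSymmFun p) {s : ℝ}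
  (hM : Summable fun y => p y * Real.cosh (s * ell y))
include hp0 hsym hM

theorem coord_cosh_sum (i : Fin d) : (Summable fun y => p y * Real.cosh (s * y i)) ∧
    ∑' y, p y * Real.cosh (s * y i) ≤ ∑' y, p y * Real.cosh (s * ell y) := by
  have h2 : Summable fun y => p y * Real.cosh (s * ell (flip i y)) :=
    sum_act hsym (Equiv.refl _) (fun j => decide (j = i)) (f := fun y => Real.cosh (s * ell y)) hM
  have h3 := ex_act hsym (Equiv.refl _) (fun j => decide (j = i)) (fun y => Real.cosh (s * ell y))
  have hle : ∀ y, p y * Real.cosh (s * y i) ≤ (p y * Real.cosh (s * ell y) + p y * Real.cosh (s * ell (flip i y))) / 2 := by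
    intro y
    have := mul_le_mul_of_nonneg_left (cosh_coord s i y) (hp0 y)
    linarith
  have hS := (hM.add h2).div_const 2
  have h1 : Summable fun y => p y * Real.cosh (s * y i) :=
    Summable.of_nonneg_of_le (fun y => mul_nonneg (hp0 y) (Real.cosh_pos _).le) hle hS
  refine ⟨h1, ?_⟩
  have h4 := h1.tsum_le_tsum hle hS
  rw [tsum_div_const, hM.tsum_add h2] at h4
  have h3' : ∑' y, p y * Real.cosh (s * ell (flip i y)) = ∑' y, p y * Real.cosh (s * ell y) := h3
  rw [h3'] at h4
  linarith

theorem coord_moments (hs : 0 < s) (i : Fin d) : (Summable fun y => p y * (y i : ℝ) ^ 2) ∧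
    (Summable fun y => p y * (y i : ℝ) ^ 4) ∧
    s ^ 4 * ∑' y, p y * (y i : ℝ) ^ 4 ≤ 24 * ∑' y, p y * Real.cosh (s * ell y) := by
  obtain ⟨h1, h2⟩ := coord_cosh_sum hp0 hsym hM i
  have hq : ∀ y : Zd d, p y * (s ^ 4 * (y i : ℝ) ^ 4) ≤ 24 * (p y * Real.cosh (s * y i)) := by
    intro y
    have := mul_le_mul_of_nonneg_left (cosh_ge_quartic (s * y i)) (hp0 y)
    have h3 := mul_nonneg (hp0 y) (by positivity : 0 ≤ 1 + (s * y i) ^ 2 / 2)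
    rw [mul_pow, mul_pow] at *
    linarith
  have hq2 : ∀ y : Zd d, p y * (s ^ 2 * (y i : ℝ) ^ 2) ≤ 2 * (p y * Real.cosh (s * y i)) := by
    intro y
    have := mul_le_mul_of_nonneg_left (cosh_ge_quartic (s * y i)) (hp0 y)
    have h3 := mul_nonneg (hp0 y) (by positivity : 0 ≤ 1 + (s * y i) ^ 4 / 24)
    rw [mul_pow, mul_pow] at *
    linarith
  have s4 : Summable fun y => p y * (s ^ 4 * (y i : ℝ) ^ 4) :=
    Summable.of_nonneg_of_le (fun y => mul_nonneg (hp0 y) (by positivity)) hq (h1.mul_left 24)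
  have s2 : Summable fun y => p y * (s ^ 2 * (y i : ℝ) ^ 2) :=
    Summable.of_nonneg_of_le (fun y => mul_nonneg (hp0 y) (by positivity)) hq2 (h1.mul_left 2)
  have e4 : ∀ y : Zd d, p y * (s ^ 4 * (y i : ℝ) ^ 4) = s ^ 4 * (p y * (y i : ℝ) ^ 4) := fun y => by ring
  have e2 : ∀ y : Zd d, p y * (s ^ 2 * (y i : ℝ) ^ 2) = s ^ 2 * (p y * (y i : ℝ) ^ 2) := fun y => by ring
  have h5 := s4.tsum_le_tsum hq (h1.mul_left 24)
  simp_rw [e4] at s4 h5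
  simp_rw [e2] at s2
  rw [tsum_mul_left, tsum_mul_left] at h5
  refine ⟨(summable_mul_left_iff (by positivity)).mp s2, (summable_mul_left_iff (by positivity)).mp s4, ?_⟩
  linarith

theorem cross_moment (hs : 0 < s) (i j : Fin d) (hij : i ≠ j) :
    (Summable fun y => p y * ((y i : ℝ) * y j)) ∧ ∑' y, p y * ((y i : ℝ) * y j) = 0 := by
  obtain ⟨h1, -⟩ := coord_moments hp0 hsym hM hs i
  obtain ⟨h2, -⟩ := coord_moments hp0 hsym hM hs j
  constructor
  · refine Summable.of_norm_bounded (h1.add h2) fun y => ?_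
    rw [norm_mul, Real.norm_of_nonneg (hp0 y), ← mul_add]
    refine mul_le_mul_of_nonneg_left ?_ (hp0 y)
    rw [Real.norm_eq_abs, abs_le]
    constructor <;> nlinarith [sq_nonneg ((y i : ℝ) + y j), sq_nonneg ((y i : ℝ) - y j)]
  · have := ex_act hsym (Equiv.refl _) (fun j => decide (j = i)) (fun y => (y i : ℝ) * y j)
    have h3 : ∀ y, p y * ((((act (Equiv.refl _) (fun j => decide (j = i)) y) i : ℤ) : ℝ) * ((act (Equiv.refl _) (fun j => decide (j = i)) y) j : ℤ))
      = - (p y * ((y i : ℝ) * y j)) := by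
      intro y
      have a1 := flip_same i y
      have a2 := flip_ne hij.symm y
      unfold flip at a1 a2
      rw [a1, a2]; push_cast; ring
    simp_rw [h3] at this
    rw [tsum_neg] at this
    linarith

theorem second_moment (hs : 0 < s) {m : ℝ} (hm : ∑' y, p y * sqNorm y = m) (k : Fin d → ℝ) :
    (Summable fun y => p y * (∑ i, k i * (y i : ℝ)) ^ 2) ∧
    d * ∑' y, p y * (∑ i, k i * (y i : ℝ)) ^ 2 = (∑ i, k i ^ 2) * m := by
  have hcm := fun i => (coord_moments hp0 hsym hM hs i).1
  have heq : ∀ i j : Fin d, ∑' y, p y * (y i : ℝ) ^ 2 = ∑' y, p y * (y j : ℝ) ^ 2 := by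
    intro i j
    have := ex_act hsym (Equiv.swap i j) (fun _ => false) (fun y => (y i : ℝ) ^ 2)
    simpa [act_apply, sgn] using this.symm
  have hsum : ∀ i, d * ∑' y, p y * (y i : ℝ) ^ 2 = m := by
    intro i
    rw [← hm]
    unfold sqNorm
    simp_rw [Finset.mul_sum]
    rw [Summable.tsum_finsetSum (fun j _ => hcm j), Finset.sum_congr rfl (fun j _ => heq j i)]
    simp
  have hexp : ∀ y : Zd d, p y * (∑ i, k i * (y i : ℝ)) ^ 2 = ∑ i, ∑ j, k i * k j * (p y * ((y i : ℝ) * y j)) := by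
    intro y
    rw [pow_two, Finset.sum_mul_sum, Finset.mul_sum]
    refine Finset.sum_congr rfl fun i _ => ?_
    rw [Finset.mul_sum]
    refine Finset.sum_congr rfl fun j _ => ?_
    ring
  have hsm : ∀ i j, Summable fun y => k i * k j * (p y * ((y i : ℝ) * y j)) := by
    intro i j
    refine Summable.mul_left _ ?_
    by_cases h : i = j
    · subst h; simpa [pow_two] using hcm i
    · exact (cross_moment hp0 hsym hM hs i j h).1
  simp_rw [hexp]
  refine ⟨summable_sum fun i _ => summable_sum fun j _ => hsm i j, ?_⟩
  rw [Summable.tsum_finsetSum (fun i _ => summable_sum fun j _ => hsm i j), Finset.mul_sum, Finset.sum_mul]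
  refine Finset.sum_congr rfl fun i _ => ?_
  rw [Summable.tsum_finsetSum (fun j _ => hsm i j), Finset.sum_eq_single i]
  · rw [tsum_mul_left, ← hsum i]
    simp_rw [← pow_two]
    ring
  · intro j _ hj
    rw [tsum_mul_left, (cross_moment hp0 hsym hM hs i j hj.symm).2, mul_zero]
  · simp

theorem cos_summable (hp : Summable p) (f : Zd d → ℝ) : Summable fun y => p y * Real.cos (f y) := by
  refine Summable.of_norm_bounded hp fun y => ?_
  rw [norm_mul, Real.norm_of_nonneg (hp0 y), Real.norm_eq_abs]
  exact mul_le_of_le_one_right (hp0 y) (Real.abs_cos_le_one _)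

theorem fourier_low (hp : Summable p) (hsum : ∑' y, p y = 1) (hd : 0 < d) {ξ : ℝ} (hξ : 0 < ξ) (hs : 0 < s)
    (hM2 : ∑' y, p y * Real.cosh (s * ell y) ≤ 2) (hm : ∑' y, p y * sqNorm y = ξ ^ 2)
    (k : Fin d → ℝ) (hk : ∀ i, |k i| ≤ s ^ 2 * ξ / (10 * d ^ 2)) :
    ∑' y, p y * Real.cos (∑ i, k i * (y i : ℝ)) ≤ 1 - (∑ i, k i ^ 2) * ξ ^ 2 / (4 * d) := by
  have hd' : (0:ℝ) < d := by exact_mod_cast hd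
  obtain ⟨s2, e2⟩ := second_moment hp0 hsym hM hs hm k
  have hcm := fun i => (coord_moments hp0 hsym hM hs i).2
  have h4 : ∀ y : Zd d, (∑ i, k i * (y i : ℝ)) ^ 4 ≤ d ^ 3 * ∑ i, k i ^ 4 * (y i : ℝ) ^ 4 := by
    intro y
    have a1 := sq_sum_le_card_mul_sum_sq (s := Finset.univ) (f := fun i : Fin d => k i * (y i : ℝ))
    have a2 := sq_sum_le_card_mul_sum_sq (s := Finset.univ) (f := fun i : Fin d => (k i * (y i : ℝ)) ^ 2)
    simp only [Finset.card_univ, Fintype.card_fin] at a1 a2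
    calc (∑ i, k i * (y i : ℝ)) ^ 4 = ((∑ i, k i * (y i : ℝ)) ^ 2) ^ 2 := by ring
      _ ≤ (d * ∑ i, (k i * (y i : ℝ)) ^ 2) ^ 2 := by gcongr
      _ = d ^ 2 * (∑ i, (k i * (y i : ℝ)) ^ 2) ^ 2 := by ring
      _ ≤ d ^ 2 * (d * ∑ i, ((k i * (y i : ℝ)) ^ 2) ^ 2) := by gcongr
      _ = _ := by
        rw [← mul_assoc, ← pow_succ]; congr 1
        exact Finset.sum_congr rfl fun i _ => by ring
  have hle : ∀ y, p y * Real.cos (∑ i, k i * (y i : ℝ)) ≤ p y - (p y * (∑ i, k i * (y i : ℝ)) ^ 2) / 2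
      + ∑ i, d ^ 3 / 2 * k i ^ 4 * (p y * (y i : ℝ) ^ 4) := by
    intro y
    have a1 := mul_le_mul_of_nonneg_left (cos_le_quartic (∑ i, k i * (y i : ℝ))) (hp0 y)
    have a2 := mul_le_mul_of_nonneg_left (h4 y) (hp0 y)
    have a3 : ∑ i, d ^ 3 / 2 * k i ^ 4 * (p y * (y i : ℝ) ^ 4) = p y * (d ^ 3 * ∑ i, k i ^ 4 * (y i : ℝ) ^ 4) / 2 := by
      rw [Finset.mul_sum, Finset.mul_sum, Finset.sum_div]
      exact Finset.sum_congr rfl fun i _ => by ring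
    rw [a3]; nlinarith
  have s4 : ∀ i ∈ Finset.univ, Summable fun y => d ^ 3 / 2 * k i ^ 4 * (p y * (y i : ℝ) ^ 4) :=
    fun i _ => (hcm i).1.mul_left _
  have hsr := ((hp.sub (s2.div_const 2)).add (summable_sum s4))
  have key := (cos_summable hp0 hsym hM hp _).tsum_le_tsum hle hsr
  rw [(hp.sub (s2.div_const 2)).tsum_add (summable_sum s4), hp.tsum_sub (s2.div_const 2), hsum,
    Summable.tsum_finsetSum s4, tsum_div_const] at key
  have b4 : ∑ i, ∑' y, d ^ 3 / 2 * k i ^ 4 * (p y * (y i : ℝ) ^ 4) ≤ (∑ i, k i ^ 2) * ξ ^ 2 / (4 * d) := by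
    rw [Finset.sum_mul, Finset.sum_div]
    refine Finset.sum_le_sum fun i _ => ?_
    rw [tsum_mul_left]
    have c1 : ∑' y, p y * (y i : ℝ) ^ 4 ≤ 48 / s ^ 4 := by
      rw [le_div_iff₀ (by positivity)]; linarith [(hcm i).2]
    have c2 : k i ^ 2 ≤ (s ^ 2 * ξ / (10 * d ^ 2)) ^ 2 := by
      rw [← sq_abs]; gcongr; exact hk i
    calc d ^ 3 / 2 * k i ^ 4 * ∑' y, p y * (y i : ℝ) ^ 4 ≤ d ^ 3 / 2 * k i ^ 4 * (48 / s ^ 4) := by gcongr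
      _ = d ^ 3 / 2 * k i ^ 2 * (48 / s ^ 4) * k i ^ 2 := by ring
      _ ≤ d ^ 3 / 2 * k i ^ 2 * (48 / s ^ 4) * (s ^ 2 * ξ / (10 * d ^ 2)) ^ 2 := by gcongr
      _ = k i ^ 2 * ξ ^ 2 / d * (24 / 100) := by field_simp; ring
      _ ≤ k i ^ 2 * ξ ^ 2 / d * (1 / 4) := mul_le_mul_of_nonneg_left (by norm_num) (by positivity)
      _ = _ := by field_simp
  have e2' : ∑' y, p y * (∑ i, k i * (y i : ℝ)) ^ 2 / 2 = (∑ i, k i ^ 2) * ξ ^ 2 / (2 * d) := by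
    rw [tsum_div_const]; field_simp; linarith
  rw [tsum_div_const] at e2'
  rw [e2'] at key
  have : (∑ i, k i ^ 2) * ξ ^ 2 / (2 * d) = (∑ i, k i ^ 2) * ξ ^ 2 / (4 * d) + (∑ i, k i ^ 2) * ξ ^ 2 / (4 * d) := by
    field_simp; ring
  linarith

end

end NC

namespace NC
variable {d : ℕ}

theorem ell_neg (y : Zd d) : ell (-y) = - ell y := by simp [ell]

theorem cs_ne_top_summable {w : Zd d → ℝ} (hw : ∀ y, 0 ≤ w y) {F : Cv d}
    (h : cs (fun y => ENNReal.ofReal (w y)) F ≠ ∞) :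
    (Summable fun y => re F y * w y) ∧ ∑' y, re F y * w y = (cs (fun y => ENNReal.ofReal (w y)) F).toReal := by
  have e : ∀ y, re F y * w y = (F y * ENNReal.ofReal (w y)).toReal := by
    intro y; rw [ENNReal.toReal_mul, ENNReal.toReal_ofReal (hw y)]; rfl
  simp_rw [e]
  refine ⟨ENNReal.summable_toReal h, ?_⟩
  unfold cs
  rw [ENNReal.tsum_toReal_eq]
  exact fun y => ENNReal.ne_top_of_tsum_ne_top h y

theorem re_symm {F : Cv d} (h : IsSymmFun F) : IsSymmFun (re F) := by
  intro π e x
  unfold re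
  rw [h π e x]

theorem tilt_cosh {F : Cv d} (hF : IsSymmFun F) {s : ℝ} (h : cs (ew s) F ≠ ∞) :
    (Summable fun y => re F y * Real.exp (s * ell y)) ∧
    (Summable fun y => re F y * Real.cosh (s * ell y)) ∧
    ∑' y, re F y * Real.cosh (s * ell y) = (cs (ew s) F).toReal := by
  obtain ⟨h1, h2⟩ := cs_ne_top_summable (w := fun y => Real.exp (s * ell y)) (fun y => (Real.exp_pos _).le) h
  have h3 : Summable fun y => re F y * Real.exp (-(s * ell y)) := by
    refine (((Equiv.neg (Zd d)).summable_iff).mpr h1).congr fun y => ?_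
    show re F (-y) * Real.exp (s * ell (-y)) = _
    rw [symm_neg (re_symm hF), ell_neg, mul_neg]
  have h4 : ∑' y, re F y * Real.exp (-(s * ell y)) = (cs (ew s) F).toReal := by
    rw [show (cs (ew s) F).toReal = _ from h2.symm, ← (Equiv.neg (Zd d)).tsum_eq]
    refine tsum_congr fun y => ?_
    show re F (-y) * Real.exp (-(s * ell (-y))) = _
    rw [symm_neg (re_symm hF), ell_neg, mul_neg, neg_neg]
  have e : ∀ y, re F y * Real.cosh (s * ell y) = (re F y * Real.exp (s * ell y) + re F y * Real.exp (-(s * ell y))) / 2 := by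
    intro y; rw [Real.cosh_eq]; ring
  simp_rw [e]
  refine ⟨h1, (h1.add h3).div_const 2, ?_⟩
  rw [tsum_div_const, h1.tsum_add h3, h2, h4]
  show ((cs (ew s) F).toReal + _) / 2 = _
  ring

theorem tilt_re {F : Cv d} (hF : IsSymmFun F) (hm : mass F ≠ ∞) {s : ℝ} (h : cs (ew s) F ≠ ∞) (k : Fin d → ℝ) :
    (hat (re (tilt s F)) k).re ≤ (cs (ew s) F).toReal - (mass F).toReal
      + ∑' y, re F y * Real.cos (∑ i, k i * (y i : ℝ)) := by
  obtain ⟨h1, h2, h3⟩ := tilt_cosh hF h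
  have hsF := re_summable hm
  have hmF : ∑' y, re F y = (mass F).toReal := by
    rw [mass_eq, ENNReal.tsum_toReal_eq (apply_ne_top hm)]; rfl
  set c : Zd d → ℝ := fun y => Real.cos (∑ i, k i * (y i : ℝ)) with hc
  have hcb : ∀ y, |c y| ≤ 1 := fun y => Real.abs_cos_le_one _
  have hcn : ∀ y, c (-y) = c y := by
    intro y
    simp only [hc]
    rw [← Real.cos_neg]; congr 1
    rw [← Finset.sum_neg_distrib]
    exact Finset.sum_congr rfl fun i _ => by simp
  have bd : ∀ {g : Zd d → ℝ}, (∀ y, 0 ≤ g y) → Summable g → Summable fun y => g y * c y := by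
    intro g hg hs
    refine Summable.of_norm_bounded hs fun y => ?_
    rw [norm_mul, Real.norm_of_nonneg (hg y), Real.norm_eq_abs]
    exact mul_le_of_le_one_right (hg y) (hcb y)
  have e1 : ∀ y, re (tilt s F) y = re F y * Real.exp (s * ell y) := by
    intro y; unfold re tilt ew
    rw [ENNReal.toReal_mul, ENNReal.toReal_ofReal (Real.exp_pos _).le]
  have hre : (hat (re (tilt s F)) k).re = ∑' y, re F y * Real.exp (s * ell y) * c y := by
    rw [hat_def, Complex.re_tsum]
    · refine tsum_congr fun y => ?_
      rw [e1, Complex.re_ofReal_mul]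
      congr 1
      unfold ph
      rw [mul_comm Complex.I, Complex.exp_ofReal_mul_I_re]
    · refine hat_summable ?_ k
      exact h1.congr fun y => (e1 y).symm
  have s1 : Summable fun y => re F y * Real.exp (s * ell y) * c y :=
    bd (fun y => mul_nonneg (re_nonneg _ _) (Real.exp_pos _).le) h1
  have hneg : ∑' y, re F y * Real.exp (-(s * ell y)) * c y = ∑' y, re F y * Real.exp (s * ell y) * c y := by
    rw [← (Equiv.neg (Zd d)).tsum_eq]
    refine tsum_congr fun y => ?_
    show re F (-y) * Real.exp (-(s * ell (-y))) * c (-y) = _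
    rw [symm_neg (re_symm hF), ell_neg, mul_neg, neg_neg, hcn]
  have s2 : Summable fun y => re F y * Real.exp (-(s * ell y)) * c y := by
    refine (((Equiv.neg (Zd d)).summable_iff).mpr s1).congr fun y => ?_
    show re F (-y) * Real.exp (s * ell (-y)) * c (-y) = _
    rw [symm_neg (re_symm hF), ell_neg, mul_neg, hcn]
  have hch : ∑' y, re F y * Real.cosh (s * ell y) * c y = ∑' y, re F y * Real.exp (s * ell y) * c y := by
    have e : ∀ y, re F y * Real.cosh (s * ell y) * c y = (re F y * Real.exp (s * ell y) * c y + re F y * Real.exp (-(s * ell y)) * c y) / 2 := by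
      intro y; rw [Real.cosh_eq]; ring
    simp_rw [e]
    rw [tsum_div_const, s1.tsum_add s2, hneg]; ring
  rw [hre, ← hch, ← h3, ← hmF, ← h2.tsum_sub hsF]
  have s3 : Summable fun y => re F y * c y := bd (re_nonneg F) hsF
  rw [← (h2.sub hsF).tsum_add s3]
  refine (bd (fun y => mul_nonneg (re_nonneg _ _) (Real.cosh_pos _).le) h2).tsum_le_tsum ?_ ((h2.sub hsF).add s3)
  intro y
  have a1 := Real.one_le_cosh (s * ell y)
  have a2 := (abs_le.mp (hcb y)).2
  have a3 := re_nonneg F y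
  have : 0 ≤ re F y * ((Real.cosh (s * ell y) - 1) * (1 - c y)) :=
    mul_nonneg a3 (mul_nonneg (by linarith) (by linarith))
  nlinarith

theorem prod_le_one_add_sum_pow (z : Fin d → ℝ) (hz : ∀ i, 0 ≤ z i) : ∏ i, (1 + z i) ≤ (1 + ∑ i, z i) ^ d := by
  have : (1 + ∑ i, z i) ^ d = ∏ _i : Fin d, (1 + ∑ i, z i) := by simp
  rw [this]
  refine Finset.prod_le_prod (fun i _ => by linarith [hz i]) fun i _ => ?_
  gcongr
  exact Finset.single_le_sum (fun j _ => hz j) (Finset.mem_univ i)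

theorem step_mgf {F Fn : Cv d} {χ Δ K s : ℝ} (hΔ : 0 ≤ Δ) (hχ : 0 < χ) (hK : 1 ≤ K)
    (hmF : mass F = ENNReal.ofReal χ) (hmFn : mass Fn ≠ ∞)
    (hstep : Fn ≤ F + ENNReal.ofReal Δ • (F * Fn)) (hθ : Δ * χ ≤ 1 - 7 / (8 * K))
    (hM1 : cs (ew s) F ≤ ENNReal.ofReal (χ * (1 + 1 / (8 * K)))) :
    Fn ≤ F * geo (ENNReal.ofReal Δ) F ∧ ENNReal.ofReal Δ * cs (ew s) F < 1 ∧
    cs (ew s) Fn ≤ ENNReal.ofReal (2 * (χ * K)) := by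
  have hK0 : 0 < K := by linarith
  have hlt : ENNReal.ofReal Δ * mass F < 1 := by
    rw [hmF, ← ENNReal.ofReal_mul hΔ, ENNReal.ofReal_lt_one]
    have : 0 < 7 / (8 * K) := by positivity
    linarith
  have h1 := le_geo hstep hlt hmFn
  have hΔm : Δ * (χ * (1 + 1 / (8 * K))) ≤ 1 - 6 / (8 * K) := by
    calc Δ * (χ * (1 + 1 / (8 * K))) = (Δ * χ) * (1 + 1 / (8 * K)) := by ring
      _ ≤ (1 - 7 / (8 * K)) * (1 + 1 / (8 * K)) := by gcongr
      _ = 1 - 6 / (8 * K) - 7 / (8 * K) * (1 / (8 * K)) := by ring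
      _ ≤ _ := by
        have : 0 ≤ 7 / (8 * K) * (1 / (8 * K)) := by positivity
        linarith
  have hle : ENNReal.ofReal Δ * cs (ew s) F ≤ ENNReal.ofReal (1 - 6 / (8 * K)) := by
    calc _ ≤ ENNReal.ofReal Δ * ENNReal.ofReal (χ * (1 + 1 / (8 * K))) := by gcongr
      _ = ENNReal.ofReal (Δ * (χ * (1 + 1 / (8 * K)))) := (ENNReal.ofReal_mul hΔ).symm
      _ ≤ _ := ENNReal.ofReal_le_ofReal hΔm
  refine ⟨h1, lt_of_le_of_lt hle ?_, ?_⟩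
  · rw [ENNReal.ofReal_lt_one]
    have : 0 < 6 / (8 * K) := by positivity
    linarith
  · refine (cs_mono h1).trans ?_
    rw [cs_mul (ew_char s), cs_geo (ew_char s), ENNReal.tsum_geometric]
    have h2 : (1 - ENNReal.ofReal Δ * cs (ew s) F)⁻¹ ≤ ENNReal.ofReal (8 * K / 6) := by
      have h3 : ENNReal.ofReal (6 / (8 * K)) ≤ 1 - ENNReal.ofReal Δ * cs (ew s) F := by
        refine le_trans ?_ (tsub_le_tsub_left hle 1)
        rw [← ENNReal.ofReal_one, ← ENNReal.ofReal_sub _ (by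
          rw [sub_nonneg, div_le_one (by positivity)]; linarith)]
        exact ENNReal.ofReal_le_ofReal (by linarith)
      refine (ENNReal.inv_le_inv.mpr h3).trans ?_
      rw [← ENNReal.ofReal_inv_of_pos (by positivity), inv_div]
    refine (mul_le_mul' hM1 h2).trans ?_
    rw [← ENNReal.ofReal_mul (by positivity)]
    refine ENNReal.ofReal_le_ofReal ?_
    have : 1 / (8 * K) ≤ 1 / 8 := by
      apply one_div_le_one_div_of_le (by norm_num); linarith
    have h5 : 0 < χ * K := by positivity
    calc χ * (1 + 1 / (8 * K)) * (8 * K / 6) = (1 + 1 / (8 * K)) * (8 / 6) * (χ * K) := by ring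
      _ ≤ 2 * (χ * K) := by gcongr; linarith

theorem conv_bound {f W : Cv d} (hWm : mass W ≠ ∞) {A B : ℝ} (hA : 0 ≤ A) {g : Zd d → ℝ} (hg0 : ∀ y, 0 ≤ g y)
    (hg1 : ∀ y, g y ≤ 1) (hpt : ∀ y, f y ≤ ENNReal.ofReal (A * g y)) (x : Zd d)
    (hs : ∑' y, re W (x - y) * g y ≤ B) : (f * W) x ≤ ENNReal.ofReal (A * B) := by
  have hsx : Summable fun y => re W (x - y) :=
    ((Equiv.subLeft x).summable_iff (f := re W)).mpr (re_summable hWm)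
  have hn : ∀ y, 0 ≤ re W (x - y) := fun y => re_nonneg W (x - y)
  have hn2 : ∀ y, 0 ≤ re W (x - y) * g y := fun y => mul_nonneg (hn y) (hg0 y)
  have hn3 : ∀ y, re W (x - y) * g y ≤ re W (x - y) := fun y => mul_le_of_le_one_right (hn y) (hg1 y)
  have hsum : Summable fun y => re W (x - y) * g y := Summable.of_nonneg_of_le hn2 hn3 hsx
  rw [mul_apply]
  have h1 : ∑' y, f y * W (x - y) ≤ ∑' y, ENNReal.ofReal (A * (re W (x - y) * g y)) := by
    refine ENNReal.tsum_le_tsum fun y => ?_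
    have e : W (x - y) = ENNReal.ofReal (re W (x - y)) := (ENNReal.ofReal_toReal (apply_ne_top hWm _)).symm
    have e2 : ENNReal.ofReal (A * (re W (x - y) * g y)) =
        ENNReal.ofReal (A * g y) * ENNReal.ofReal (re W (x - y)) := by
      rw [← ENNReal.ofReal_mul (mul_nonneg hA (hg0 y))]
      congr 1; ring
    rw [e, e2]
    exact mul_le_mul_left (hpt y) _
  refine h1.trans ?_
  rw [← ENNReal.ofReal_tsum_of_nonneg (fun y => mul_nonneg hA (hn2 y)) (hsum.mul_left A)]
  refine ENNReal.ofReal_le_ofReal ?_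
  rw [tsum_mul_left]
  exact mul_le_mul_of_nonneg_left hs hA

set_option maxHeartbeats 1000000 in
theorem step_point {F Fn : Cv d} {χ Δ K s a ξ A : ℝ} (hd : 0 < d) (hΔ : 0 ≤ Δ) (hχ : 0 < χ) (hK : 1 ≤ K)
    (ha : 0 < a) (hξ : 0 < ξ) (hA : 0 ≤ A) (hF : IsSymmFun F)
    (hmF : mass F = ENNReal.ofReal χ) (hmFn : mass Fn ≠ ∞)
    (hstep : Fn ≤ F + ENNReal.ofReal Δ • (F * Fn)) (hθ : Δ * χ ≤ 1 - 7 / (8 * K))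
    (hM1 : cs (ew s) F ≤ ENNReal.ofReal (χ * (1 + 1 / (8 * K))))
    (hfo : ∀ k : Fin d → ℝ, (∀ i, |k i| ≤ a) → ∑' y, re F y * Real.cos (∑ i, k i * (y i : ℝ)) ≤
      χ * (1 - (∑ i, k i ^ 2) * ξ ^ 2 / (4 * d)))
    (hpt : ∀ y, tilt s (F ^ d) y ≤ ENNReal.ofReal (A * ∏ i, (1 + a * |(y i : ℝ)|)⁻¹ ^ 2)) (x : Zd d) :
    tilt s (Fn ^ d) x ≤ ENNReal.ofReal (A * (80 * K / (a * (ξ * √(K / (4 * d))))) ^ d) := by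
  have hK0 : 0 < K := by linarith
  have hd' : (0:ℝ) < d := by exact_mod_cast hd
  obtain ⟨h1, h2, -⟩ := step_mgf hΔ hχ hK hmF hmFn hstep hθ hM1
  have hmF' : mass F ≠ ∞ := by rw [hmF]; exact ENNReal.ofReal_ne_top
  have hcsF : cs (ew s) F ≠ ∞ := ne_top_of_le_ne_top ENNReal.ofReal_ne_top hM1
  set f := tilt s F with hf
  have hmf : mass f ≠ ∞ := by rw [hf, mass_tilt]; exact hcsF
  have h2' : ENNReal.ofReal Δ * mass f < 1 := by rw [hf, mass_tilt]; exact h2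
  set V := geo (ENNReal.ofReal Δ) f with hV
  have hVm : mass V ≠ ∞ := by
    rw [hV, mass_geo]; simpa using (tsub_pos_of_lt h2').ne'
  set W := V ^ d with hW
  have hWm : mass W ≠ ∞ := by rw [hW, mass_pow]; exact ENNReal.pow_ne_top hVm
  set b := ξ * √(K / (4 * d)) with hb
  have hb0 : 0 < b := by positivity
  have hb2 : b ^ 2 = K * ξ ^ 2 / (4 * d) := by
    rw [hb, mul_pow, Real.sq_sqrt (by positivity)]; ring
  have hhat : ∀ k : Fin d → ℝ, (∀ i, |k i| ≤ a) → ‖hat (re W) k‖ ≤ ∏ i, (4 * K * (1 / (1 + (b * k i) ^ 2))) := by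
    intro k hk
    rw [hW, hat_pow hVm, norm_pow]
    set P := (∑' y, re F y * Real.cos (∑ i, k i * (y i : ℝ))) / χ with hP
    have hP1 : P ≤ 1 - (∑ i, k i ^ 2) * ξ ^ 2 / (4 * d) := by
      rw [hP, div_le_iff₀ hχ]; linarith [hfo k hk]
    have hP2 : -1 ≤ P := by
      rw [hP, le_div_iff₀ hχ]
      have hsF := re_summable hmF'
      have e : ∑' y, re F y = χ := by
        have : ∑' y, re F y = (mass F).toReal := by
          rw [mass_eq, ENNReal.tsum_toReal_eq (apply_ne_top hmF')]; rfl
        rw [this, hmF, ENNReal.toReal_ofReal hχ.le]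
      rw [← e, ← tsum_mul_left]
      refine (hsF.mul_left (-1)).tsum_le_tsum ?_ ?_
      · intro y
        have := Real.neg_one_le_cos (∑ i, k i * (y i : ℝ))
        nlinarith [re_nonneg F y]
      · refine Summable.of_norm_bounded hsF fun y => ?_
        rw [norm_mul, Real.norm_of_nonneg (re_nonneg _ y), Real.norm_eq_abs]
        exact mul_le_of_le_one_right (re_nonneg _ y) (Real.abs_cos_le_one _)
    have hre : (hat (re f) k).re ≤ χ * (1 / (8 * K)) + χ * P := by
      refine (tilt_re hF hmF' hcsF k).trans ?_
      have e1 : (cs (ew s) F).toReal ≤ χ * (1 + 1 / (8 * K)) := by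
        have := ENNReal.toReal_mono ENNReal.ofReal_ne_top hM1
        rwa [ENNReal.toReal_ofReal (by positivity)] at this
      have e2 : (mass F).toReal = χ := by rw [hmF, ENNReal.toReal_ofReal hχ.le]
      have e3 : χ * P = ∑' y, re F y * Real.cos (∑ i, k i * (y i : ℝ)) := by rw [hP]; field_simp
      rw [e2, e3]; linarith
    have hz : 0 ≤ (∑ i, k i ^ 2) * ξ ^ 2 / (4 * d) := by positivity
    set z := (∑ i, k i ^ 2) * ξ ^ 2 / (4 * d) with hzd
    have hlow : (1 + K * z) / (4 * K) ≤ ‖1 - Δ * hat (re f) k‖ := by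
      refine le_trans ?_ (Complex.re_le_norm _)
      have : (1 - (Δ:ℂ) * hat (re f) k).re = 1 - Δ * (hat (re f) k).re := by simp
      rw [this]
      have h3 : Δ * (hat (re f) k).re ≤ Δ * (χ * (1 / (8 * K)) + χ * P) := mul_le_mul_of_nonneg_left hre hΔ
      have h4 : (1 + K * z) / (4 * K) = 1 / (4 * K) + z / 4 := by field_simp
      rw [h4]
      set θ := Δ * χ with hθd
      have hθ0 : 0 ≤ θ := by positivity
      have i1 : 7 / (8 * K) = 7 * (1 / (8 * K)) := by ring
      have i2 : 1 / (4 * K) = 2 * (1 / (8 * K)) := by field_simp; norm_num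
      have i3 : 0 < 1 / (8 * K) := by positivity
      set q := 1 / (8 * K)
      rw [i2]
      rw [i1] at hθ
      have h5 : Δ * (χ * q + χ * P) = θ * q + θ * P := by rw [hθd]; ring
      rw [h5] at h3
      have h6 : θ * q ≤ q := by nlinarith
      have h7 : (1 - θ) / 2 + (1 - P) / 4 ≤ 1 - θ * P := by
        by_cases ht : 1 / 4 ≤ θ
        · nlinarith
        · nlinarith
      linarith
    have hge := hat_geo hΔ hmf h2' k
    rw [← hV] at hge
    have hnorm : ‖hat (re V) k‖ * ‖1 - Δ * hat (re f) k‖ = 1 := by rw [← norm_mul, hge, norm_one]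
    have hpos : 0 < (1 + K * z) / (4 * K) := by positivity
    have hV1 : ‖hat (re V) k‖ ≤ 4 * K / (1 + K * z) := by
      have h8 : ‖hat (re V) k‖ * ((1 + K * z) / (4 * K)) ≤ 1 :=
        (mul_le_mul_of_nonneg_left hlow (norm_nonneg _)).trans_eq hnorm
      rw [← le_div_iff₀ hpos] at h8
      rwa [one_div_div] at h8
    calc ‖hat (re V) k‖ ^ d ≤ (4 * K / (1 + K * z)) ^ d := by gcongr
      _ = (4 * K) ^ d / (1 + K * z) ^ d := by rw [div_pow]
      _ ≤ (4 * K) ^ d / ∏ i, (1 + (b * k i) ^ 2) := by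
        refine div_le_div_of_nonneg_left (by positivity) (Finset.prod_pos fun i _ => by positivity) ?_
        refine (prod_le_one_add_sum_pow (fun i => (b * k i) ^ 2) (fun i => by positivity)).trans (le_of_eq ?_)
        congr 2
        simp_rw [mul_pow]
        rw [← Finset.mul_sum, hb2, hzd]; ring
      _ = _ := by
        rw [Finset.prod_mul_distrib]
        simp [div_eq_mul_inv]
  have hs := smooth2 (re W) (re_nonneg W) (re_summable hWm) a b (4 * K) ha hb0 (by positivity) hhat x
  have hle : tilt s (Fn ^ d) x ≤ (tilt s (F ^ d) * W) x := by
    have := tilt_mono s (cpow_le h1 d)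
    rw [mul_pow, tilt_mul, tilt_pow s (geo _ F), tilt_geo, ← hf, ← hV, ← hW] at this
    exact this x
  have hprod1 : ∀ y : Zd d, ∏ i, (1 + a * |(y i : ℝ)|)⁻¹ ^ 2 ≤ 1 := by
    intro y
    refine Finset.prod_le_one (fun i _ => by positivity) fun i _ => ?_
    refine pow_le_one₀ (by positivity) (inv_le_one_of_one_le₀ ?_)
    have : 0 ≤ a * |(y i : ℝ)| := by positivity
    linarith
  have hprod0 : ∀ y : Zd d, 0 ≤ ∏ i, (1 + a * |(y i : ℝ)|)⁻¹ ^ 2 := fun y =>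
    Finset.prod_nonneg fun i _ => by positivity
  have hfin := conv_bound (f := tilt s (F ^ d)) hWm hA hprod0 hprod1 hpt x hs
  have e : 20 * (4 * K) / (a * b) = 80 * K / (a * b) := by ring
  rw [e] at hfin
  exact le_trans hle hfin

end NC

namespace NC
variable {d : ℕ}

theorem cs_of_summable {w : Zd d → ℝ} (hw : ∀ y, 0 ≤ w y) {F : Cv d} (hF : ∀ y, F y ≠ ∞)
    (h : Summable fun y => re F y * w y) :
    cs (fun y => ENNReal.ofReal (w y)) F = ENNReal.ofReal (∑' y, re F y * w y) := by
  rw [ENNReal.ofReal_tsum_of_nonneg (fun y => mul_nonneg (re_nonneg F y) (hw y)) h]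
  unfold cs
  refine tsum_congr fun y => ?_
  rw [ENNReal.ofReal_mul (re_nonneg F y)]
  congr 1
  exact (ENNReal.ofReal_toReal (hF y)).symm

theorem cs_ew_cosh {F : Cv d} (hF : IsSymmFun F) (s : ℝ) :
    cs (ew s) F = cs (fun y => ENNReal.ofReal (Real.cosh (s * ell y))) F := by
  have h1 : cs (ew s) F = cs (ew (-s)) F := by
    unfold cs
    rw [← (Equiv.neg (Zd d)).tsum_eq]
    refine tsum_congr fun y => ?_
    show F (-y) * ew s (-y) = _
    rw [symm_neg (f := F) hF]
    unfold ew
    rw [ell_neg, neg_mul, mul_neg]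
  have h2 : 2 * cs (ew s) F = 2 * cs (fun y => ENNReal.ofReal (Real.cosh (s * ell y))) F := by
    rw [two_mul]
    nth_rw 2 [h1]
    unfold cs
    rw [← ENNReal.tsum_add, ← ENNReal.tsum_mul_left]
    refine tsum_congr fun y => ?_
    rw [← mul_add]
    unfold ew
    rw [← ENNReal.ofReal_add (Real.exp_pos _).le (Real.exp_pos _).le, mul_left_comm]
    congr 1
    rw [← ENNReal.ofReal_ofNat, ← ENNReal.ofReal_mul (by norm_num), Real.cosh_eq]
    congr 1; rw [neg_mul]; ring
  exact (ENNReal.mul_right_inj (by simp) (by simp)).mp h2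

/-- static data of a symmetric finite-mass kernel -/
structure Dat (F : Cv d) (χ ξ : ℝ) : Prop where
  symm : IsSymmFun F
  chi_pos : 0 < χ
  xi_pos : 0 < ξ
  mass : mass F = ENNReal.ofReal χ
  sq : cs sq F = ENNReal.ofReal (χ * ξ ^ 2)

namespace Dat
variable {F : Cv d} {χ ξ : ℝ} (D : Dat F χ ξ)
include D

theorem mass_ne : NC.mass F ≠ ∞ := by rw [D.mass]; exact ENNReal.ofReal_ne_top

theorem tsum_re : ∑' y, re F y = χ := by
  have : ∑' y, re F y = (NC.mass F).toReal := by
    rw [mass_eq, ENNReal.tsum_toReal_eq (apply_ne_top D.mass_ne)]; rfl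
  rw [this, D.mass, ENNReal.toReal_ofReal D.chi_pos.le]

theorem tsum_sq : (Summable fun y => re F y * sqNorm y) ∧ ∑' y, re F y * sqNorm y = χ * ξ ^ 2 := by
  have hne : cs (fun y => ENNReal.ofReal (sqNorm y)) F ≠ ∞ := by
    rw [show cs (fun y => ENNReal.ofReal (sqNorm y)) F = _ from D.sq]; exact ENNReal.ofReal_ne_top
  obtain ⟨h1, h2⟩ := cs_ne_top_summable sqNorm_nonneg hne
  refine ⟨h1, ?_⟩
  rw [h2, show cs (fun y => ENNReal.ofReal (sqNorm y)) F = _ from D.sq, ENNReal.toReal_ofReal]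
  have := D.chi_pos; positivity

theorem norm_symm : IsSymmFun (fun y => re F y / χ) := by
  intro π e x
  have := (re_symm D.symm) π e x
  simp only
  rw [this]

theorem fourier (hd : 0 < d) {s : ℝ} (hs : 0 < s) (hM : cs (ew s) F ≤ ENNReal.ofReal (2 * χ)) (k : Fin d → ℝ)
    (hk : ∀ i, |k i| ≤ s ^ 2 * ξ / (10 * d ^ 2)) :
    ∑' y, re F y * Real.cos (∑ i, k i * (y i : ℝ)) ≤ χ * (1 - (∑ i, k i ^ 2) * ξ ^ 2 / (4 * d)) := by
  have hχ := D.chi_pos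
  have hcs : cs (ew s) F ≠ ∞ := ne_top_of_le_ne_top ENNReal.ofReal_ne_top hM
  obtain ⟨-, h2, h3⟩ := tilt_cosh D.symm hcs
  have e : ∀ w : Zd d → ℝ, ∀ y, re F y / χ * w y = (re F y * w y) / χ := fun w y => by ring
  have hM' : Summable fun y => re F y / χ * Real.cosh (s * ell y) := by
    simp_rw [e (fun y => Real.cosh (s * ell y))]; exact h2.div_const _
  have := fourier_low (p := fun y => re F y / χ) (fun y => div_nonneg (re_nonneg F y) hχ.le) D.norm_symm
    (s := s) hM' ((re_summable D.mass_ne).div_const _)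
    (by rw [tsum_div_const, D.tsum_re, div_self hχ.ne']) hd D.xi_pos hs
    (by
      simp_rw [e (fun y => Real.cosh (s * ell y))]
      rw [tsum_div_const, h3, div_le_iff₀ hχ]
      have := ENNReal.toReal_mono ENNReal.ofReal_ne_top hM
      rwa [ENNReal.toReal_ofReal (by positivity)] at this)
    (by
      simp_rw [e sqNorm]
      rw [tsum_div_const, D.tsum_sq.2]; field_simp) k hk
  simp_rw [e (fun y => Real.cos (∑ i, k i * (y i : ℝ)))] at this
  rw [tsum_div_const, div_le_iff₀ hχ] at this
  linarith

theorem tsum_ell (hd : 0 < d) {s : ℝ} (hs : 0 < s) (hcs : cs (ew s) F ≠ ∞) :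
    (Summable fun y => re F y * ell y ^ 2) ∧ ∑' y, re F y * ell y ^ 2 = χ * ξ ^ 2 := by
  obtain ⟨-, h2, -⟩ := tilt_cosh D.symm hcs
  obtain ⟨h4, h5⟩ := second_moment (re_nonneg F) (re_symm D.symm) h2 hs D.tsum_sq.2 (fun _ => 1)
  simp only [one_mul] at h4 h5
  refine ⟨h4, ?_⟩
  have hd' : (d:ℝ) ≠ 0 := by exact_mod_cast hd.ne'
  have h6 : (d:ℝ) * ∑' y, re F y * ell y ^ 2 = d * (χ * ξ ^ 2) := by
    rw [show (∑' y, re F y * ell y ^ 2) = _ from rfl]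
    unfold ell
    rw [h5]; simp
  exact mul_left_cancel₀ hd' h6

theorem mgf_compare (hd : 0 < d) {s s' α γ : ℝ} (hs : 0 < s) (hα : 0 ≤ α) (hγ : 0 ≤ γ)
    (hM : cs (ew s) F ≤ ENNReal.ofReal (2 * χ))
    (hc : ∀ y, F y ≠ 0 → Real.cosh (s' * ell y) ≤ 1 + α * ell y ^ 2 + γ * Real.cosh (s * ell y)) :
    cs (ew s') F ≤ ENNReal.ofReal (χ * (1 + α * ξ ^ 2 + 2 * γ)) := by
  have hχ := D.chi_pos
  have hcs : cs (ew s) F ≠ ∞ := ne_top_of_le_ne_top ENNReal.ofReal_ne_top hM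
  obtain ⟨-, h2, h3⟩ := tilt_cosh D.symm hcs
  obtain ⟨h4, h5⟩ := D.tsum_ell hd hs hcs
  have h6 := re_summable D.mass_ne
  have hle : ∀ y, re F y * Real.cosh (s' * ell y) ≤ re F y + α * (re F y * ell y ^ 2) + γ * (re F y * Real.cosh (s * ell y)) := by
    intro y
    by_cases hy : F y = 0
    · have : re F y = 0 := by simp [re, hy]
      rw [this]; simp
    · have := mul_le_mul_of_nonneg_left (hc y hy) (re_nonneg F y)
      linarith
  have hS := (h6.add (h4.mul_left α)).add (h2.mul_left γ)
  have h7 : Summable fun y => re F y * Real.cosh (s' * ell y) :=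
    Summable.of_nonneg_of_le (fun y => mul_nonneg (re_nonneg F y) (Real.cosh_pos _).le) hle hS
  have h8 := h7.tsum_le_tsum hle hS
  rw [(h6.add (h4.mul_left α)).tsum_add (h2.mul_left γ), h6.tsum_add (h4.mul_left α), tsum_mul_left, tsum_mul_left,
    D.tsum_re, h5, h3] at h8
  rw [cs_ew_cosh D.symm, cs_of_summable (fun y => (Real.cosh_pos _).le) (apply_ne_top D.mass_ne) h7]
  refine ENNReal.ofReal_le_ofReal (h8.trans ?_)
  have h9 := ENNReal.toReal_mono ENNReal.ofReal_ne_top hM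
  rw [ENNReal.toReal_ofReal (by positivity)] at h9
  have := mul_le_mul_of_nonneg_left h9 hγ
  nlinarith

end Dat

def el1 (y : Zd d) : ℝ := ∑ i, |(y i : ℝ)|

theorem ell_le_el1 (y : Zd d) : ell y ≤ el1 y := Finset.sum_le_sum fun _ _ => le_abs_self _

theorem abs_tilt {F : Cv d} (hF : IsSymmFun F) {s A : ℝ} (hA : 0 ≤ A) (h : ∀ x, tilt s F x ≤ ENNReal.ofReal A) (y : Zd d) :
    F y ≤ ENNReal.ofReal (A * Real.exp (-s * el1 y)) := by
  set e : Fin d → Bool := fun i => decide (y i < 0)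
  have h1 := h (act (Equiv.refl _) e y)
  have h2 : ell (act (Equiv.refl _) e y) = el1 y := by
    unfold ell el1
    refine Finset.sum_congr rfl fun i _ => ?_
    rw [act_apply]
    by_cases hy : y i < 0
    · have : (y i : ℝ) < 0 := by exact_mod_cast hy
      simp [e, hy, sgn, abs_of_neg this]
    · have : (0:ℝ) ≤ y i := by exact_mod_cast not_lt.mp hy
      simp [e, hy, sgn, abs_of_nonneg this]
  unfold tilt ew at h1
  rw [(symm_iff F).1 hF, h2] at h1
  have h3 : F y = F y * ENNReal.ofReal (Real.exp (s * el1 y)) * ENNReal.ofReal (Real.exp (-s * el1 y)) := by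
    rw [mul_assoc, ← ENNReal.ofReal_mul (Real.exp_pos _).le, ← Real.exp_add]
    simp
  rw [h3, ENNReal.ofReal_mul hA]
  gcongr

theorem tilt_decay {F : Cv d} {s s' a A : ℝ} (hA : 0 ≤ A) (hs' : 0 ≤ s') (hss : s' ≤ s / 2) (ha : 0 ≤ a) (has : 4 * a ≤ s)
    (h : ∀ y, F y ≤ ENNReal.ofReal (A * Real.exp (-s * el1 y))) (y : Zd d) :
    tilt s' F y ≤ ENNReal.ofReal (A * ∏ i, (1 + a * |(y i : ℝ)|)⁻¹ ^ 2) := by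
  unfold tilt ew
  refine (mul_le_mul_left (h y) _).trans ?_
  have h0 : 0 ≤ A * Real.exp (-s * el1 y) := mul_nonneg hA (Real.exp_pos _).le
  rw [← ENNReal.ofReal_mul h0]
  refine ENNReal.ofReal_le_ofReal ?_
  rw [mul_assoc, ← Real.exp_add]
  refine mul_le_mul_of_nonneg_left ?_ hA
  have hel : 0 ≤ el1 y := Finset.sum_nonneg fun _ _ => abs_nonneg _
  have h1 : -s * el1 y + s' * ell y ≤ ∑ i, -(2 * a * |(y i : ℝ)|) := by
    have a1 : s' * ell y ≤ s / 2 * el1 y := by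
      calc s' * ell y ≤ s' * el1 y := by gcongr; exact ell_le_el1 y
        _ ≤ _ := by gcongr
    have a2 : ∑ i, -(2 * a * |(y i : ℝ)|) = - (2 * a * el1 y) := by
      rw [Finset.sum_neg_distrib, ← Finset.mul_sum]; rfl
    rw [a2]
    have : 2 * a * el1 y ≤ s / 2 * el1 y := by gcongr; linarith
    linarith
  refine (Real.exp_le_exp.mpr h1).trans ?_
  rw [Real.exp_sum]
  refine Finset.prod_le_prod (fun i _ => (Real.exp_pos _).le) fun i _ => ?_
  rw [Real.exp_neg, inv_pow]
  refine inv_anti₀ (by positivity) ?_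
  have : 2 * a * |(y i : ℝ)| = (2:ℕ) * (a * |(y i : ℝ)|) := by push_cast; ring
  rw [this, Real.exp_nat_mul]
  gcongr
  linarith [Real.add_one_le_exp (a * |(y i : ℝ)|)]

end NC

namespace NC
variable {d : ℕ}

theorem theta_bd {Δ χ χ' δ : ℝ} (hχ : 0 < χ) (hle : χ ≤ χ') (hδ : 0 ≤ δ) (hδK : δ * (χ' / χ) ≤ 1 / 8)
    (hlow : (1 - δ) * Δ ≤ 1 / χ - 1 / χ') : Δ * χ ≤ 1 - 7 / (8 * (χ' / χ)) ∧ δ ≤ 1 / 8 := by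
  have hK : 1 ≤ χ' / χ := by rw [le_div_iff₀ hχ]; linarith
  have hχ' : 0 < χ' := by linarith
  set K := χ' / χ with hKd
  have hK0 : 0 < K := by linarith
  have h1 : (1 - δ) * (Δ * χ) ≤ 1 - 1 / K := by
    have : (1 / χ - 1 / χ') * χ = 1 - 1 / K := by rw [hKd]; field_simp
    rw [← this, ← mul_assoc]; gcongr
  have hδ2 : δ ≤ 1 / (8 * K) := by rw [le_div_iff₀ (by positivity)]; linarith
  have hδ3 : δ ≤ 1 / 8 := by nlinarith
  have e1 : 1 / (8 * K) = 1 / K / 8 := by field_simp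
  have e2 : 7 / (8 * K) = 7 * (1 / K) / 8 := by field_simp
  have hp : 0 < 1 / K := by positivity
  have hθ1 : Δ * χ ≤ 1 := by
    by_contra h
    push Not at h
    nlinarith
  refine ⟨?_, hδ3⟩
  rw [e2]
  rw [e1] at hδ2
  nlinarith

theorem xi_up {F Fn : Cv d} {χ χ' ξ ξ' Δ : ℝ} (D : Dat F χ ξ) (D' : Dat Fn χ' ξ') (hΔ : 0 ≤ Δ)
    (hle : χ ≤ χ') (hstep : Fn ≤ F + ENNReal.ofReal Δ • (F * Fn))
    (hθ : Δ * χ ≤ 1 - 7 / (8 * (χ' / χ))) : ξ' ^ 2 ≤ 4 * (χ' / χ) * ξ ^ 2 := by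
  have hχ := D.chi_pos
  have hχ' := D'.chi_pos
  have hK : 1 ≤ χ' / χ := by rw [le_div_iff₀ hχ]; linarith
  have h := cs_mono (w := sq) hstep
  rw [cs_add, cs_smul, cs_sq_mul _ _ (fun x => symm_neg D.symm x), D.sq, D'.sq, D.mass, D'.mass] at h
  rw [← ENNReal.ofReal_mul (by positivity), ← ENNReal.ofReal_mul (by positivity), ← ENNReal.ofReal_add (by positivity) (by positivity),
    ← ENNReal.ofReal_mul (by positivity), ← ENNReal.ofReal_add (by positivity) (by positivity),
    ENNReal.ofReal_le_ofReal_iff (by positivity)] at h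
  set K := χ' / χ with hKd
  have hK0 : 0 < K := by linarith
  have e : χ' = K * χ := by rw [hKd]; field_simp
  rw [e] at h
  have h2 : K * ξ' ^ 2 * (1 - Δ * χ) ≤ ξ ^ 2 * (1 + Δ * χ * K) := by
    have : χ * (K * ξ' ^ 2 * (1 - Δ * χ)) ≤ χ * (ξ ^ 2 * (1 + Δ * χ * K)) := by linarith
    exact le_of_mul_le_mul_left this hχ
  have h3 : K * ξ' ^ 2 * (7 / (8 * K)) ≤ K * ξ' ^ 2 * (1 - Δ * χ) := by
    gcongr; linarith
  have h4 : K * ξ' ^ 2 * (7 / (8 * K)) = 7 / 8 * ξ' ^ 2 := by field_simp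
  have h5 : 0 < 7 / (8 * K) := by positivity
  have h6 : ξ ^ 2 * (1 + Δ * χ * K) ≤ ξ ^ 2 * (2 * K) := by
    gcongr
    nlinarith
  nlinarith [sq_nonneg ξ, sq_nonneg ξ']

def C2 (d : ℕ) (s0 : ℝ) : ℝ := 320 * √d / (s0 ^ 2 / (10 * d ^ 2))

theorem fam_step (hd : 0 < d) {F Fn : Cv d} {χ χ' ξ ξ' Δ δ s0 B : ℝ} (D : Dat F χ ξ) (D' : Dat Fn χ' ξ') (hΔ : 0 ≤ Δ)
    (hle : χ ≤ χ') (hstep : Fn ≤ F + ENNReal.ofReal Δ • (F * Fn)) (hδ : 0 ≤ δ) (hδK : δ * (χ' / χ) ≤ 1 / 8)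
    (hlow : (1 - δ) * Δ ≤ 1 / χ - 1 / χ') (hs0 : 0 < s0) (hB : 0 ≤ B)
    (hM : cs (ew (s0 / ξ)) F ≤ ENNReal.ofReal (2 * χ))
    (hρ : cs (ew (s0 / ξ')) F ≤ ENNReal.ofReal (χ * (1 + 1 / (8 * (χ' / χ)))))
    (hpt : ∀ y, tilt (s0 / ξ') (F ^ d) y ≤ ENNReal.ofReal (B * (χ / ξ) ^ d *
      ∏ i, (1 + s0 ^ 2 / (10 * d ^ 2) / ξ * |(y i : ℝ)|)⁻¹ ^ 2)) :
    cs (ew (s0 / ξ')) Fn ≤ ENNReal.ofReal (2 * χ') ∧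
    ∀ x, tilt (s0 / ξ') (Fn ^ d) x ≤ ENNReal.ofReal (B * C2 d s0 ^ d * (χ' / ξ') ^ d) := by
  have hχ := D.chi_pos
  have hχ' := D'.chi_pos
  have hξ := D.xi_pos
  have hξ' := D'.xi_pos
  have hd' : (0:ℝ) < d := by exact_mod_cast hd
  have hK : 1 ≤ χ' / χ := by rw [le_div_iff₀ hχ]; linarith
  obtain ⟨hθ, -⟩ := theta_bd hχ hle hδ hδK hlow
  have hxi := xi_up D D' hΔ hle hstep hθ
  constructor
  · have h := (step_mgf hΔ hχ hK D.mass D'.mass_ne hstep hθ hρ).2.2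
    rwa [show χ * (χ' / χ) = χ' by field_simp] at h
  · intro x
    refine (step_point hd hΔ hχ hK (a := s0 ^ 2 / (10 * d ^ 2) / ξ) (by positivity) hξ (by positivity) D.symm
      D.mass D'.mass_ne hstep hθ hρ ?_ hpt x).trans ?_
    · intro k hk
      refine D.fourier hd (div_pos hs0 hξ) hM k fun i => (hk i).trans (le_of_eq ?_)
      field_simp
    · refine ENNReal.ofReal_le_ofReal ?_
      rw [mul_assoc B, mul_assoc B, ← mul_pow, ← mul_pow]
      refine mul_le_mul_of_nonneg_left (pow_le_pow_left₀ (by positivity) ?_ d) hB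
      set K := χ' / χ with hKd
      have hK0 : 0 < K := by linarith
      have e : χ' = K * χ := by rw [hKd]; field_simp
      rw [e]
      have hx2 : ξ' ≤ 2 * √K * ξ := by
        refine le_of_sq_le_sq (le_of_le_of_eq hxi ?_) (by positivity)
        rw [mul_pow, mul_pow, Real.sq_sqrt hK0.le]; norm_num
      have h4 : √(K / (4 * d)) = √K / (2 * √d) := by
        rw [Real.sqrt_div hK0.le, Real.sqrt_mul (by norm_num), show (4:ℝ) = 2 ^ 2 by norm_num, Real.sqrt_sq (by norm_num)]
      rw [h4]
      unfold C2
      set q := √K with hq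
      have hq2 : K = q ^ 2 := (Real.sq_sqrt hK0.le).symm
      have hq0 : 0 < q := Real.sqrt_pos.2 hK0
      have hd0 : 0 < √(d:ℝ) := Real.sqrt_pos.2 hd'
      rw [hq2]
      have e5 : χ / ξ * (80 * q ^ 2 / (s0 ^ 2 / (10 * d ^ 2) / ξ * (ξ * (q / (2 * √d))))) = 
        (320 * √d / (s0 ^ 2 / (10 * d ^ 2)) * χ) * (q ^ 2 / (2 * q * ξ)) := by
        field_simp; ring
      have e6 : 320 * √d / (s0 ^ 2 / (10 * d ^ 2)) * (q ^ 2 * χ / ξ') =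
        (320 * √d / (s0 ^ 2 / (10 * d ^ 2)) * χ) * (q ^ 2 / ξ') := by ring
      rw [e5, e6]
      refine mul_le_mul_of_nonneg_left ?_ (by positivity)
      exact div_le_div_of_nonneg_left (by positivity) hξ' hx2

end NC

namespace NC
variable {d : ℕ}

structure Fam (d : ℕ) (c0 R δ b : ℝ) (F : ℝ → Cv d) (χ ξ : ℝ → ℝ) : Prop where
  dat : ∀ t, 0 ≤ t → t ≤ b → Dat (F t) (χ t) (ξ t)
  mono : ∀ t z, 0 ≤ t → t ≤ z → z ≤ b → F t ≤ F z
  step : ∀ t z, 0 ≤ t → t ≤ z → z ≤ b → F z ≤ F t + ENNReal.ofReal (z - t) • (F t * F z)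
  chi0 : χ 0 = 1
  chi_low : ∀ t z, 0 ≤ t → t ≤ z → z ≤ b → (1 - δ) * (z - t) ≤ 1 / χ t - 1 / χ z
  chi_up : ∀ t z, 0 ≤ t → t ≤ z → z ≤ b → 1 / χ t - 1 / χ z ≤ z - t
  xi_low : ∀ t z, 0 ≤ t → t ≤ z → z ≤ b → ξ t ^ 2 * (χ z / χ t) ^ (1 - 2 * δ) ≤ ξ z ^ 2
  base_le : ∀ x, F 0 x ≤ ENNReal.ofReal (c0⁻¹ / R ^ d)
  base_supp : ∀ x, F 0 x ≠ 0 → supNorm x ≤ R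
  R1 : 1 ≤ R
  sig_low : c0 * R ≤ ξ 0
  sig_up : ξ 0 ^ 2 ≤ d * R ^ 2

theorem abs_le_supNorm (x : Zd d) (i : Fin d) : |(x i : ℝ)| ≤ supNorm x := by
  unfold supNorm
  rw [← Int.cast_abs, Int.abs_eq_natAbs, Int.cast_natCast, Nat.cast_le]
  exact Finset.le_sup (f := fun i => (x i).natAbs) (Finset.mem_univ i)

theorem supNorm_nonneg (x : Zd d) : 0 ≤ supNorm x := Nat.cast_nonneg _

theorem pow_supp {F : Cv d} {R : ℝ} (h : ∀ x, F x ≠ 0 → ∀ i, |(x i : ℝ)| ≤ R) (n : ℕ) :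
    ∀ x, (F ^ n) x ≠ 0 → ∀ i, |(x i : ℝ)| ≤ n * R := by
  induction n with
  | zero =>
    intro x hx i
    rw [pow_zero, one_apply] at hx
    have : x = 0 := by by_contra h'; simp [h'] at hx
    simp [this]
  | succ n ih =>
    intro x hx i
    rw [pow_succ, mul_apply] at hx
    have : ∃ y, (F ^ n) y * F (x - y) ≠ 0 := by
      by_contra h'
      push Not at h'
      exact hx (by simp [h'])
    obtain ⟨y, hy⟩ := this
    have h1 := ih y (left_ne_zero_of_mul hy) i
    have h2 := h (x - y) (right_ne_zero_of_mul hy) i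
    have : (x i : ℝ) = y i + ((x - y) i : ℤ) := by simp
    rw [this]
    refine (abs_add_le _ _).trans ?_
    push_cast at h2 ⊢
    linarith

theorem ell_abs_le {R : ℝ} {x : Zd d} (h : ∀ i, |(x i : ℝ)| ≤ R) : |ell x| ≤ d * R := by
  unfold ell
  refine (Finset.abs_sum_le_sum_abs _ _).trans ?_
  refine (Finset.sum_le_card_nsmul _ _ R fun i _ => h i).trans ?_
  simp

namespace Fam
variable {c0 R δ b : ℝ} {F : ℝ → Cv d} {χ ξ : ℝ → ℝ} (Φ : Fam d c0 R δ b F χ ξ)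
include Φ

theorem chi_mono {t z : ℝ} (h0 : 0 ≤ t) (h1 : t ≤ z) (h2 : z ≤ b) : χ t ≤ χ z := by
  have := cs_mono (w := fun _ => 1) (Φ.mono t z h0 h1 h2)
  have h3 := (Φ.dat t h0 (h1.trans h2)).mass
  have h4 := (Φ.dat z (h0.trans h1) h2).mass
  unfold mass at h3 h4
  rw [h3, h4] at this
  exact (ENNReal.ofReal_le_ofReal_iff (Φ.dat z (h0.trans h1) h2).chi_pos.le).1 this

theorem one_le {t : ℝ} (h0 : 0 ≤ t) (h1 : t ≤ b) : 1 ≤ χ t := by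
  rw [← Φ.chi0]; exact Φ.chi_mono le_rfl h0 h1

theorem xi_low2 (hδ : 0 ≤ δ) {t z K : ℝ} (h0 : 0 ≤ t) (h1 : t ≤ z) (h2 : z ≤ b) (hK : χ z / χ t ≤ K)
    (hK2 : K ^ (2 * δ) ≤ 2) : ξ t ^ 2 * (χ z / χ t) ≤ 2 * ξ z ^ 2 := by
  have h := Φ.xi_low t z h0 h1 h2
  have hp : 0 < χ z / χ t := div_pos (Φ.dat z (h0.trans h1) h2).chi_pos (Φ.dat t h0 (h1.trans h2)).chi_pos
  have e : χ z / χ t = (χ z / χ t) ^ (1 - 2 * δ) * (χ z / χ t) ^ (2 * δ) := by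
    rw [← Real.rpow_add hp]; simp
  have h3 : (χ z / χ t) ^ (2 * δ) ≤ 2 := (Real.rpow_le_rpow hp.le hK (by positivity)).trans hK2
  calc ξ t ^ 2 * (χ z / χ t) = ξ t ^ 2 * (χ z / χ t) ^ (1 - 2 * δ) * (χ z / χ t) ^ (2 * δ) := by
        rw [mul_assoc, ← e]
    _ ≤ ξ z ^ 2 * 2 := mul_le_mul h h3 (by positivity) (by positivity)
    _ = _ := by ring

theorem xi_mono (hδ : δ ≤ 1 / 2) {t z : ℝ} (h0 : 0 ≤ t) (h1 : t ≤ z) (h2 : z ≤ b) : ξ t ≤ ξ z := by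
  have h := Φ.xi_low t z h0 h1 h2
  have hp : 1 ≤ χ z / χ t := by
    rw [le_div_iff₀ (Φ.dat t h0 (h1.trans h2)).chi_pos, one_mul]; exact Φ.chi_mono h0 h1 h2
  have h3 : 1 ≤ (χ z / χ t) ^ (1 - 2 * δ) := Real.one_le_rpow hp (by linarith)
  refine le_of_sq_le_sq ?_ (Φ.dat z (h0.trans h1) h2).xi_pos.le
  nlinarith [sq_nonneg (ξ t)]

theorem inv_cont : ContinuousOn (fun t => 1 / χ t) (Set.Icc 0 b) := by
  have : LipschitzOnWith 1 (fun t => 1 / χ t) (Set.Icc 0 b) := by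
    refine LipschitzOnWith.of_dist_le_mul fun x hx y hy => ?_
    rw [Real.dist_eq, Real.dist_eq, NNReal.coe_one, one_mul]
    have key : ∀ x ∈ Set.Icc 0 b, ∀ y ∈ Set.Icc 0 b, x ≤ y → |1 / χ x - 1 / χ y| ≤ |x - y| := by
      intro x hx y hy h
      rw [abs_sub_comm x y, abs_of_nonneg (sub_nonneg.2 h), abs_of_nonneg]
      · exact Φ.chi_up x y hx.1 h hy.2
      · exact sub_nonneg.2 (one_div_le_one_div_of_le (Φ.dat x hx.1 hx.2).chi_pos (Φ.chi_mono hx.1 h hy.2))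
    rcases le_total x y with h | h
    · exact key x hx y hy h
    · rw [abs_sub_comm, abs_sub_comm x y]; exact key y hy x hx h
  exact this.continuousOn

def B0 (d : ℕ) (c0 : ℝ) : ℝ := c0⁻¹ * (4 * Real.exp 1 * √d) ^ d

omit Φ in
theorem B0_pos (hd : 0 < d) (hc : 0 < c0) : 0 < B0 d c0 := by
  unfold B0
  have hd' : (0:ℝ) < d := by exact_mod_cast hd
  have := Real.sqrt_pos.2 hd'
  positivity

theorem base_abs {x : Zd d} (hx : F 0 x ≠ 0) (i : Fin d) : |(x i : ℝ)| ≤ R :=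
  (abs_le_supNorm x i).trans (Φ.base_supp x hx)

theorem base (hd : 0 < d) (hc : 0 < c0) (hc1 : c0 ≤ 1) (hδ : 0 ≤ δ) (hδ' : δ ≤ 1 / 2) {z K : ℝ} (h0 : 0 ≤ z) (h2 : z ≤ b)
    (hK : χ z ≤ K) (hδK : δ * K ≤ 1 / 8) (hK2 : K ^ (2 * δ) ≤ 2) :
    cs (ew (c0 / (4 * d) / ξ z)) (F z) ≤ ENNReal.ofReal (2 * χ z) ∧
    ∀ x, tilt (c0 / (4 * d) / ξ z) (F z ^ d) x ≤
      ENNReal.ofReal (B0 d c0 * C2 d (c0 / (4 * d)) ^ d * (χ z / ξ z) ^ d) := by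
  have hb : 0 ≤ b := h0.trans h2
  have D := Φ.dat 0 le_rfl hb
  have D' := Φ.dat z h0 h2
  have hd' : (1:ℝ) ≤ d := by exact_mod_cast hd
  have hd0 : (0:ℝ) < d := by linarith
  have hσ := D.xi_pos
  have hξ := D'.xi_pos
  have hξm := Φ.xi_mono hδ' le_rfl h0 h2
  have hR := Φ.R1
  have hcR := Φ.sig_low
  have hχ := Φ.one_le h0 h2
  set s0 := c0 / (4 * d) with hs
  have hs0 : 0 < s0 := by positivity
  have hsd : s0 * d = c0 / 4 := by rw [hs]; field_simp
  have hs4 : s0 ≤ 1 / 4 := by nlinarith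
  have hs'le : s0 / ξ z ≤ s0 / ξ 0 := div_le_div_of_nonneg_left hs0.le hσ hξm
  have hs'0 : 0 < s0 / ξ z := by positivity
  have hell : ∀ y, F 0 y ≠ 0 → |ell y| ≤ d * R := fun y hy => ell_abs_le (Φ.base_abs hy)
  have hsR : s0 / ξ 0 * (d * R) ≤ 1 / 4 := by
    rw [div_mul_eq_mul_div, div_le_iff₀ hσ, ← mul_assoc, hsd]; linarith
  have hM : cs (ew (s0 / ξ 0)) (F 0) ≤ ENNReal.ofReal (2 * χ 0) := by
    rw [ENNReal.ofReal_mul (by norm_num), ← D.mass]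
    unfold mass cs
    rw [← ENNReal.tsum_mul_left]
    refine ENNReal.tsum_le_tsum fun y => ?_
    by_cases hy : F 0 y = 0
    · simp [hy]
    · rw [mul_one, mul_comm (ENNReal.ofReal 2)]
      refine mul_le_mul_right (ENNReal.ofReal_le_ofReal ?_) _
      have h1 : s0 / ξ 0 * ell y ≤ 1 / 2 := by
        have := (le_abs_self _).trans (hell y hy)
        have : s0 / ξ 0 * ell y ≤ s0 / ξ 0 * (d * R) := by gcongr
        linarith
      have h2 : Real.exp (1 / 2) ≤ 2 := by
        have := Real.exp_bound_div_one_sub_of_interval (x := 1/2) (by norm_num) (by norm_num)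
        norm_num at this ⊢; exact this
      exact (Real.exp_le_exp.2 h1).trans h2
  refine fam_step hd (B := B0 d c0) D D' (Δ := z - 0) (by linarith) (Φ.chi_mono le_rfl h0 h2) (Φ.step 0 z le_rfl h0 h2) hδ
    ?_ (Φ.chi_low 0 z le_rfl h0 h2) hs0 (B0_pos hd hc).le hM ?_ ?_
  · rw [Φ.chi0, div_one]; exact (mul_le_mul_of_nonneg_left hK hδ).trans hδK
  · refine (D.mgf_compare hd (α := (s0 / ξ z) ^ 2) (γ := 0) (div_pos hs0 hσ) (by positivity) le_rfl hM ?_).trans ?_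
    · intro y hy
      rw [zero_mul, add_zero, ← mul_pow]
      refine cosh_small _ ?_
      rw [abs_mul, abs_of_pos hs'0]
      have : s0 / ξ z * |ell y| ≤ s0 / ξ 0 * (d * R) :=
        mul_le_mul hs'le (hell y hy) (abs_nonneg _) (div_pos hs0 hσ).le
      linarith
    · refine ENNReal.ofReal_le_ofReal ?_
      rw [Φ.chi0, one_mul, one_mul, mul_zero, add_zero, div_one]
      have h := Φ.xi_low2 hδ le_rfl h0 h2 (K := K) (by rw [Φ.chi0, div_one]; exact hK) hK2
      rw [Φ.chi0, div_one] at h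
      have : (s0 / ξ z) ^ 2 * ξ 0 ^ 2 ≤ 1 / (8 * χ z) := by
        rw [div_pow, div_mul_eq_mul_div, div_le_div_iff₀ (by positivity) (by positivity)]
        have : s0 ^ 2 ≤ 1 / 16 := by nlinarith
        calc s0 ^ 2 * ξ 0 ^ 2 * (8 * χ z) = s0 ^ 2 * (8 * (ξ 0 ^ 2 * χ z)) := by ring
          _ ≤ 1 / 16 * (8 * (2 * ξ z ^ 2)) := by gcongr
          _ = _ := by ring
      linarith
  · intro y
    unfold tilt
    by_cases hy : (F 0 ^ d) y = 0
    · rw [hy, zero_mul]; exact zero_le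
    have hs2 := pow_supp (fun x hx i => Φ.base_abs hx i) d y hy
    have hell2 := ell_abs_le hs2
    have h1 : (F 0 ^ d) y ≤ ENNReal.ofReal (c0⁻¹ / R ^ d) := by
      obtain ⟨n, rfl⟩ : ∃ n, d = n + 1 := ⟨d - 1, by omega⟩
      rw [pow_succ]
      refine (mul_le_mass _ _ _ Φ.base_le y).trans ?_
      rw [mass_pow, D.mass, Φ.chi0]; simp
    unfold ew
    refine (mul_le_mul' h1 le_rfl).trans ?_
    rw [← ENNReal.ofReal_mul (by positivity)]
    refine ENNReal.ofReal_le_ofReal ?_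
    have h3 : Real.exp (s0 / ξ z * ell y) ≤ Real.exp 1 ^ d := by
      rw [← Real.exp_nat_mul, mul_one, Real.exp_le_exp]
      have h4 : s0 / ξ z * ell y ≤ s0 / ξ 0 * (d * (d * R)) :=
        (mul_le_mul_of_nonneg_left ((le_abs_self _).trans hell2) hs'0.le).trans
          (mul_le_mul_of_nonneg_right hs'le (by have : 0 < R := by linarith
                                                positivity))
      have h5 : s0 / ξ 0 * (d * (d * R)) = d * (s0 / ξ 0 * (d * R)) := by ring
      nlinarith
    have h6 : (1 / 4 : ℝ) ^ d ≤ ∏ i, (1 + s0 ^ 2 / (10 * d ^ 2) / ξ 0 * |(y i : ℝ)|)⁻¹ ^ 2 := by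
      rw [show (1/4:ℝ) ^ d = ∏ i : Fin d, (1/4:ℝ) by simp]
      refine Finset.prod_le_prod (fun _ _ => by norm_num) fun i _ => ?_
      have h7 : s0 ^ 2 / (10 * d ^ 2) / ξ 0 * |(y i : ℝ)| ≤ 1 := by
        calc _ ≤ s0 ^ 2 / (10 * d ^ 2) / ξ 0 * (d * R) := by gcongr; exact hs2 i
          _ = s0 * (s0 / ξ 0 * (d * R)) / (10 * d ^ 2) := by ring
          _ ≤ 1 := by
            rw [div_le_one (by positivity)]
            nlinarith
      have h8 : 0 ≤ s0 ^ 2 / (10 * d ^ 2) / ξ 0 * |(y i : ℝ)| := by positivity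
      rw [show (1/4:ℝ) = (2:ℝ)⁻¹ ^ 2 by norm_num]
      gcongr
      linarith
    have h9 : 1 / R ≤ √d / ξ 0 := by
      rw [div_le_div_iff₀ (by linarith) hσ, one_mul]
      refine le_of_sq_le_sq ?_ (by positivity)
      rw [mul_pow, Real.sq_sqrt hd0.le]; exact Φ.sig_up
    have hR0 : 0 < R := by linarith
    calc c0⁻¹ / R ^ d * Real.exp (s0 / ξ z * ell y) ≤ c0⁻¹ / R ^ d * Real.exp 1 ^ d := by gcongr
      _ = c0⁻¹ * (Real.exp 1 * (1 / R)) ^ d := by rw [mul_pow, one_div, inv_pow]; ring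
      _ ≤ c0⁻¹ * (Real.exp 1 * (√d / ξ 0)) ^ d := by gcongr
      _ = B0 d c0 * (χ 0 / ξ 0) ^ d * (1 / 4) ^ d := by
        unfold B0
        rw [Φ.chi0, mul_assoc, mul_assoc, ← mul_pow, ← mul_pow]
        congr 2; ring
      _ ≤ _ := by
        refine mul_le_mul_of_nonneg_left h6 ?_
        have := B0_pos hd hc
        rw [Φ.chi0]; positivity

end Fam
end NC

namespace NC
variable {d : ℕ}

theorem C2_one_le (hd : 0 < d) {s0 : ℝ} (h : 0 < s0) (h1 : s0 ≤ 1) : 1 ≤ C2 d s0 := by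
  unfold C2
  have hd' : (1:ℝ) ≤ d := by exact_mod_cast hd
  have h2 : 1 ≤ √(d:ℝ) := Real.one_le_sqrt.2 hd'
  rw [one_le_div (by positivity)]
  have : s0 ^ 2 / (10 * d ^ 2) ≤ 1 := by
    rw [div_le_one (by positivity)]; nlinarith
  linarith

namespace Fam
variable {c0 R δ b : ℝ} {F : ℝ → Cv d} {χ ξ : ℝ → ℝ} (Φ : Fam d c0 R δ b F χ ξ)
include Φ

theorem induct_step (hd : 0 < d) (hc : 0 < c0) (hc1 : c0 ≤ 1) (hδ : 0 ≤ δ) (hδ' : δ ≤ 1 / 2) {t z K B : ℝ} (h0 : 0 ≤ t) (h1 : t ≤ z) (h2 : z ≤ b)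
    (hK : χ z / χ t = K) (hK128 : 128 ≤ K) (hδK : δ * K ≤ 1 / 8) (hK2 : K ^ (2 * δ) ≤ 2) (hB : 0 ≤ B)
    (hM : cs (ew (c0 / (4 * d) / ξ t)) (F t) ≤ ENNReal.ofReal (2 * χ t))
    (hP : ∀ x, tilt (c0 / (4 * d) / ξ t) (F t ^ d) x ≤ ENNReal.ofReal (B * (χ t / ξ t) ^ d)) :
    cs (ew (c0 / (4 * d) / ξ z)) (F z) ≤ ENNReal.ofReal (2 * χ z) ∧
    ∀ x, tilt (c0 / (4 * d) / ξ z) (F z ^ d) x ≤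
      ENNReal.ofReal (B * C2 d (c0 / (4 * d)) ^ d * (χ z / ξ z) ^ d) := by
  have D := Φ.dat t h0 (h1.trans h2)
  have D' := Φ.dat z (h0.trans h1) h2
  have hd' : (1:ℝ) ≤ d := by exact_mod_cast hd
  have hd0 : (0:ℝ) < d := by linarith
  have hξt := D.xi_pos
  have hξ := D'.xi_pos
  have hχt := D.chi_pos
  have hξm := Φ.xi_mono hδ' h0 h1 h2
  set s0 := c0 / (4 * d) with hs
  have hs0 : 0 < s0 := by positivity
  have hsd : s0 * d = c0 / 4 := by rw [hs]; field_simp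
  have hs4 : s0 ≤ 1 / 4 := by nlinarith
  have hK0 : 0 < K := by linarith
  have hx := Φ.xi_low2 hδ h0 h1 h2 hK.le hK2
  rw [hK] at hx
  have hlam : (ξ t / ξ z) ^ 2 ≤ 2 / K := by
    rw [div_pow, div_le_div_iff₀ (by positivity) hK0]; exact hx
  have hlam1 : ξ t / ξ z ≤ 1 := by rw [div_le_one hξ]; exact hξm
  have h2x : 2 * ξ t ≤ ξ z := by
    refine le_of_sq_le_sq ?_ hξ.le
    nlinarith [sq_nonneg (ξ t)]
  refine fam_step hd (B := B) D D' (Δ := z - t) (by linarith) (Φ.chi_mono h0 h1 h2) (Φ.step t z h0 h1 h2) hδ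
    (by rw [hK]; exact hδK) (Φ.chi_low t z h0 h1 h2) hs0 hB hM ?_ ?_
  · rw [hK]
    refine (D.mgf_compare hd (α := (ξ t / ξ z) ^ 2 * (s0 / ξ t) ^ 2 / 2) (γ := (ξ t / ξ z) ^ 4) (div_pos hs0 hξt) (by positivity) (by positivity) hM ?_).trans ?_
    · intro y _
      have := cosh_scale (ξ t / ξ z) (s0 / ξ t * ell y) (by positivity) hlam1
      rw [show ξ t / ξ z * (s0 / ξ t * ell y) = s0 / ξ z * ell y by field_simp] at this
      refine this.trans (le_of_eq ?_)
      ring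
    · refine ENNReal.ofReal_le_ofReal ?_
      refine mul_le_mul_of_nonneg_left ?_ hχt.le
      have e1 : (ξ t / ξ z) ^ 2 * (s0 / ξ t) ^ 2 / 2 * ξ t ^ 2 = (ξ t / ξ z) ^ 2 * s0 ^ 2 / 2 := by
        field_simp
      rw [e1, show (ξ t / ξ z) ^ 4 = ((ξ t / ξ z) ^ 2) ^ 2 by ring]
      set l := (ξ t / ξ z) ^ 2 with hl
      have hl0 : 0 ≤ l := by positivity
      have hlK : l * K ≤ 2 := by rwa [le_div_iff₀ hK0] at hlam
      have h5 : l ≤ 2 / 128 := hlam.trans (by gcongr)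
      have h6 : s0 ^ 2 ≤ 1 / 16 := by nlinarith
      have h7 : l * s0 ^ 2 / 2 + 2 * l ^ 2 ≤ l * (1 / 16) := by
        nlinarith
      have h8 : l * (1 / 16) ≤ 1 / (8 * K) := by
        rw [le_div_iff₀ (by positivity)]; nlinarith
      linarith
  · have hA : 0 ≤ B * (χ t / ξ t) ^ d := by positivity
    refine tilt_decay (s := s0 / ξ t) hA (by positivity) ?_ (by positivity) ?_ (abs_tilt (symm_pow D.symm d) hA hP)
    · rw [div_div s0, div_le_div_iff_of_pos_left hs0 hξ (by positivity)]; linarith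
    · rw [← mul_div_assoc]
      gcongr
      rw [← mul_div_assoc, div_le_iff₀ (by positivity)]
      nlinarith

theorem exists_chi {z v : ℝ} (h0 : 0 ≤ z) (h2 : z ≤ b) (hv1 : 1 ≤ v) (hv : v ≤ χ z) :
    ∃ t, 0 ≤ t ∧ t ≤ z ∧ χ t = v := by
  have hc := Φ.inv_cont.mono (Set.Icc_subset_Icc_right h2)
  have := intermediate_value_Icc' h0 hc
  have hm : 1 / v ∈ Set.Icc (1 / χ z) (1 / χ 0) := by
    rw [Φ.chi0]
    exact ⟨one_div_le_one_div_of_le (by linarith) hv, one_div_le_one_div_of_le (by linarith) hv1⟩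
  obtain ⟨t, ht, h⟩ := this hm
  refine ⟨t, ht.1, ht.2, ?_⟩
  have h3 : 1 / χ t = 1 / v := h
  have := congrArg (fun a => 1 / a) h3
  simpa using this

theorem induct (hd : 0 < d) (hc : 0 < c0) (hc1 : c0 ≤ 1) (hδ : 0 ≤ δ) (hδ' : δ ≤ 1 / 2) {K : ℝ}
    (hK128 : 128 ≤ K) (hδK : δ * K ≤ 1 / 8) (hK2 : K ^ (2 * δ) ≤ 2) (n : ℕ) :
    ∀ z, 0 ≤ z → z ≤ b → χ z ≤ K ^ (n + 1) →
    cs (ew (c0 / (4 * d) / ξ z)) (F z) ≤ ENNReal.ofReal (2 * χ z) ∧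
    ∀ x, tilt (c0 / (4 * d) / ξ z) (F z ^ d) x ≤
      ENNReal.ofReal (B0 d c0 * (C2 d (c0 / (4 * d)) ^ d) ^ (n + 1) * (χ z / ξ z) ^ d) := by
  have hd' : (1:ℝ) ≤ d := by exact_mod_cast hd
  have hC : 1 ≤ C2 d (c0 / (4 * d)) ^ d := by
    refine one_le_pow₀ (C2_one_le hd (by positivity) ?_)
    rw [div_le_one (by positivity)]; linarith
  have hB := B0_pos hd hc
  have hK0 : 0 < K := by linarith
  induction n with
  | zero =>
    intro z h0 h2 hz
    rw [zero_add, pow_one] at hz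
    have := Φ.base hd hc hc1 hδ hδ' h0 h2 hz hδK hK2
    rwa [zero_add, pow_one]
  | succ n ih =>
    intro z h0 h2 hz
    have D' := Φ.dat z h0 h2
    by_cases hz' : χ z ≤ K
    · have := Φ.base hd hc hc1 hδ hδ' h0 h2 hz' hδK hK2
      refine ⟨this.1, fun x => (this.2 x).trans (ENNReal.ofReal_le_ofReal ?_)⟩
      have h1 := D'.chi_pos
      have h2 := D'.xi_pos
      gcongr
      exact le_self_pow₀ hC (by omega)
    · push Not at hz'
      obtain ⟨t, ht0, htz, ht⟩ := Φ.exists_chi h0 h2 (v := χ z / K) (by rw [one_le_div hK0]; exact hz'.le)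
        (div_le_self D'.chi_pos.le (by linarith))
      obtain ⟨h3, h4⟩ := ih t ht0 (htz.trans h2) (by rw [ht, div_le_iff₀ hK0, ← pow_succ]; exact hz)
      have := Φ.induct_step hd hc hc1 hδ hδ' ht0 htz h2 (K := K) (by rw [ht]; have := D'.chi_pos; field_simp) hK128 hδK hK2
        (by positivity) h3 h4
      rw [mul_assoc (B0 d c0), ← pow_succ] at this
      exact this

/-- the main bound on the `d`-fold convolution -/
theorem dbound (hd : 0 < d) (hc : 0 < c0) (hc1 : c0 ≤ 1) (hδ : 0 ≤ δ) (hδ' : δ ≤ 1 / 2) {K ε : ℝ} (hε : 0 ≤ ε)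
    (hK128 : 128 ≤ K) (hδK : δ * K ≤ 1 / 8) (hK2 : K ^ (2 * δ) ≤ 2) (hKε : C2 d (c0 / (4 * d)) ^ d ≤ K ^ ε)
    {z : ℝ} (h0 : 0 ≤ z) (h2 : z ≤ b) (x : Zd d) : (F z ^ d) x ≤ ENNReal.ofReal 
      (B0 d c0 * C2 d (c0 / (4 * d)) ^ d * χ z ^ ε * (χ z / ξ z) ^ d * Real.exp (-(c0 / (4 * d)) / ξ z * supNorm x)) := by
  have hd' : (1:ℝ) ≤ d := by exact_mod_cast hd
  have hC : 1 ≤ C2 d (c0 / (4 * d)) ^ d := by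
    refine one_le_pow₀ (C2_one_le hd (by positivity) ?_)
    rw [div_le_one (by positivity)]; linarith
  have hB := B0_pos hd hc
  have hK0 : 0 < K := by linarith
  have D := Φ.dat z h0 h2
  have hχ := D.chi_pos
  have hξ := D.xi_pos
  have hχ1 := Φ.one_le h0 h2
  obtain ⟨n, hn1, hn2⟩ : ∃ n : ℕ, K ^ n ≤ χ z ∧ χ z < K ^ (n + 1) := exists_nat_pow_near hχ1 (by linarith)
  have h3 := (Φ.induct hd hc hc1 hδ hδ' hK128 hδK hK2 n z h0 h2 hn2.le).2
  have h4 := abs_tilt (symm_pow D.symm d) (by positivity) h3 x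
  refine h4.trans (ENNReal.ofReal_le_ofReal ?_)
  rw [pow_succ, ← mul_assoc]
  have h5 : (C2 d (c0 / (4 * d)) ^ d) ^ n ≤ χ z ^ ε := by
    calc (C2 d (c0 / (4 * d)) ^ d) ^ n ≤ (K ^ ε) ^ n := by gcongr
      _ = (K ^ n) ^ ε := by rw [← Real.rpow_natCast, ← Real.rpow_mul hK0.le, mul_comm, Real.rpow_mul hK0.le, Real.rpow_natCast]
      _ ≤ _ := Real.rpow_le_rpow (by positivity) hn1 hε
  have h6 : supNorm x ≤ el1 x := by
    unfold supNorm el1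
    have : ((Finset.univ.sup fun i => (x i).natAbs : ℕ)) ≤ ∑ i, (x i).natAbs :=
      Finset.sup_le fun i hi => Finset.single_le_sum (f := fun i => (x i).natAbs) (fun _ _ => Nat.zero_le _) hi
    calc ((Finset.univ.sup fun i => (x i).natAbs : ℕ) : ℝ) ≤ ((∑ i, (x i).natAbs : ℕ) : ℝ) := by exact_mod_cast this
      _ = _ := by
        push_cast
        refine Finset.sum_congr rfl fun i _ => ?_
        rw [← Int.cast_abs, Int.abs_eq_natAbs, Int.cast_natCast]
  have h7 : Real.exp (-(c0 / (4 * d) / ξ z) * el1 x) ≤ Real.exp (-(c0 / (4 * d)) / ξ z * supNorm x) := by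
    rw [Real.exp_le_exp, neg_div, neg_mul, neg_mul, neg_le_neg_iff]
    gcongr
  have e : B0 d c0 * C2 d (c0 / (4 * d)) ^ d * χ z ^ ε * (χ z / ξ z) ^ d = 
    B0 d c0 * χ z ^ ε * C2 d (c0 / (4 * d)) ^ d * (χ z / ξ z) ^ d := by ring
  rw [e]
  gcongr

end Fam
end NC

namespace NC
variable {d : ℕ}

theorem quad_telescope {a b C : ℝ} {f : ℝ → ℝ} (hab : a ≤ b)
    (h : ∀ t z, a ≤ t → t ≤ z → z ≤ b → f z - f t ≤ C * (z - t) ^ 2) : f b ≤ f a := by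
  have key : ∀ N : ℕ, 0 < N → f b - f a ≤ C * (b - a) ^ 2 / N := by
    intro N hN
    have hN' : (0:ℝ) < N := by exact_mod_cast hN
    set p : ℕ → ℝ := fun k => a + k * ((b - a) / N) with hp
    have hst : 0 ≤ (b - a) / N := div_nonneg (by linarith) hN'.le
    have h1 : f (p N) - f (p 0) = ∑ k ∈ Finset.range N, (f (p (k+1)) - f (p k)) :=
      (Finset.sum_range_sub (fun k => f (p k)) N).symm
    have hp0 : p 0 = a := by simp [hp]
    have hpN : p N = b := by simp only [hp]; field_simp; ring
    rw [← hp0, ← hpN, h1, hp0, hpN]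
    have h2 : ∀ k ∈ Finset.range N, f (p (k+1)) - f (p k) ≤ C * ((b - a) / N) ^ 2 := by
      intro k hk
      have hk' : (k:ℝ) + 1 ≤ N := by exact_mod_cast Finset.mem_range.1 hk
      have e : p (k+1) - p k = (b - a) / N := by simp only [hp]; push_cast; ring
      rw [← e]
      refine h _ _ ?_ (by linarith) ?_
      · simp only [hp]; have : (0:ℝ) ≤ k * ((b - a) / N) := by positivity
        linarith
      · simp only [hp]; push_cast
        have : ((k:ℝ) + 1) * ((b - a) / N) ≤ N * ((b - a) / N) := by gcongr
        rw [mul_div_cancel₀ _ hN'.ne'] at this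
        linarith
    refine (Finset.sum_le_sum h2).trans (le_of_eq ?_)
    rw [Finset.sum_const, Finset.card_range, nsmul_eq_mul]
    field_simp
  by_contra hlt
  push Not at hlt
  have hpos : 0 < f b - f a := by linarith
  obtain ⟨N, hN⟩ := exists_nat_gt (C * (b - a) ^ 2 / (f b - f a))
  have h1 := key (N + 1) (by omega)
  rw [le_div_iff₀ (by positivity)] at h1
  rw [div_lt_iff₀ hpos] at hN
  push_cast at h1
  nlinarith

theorem rpow_w {x y : ℝ} (hx : 0 < x) (hxy : x ≤ y) :
    (y - x) * y ^ (-(5/4) : ℝ) ≤ 4 * (x ^ (-(1/4) : ℝ) - y ^ (-(1/4) : ℝ)) := by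
  have hy : 0 < y := by linarith
  set q := (1 - x / y) / 4 with hq
  have hxy1 : x / y ≤ 1 := by rw [div_le_one hy]; exact hxy
  have hxy0 : 0 < x / y := by positivity
  have h1 : (x / y) ^ (1/4 : ℝ) ≤ 1 - q := by
    have := rpow_one_add_le_one_add_mul_self (s := x / y - 1) (by linarith) (p := 1/4) (by norm_num) (by norm_num)
    rw [show 1 + (x / y - 1) = x / y by ring] at this
    refine this.trans (le_of_eq ?_)
    rw [hq]; ring
  have hpos : 0 < (x / y) ^ (1/4 : ℝ) := by positivity
  have h2 : 1 + q ≤ (x / y) ^ (-(1/4) : ℝ) := by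
    rw [Real.rpow_neg hxy0.le, ← one_div, le_div_iff₀ hpos]
    have hq0 : 0 ≤ q := by rw [hq]; linarith
    nlinarith
  have h3 : x ^ (-(1/4) : ℝ) = (x / y) ^ (-(1/4) : ℝ) * y ^ (-(1/4) : ℝ) := by
    rw [← Real.mul_rpow hxy0.le hy.le]; congr 1; field_simp
  have h4 : y ^ (-(5/4) : ℝ) = y⁻¹ * y ^ (-(1/4) : ℝ) := by
    rw [← Real.rpow_neg_one, ← Real.rpow_add hy]; norm_num
  rw [h3, h4]
  have h5 : 0 < y ^ (-(1/4) : ℝ) := by positivity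
  have h6 : (y - x) * y⁻¹ = 4 * q := by rw [hq]; field_simp
  calc (y - x) * (y⁻¹ * y ^ (-(1/4) : ℝ)) = 4 * q * y ^ (-(1/4) : ℝ) := by rw [← h6]; ring
    _ ≤ _ := by nlinarith

theorem add_pow_ge {v Δ : ℝ} (hv : 0 ≤ v) (hΔ : 0 ≤ Δ) (n : ℕ) : v ^ (n+1) + (n+1) * Δ * v ^ n ≤ (v + Δ) ^ (n+1) := by
  induction n with
  | zero => simp
  | succ n ih =>
    calc v ^ (n+1+1) + ((n+1:ℕ)+1) * Δ * v ^ (n+1) ≤ (v ^ (n+1) + (n+1) * Δ * v ^ n) * (v + Δ) := by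
          have : 0 ≤ (n+1) * Δ * v ^ n * Δ := by positivity
          push_cast
          have e1 : v ^ (n+1+1) = v ^ n * v * v := by ring
          have e2 : v ^ (n+1) = v ^ n * v := by ring
          rw [e1, e2]
          linarith
      _ ≤ (v + Δ) ^ (n+1) * (v + Δ) := by gcongr
      _ = _ := by ring

theorem incr (M : ℕ → ℝ) (U : ℝ) (n : ℕ) : ∃ C : ℝ, ∀ (a b : ℕ → ℝ) (v Δ : ℝ), 0 ≤ v → 0 ≤ Δ → v ≤ U →
    (∀ i, 0 ≤ a i) → (∀ i, 0 ≤ b i) → (∀ i, b i ≤ a i + Δ * i * b (i+1)) → (∀ i, b i ≤ M i) →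
    ∑ i ∈ Finset.range (n+1), v ^ i * b (i+1) - ∑ i ∈ Finset.range (n+1), (v + Δ) ^ i * a (i+1) ≤
      Δ * (n+1) * v ^ n * b (n+2) + C * Δ ^ 2 := by
  induction n with
  | zero =>
    refine ⟨0, fun a b v Δ hv hΔ hU ha hb0 hb hM => ?_⟩
    have := hb 1
    simp at this ⊢
    linarith
  | succ n ih =>
    obtain ⟨C, hC⟩ := ih
    refine ⟨C + (n+1) * U ^ n * ((n+2) * M (n+3)), fun a b v Δ hv hΔ hU ha hb0 hb hM => ?_⟩
    have h := hC a b v Δ hv hΔ hU ha hb0 hb hM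
    rw [Finset.sum_range_succ (n := n+1), Finset.sum_range_succ (n := n+1)]
    have h1 := hb (n+2)
    have h2 : v ^ (n+1) + (n+1) * Δ * v ^ n ≤ (v + Δ) ^ (n+1) := add_pow_ge hv hΔ n
    push_cast at h1 ⊢
    have h3 : v ^ (n+1) * b (n+2) ≤ v ^ (n+1) * (a (n+2) + Δ * (n+2) * b (n+3)) :=
      mul_le_mul_of_nonneg_left h1 (by positivity)
    have h4 : (v ^ (n+1) + (n+1) * Δ * v ^ n) * a (n+2) ≤ (v + Δ) ^ (n+1) * a (n+2) :=
      mul_le_mul_of_nonneg_right h2 (ha _)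
    have h5 : Δ * (n+1) * v ^ n * b (n+2) - Δ * (n+1) * v ^ n * a (n+2) ≤ Δ * (n+1) * v ^ n * (Δ * (n+2) * b (n+3)) := by
      rw [← mul_sub]
      refine mul_le_mul_of_nonneg_left (by linarith) (by positivity)
    have h6 : Δ * (n+1) * v ^ n * (Δ * (n+2) * b (n+3)) ≤ Δ * (n+1) * U ^ n * (Δ * (n+2) * M (n+3)) := by
      have := hb0 (n+3)
      have := hM (n+3)
      have hU0 : 0 ≤ U := hv.trans hU
      gcongr
    have e1 : (n:ℝ) + 1 + 1 = n + 2 := by ring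
    rw [show n + 1 + 1 = n + 2 by rfl, show n + 1 + 2 = n + 3 by rfl, e1]
    nlinarith

end NC

namespace NC
variable {d : ℕ}

def XX (σ r : ℝ) : ℝ := max 1 ((r / σ) ^ 2)

theorem XX_one (σ r : ℝ) : 1 ≤ XX σ r := le_max_left _ _

theorem keyA (s σ ξ r : ℝ) (hs : 0 < s) (hσ : 0 < σ) (hξ : σ ≤ ξ) (hr : 0 ≤ r) :
    (1 / ξ) ^ d * Real.exp (-(s * r / ξ)) ≤ (1 + d.factorial / s ^ d) * (1 / σ) ^ d * XX σ r ^ (-(d / 2) : ℝ) := by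
  have hξ0 : 0 < ξ := by linarith
  have hf : (0:ℝ) ≤ d.factorial / s ^ d := by positivity
  rcases le_or_gt r σ with h | h
  · have hX : XX σ r = 1 := by
      unfold XX
      rw [max_eq_left]
      have : r / σ ≤ 1 := by rw [div_le_one hσ]; exact h
      have : 0 ≤ r / σ := by positivity
      nlinarith
    rw [hX, Real.one_rpow, mul_one]
    have h1 : Real.exp (-(s * r / ξ)) ≤ 1 := Real.exp_le_one_iff.2 (neg_nonpos.2 (by positivity))
    calc (1 / ξ) ^ d * Real.exp (-(s * r / ξ)) ≤ (1 / σ) ^ d * 1 := by gcongr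
      _ = 1 * (1 / σ) ^ d := by ring
      _ ≤ _ := by gcongr; linarith
  · have hr0 : 0 < r := by linarith
    have hX : XX σ r = (r / σ) ^ 2 := by
      unfold XX
      rw [max_eq_right]
      have : 1 ≤ r / σ := by rw [one_le_div hσ]; exact h.le
      nlinarith
    have e : XX σ r ^ (-(d / 2) : ℝ) = (σ / r) ^ d := by
      rw [hX, ← Real.rpow_natCast (r / σ), ← Real.rpow_mul (by positivity), show ((2:ℕ):ℝ) * (-(d/2)) = -(d:ℝ) by push_cast; ring,
        Real.rpow_neg (by positivity), Real.rpow_natCast, ← inv_pow, inv_div]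
    rw [e]
    set u := s * r / ξ with hu
    have hu0 : 0 < u := by positivity
    have h1 := Real.pow_div_factorial_le_exp u hu0.le d
    have h2 : Real.exp (-u) ≤ d.factorial / u ^ d := by
      rw [Real.exp_neg, inv_le_comm₀ (Real.exp_pos _) (by positivity), inv_div]; exact h1
    calc (1 / ξ) ^ d * Real.exp (-u) ≤ (1 / ξ) ^ d * (d.factorial / u ^ d) := by gcongr
      _ = d.factorial / s ^ d * (1 / r) ^ d := by rw [hu]; simp only [div_pow, mul_pow, one_pow]; field_simp
      _ = d.factorial / s ^ d * ((1 / σ) ^ d * (σ / r) ^ d) := by rw [← mul_pow]; congr 2; field_simp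
      _ ≤ (1 + d.factorial / s ^ d) * ((1 / σ) ^ d * (σ / r) ^ d) := by gcongr; linarith
      _ = _ := by ring

theorem keyB (σ ξ χ δ : ℝ) (hσ : 0 < σ) (hξ : 0 < ξ) (hχ : 1 ≤ χ) (h : σ ^ 2 * χ ^ (1 - 2 * δ) ≤ ξ ^ 2) :
    (1 / ξ) ^ d ≤ (1 / σ) ^ d * χ ^ (-(d / 2) + δ * d : ℝ) := by
  have hχ0 : 0 < χ := by linarith
  have h1 : σ * χ ^ ((1 - 2 * δ) / 2) ≤ ξ := by
    refine le_of_sq_le_sq ?_ hξ.le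
    refine le_of_eq_of_le ?_ h
    rw [mul_pow, ← Real.rpow_natCast (χ ^ _), ← Real.rpow_mul hχ0.le]
    congr 2; push_cast; ring
  have hp : 0 < σ * χ ^ ((1 - 2 * δ) / 2) := by positivity
  calc (1 / ξ) ^ d ≤ (1 / (σ * χ ^ ((1 - 2 * δ) / 2))) ^ d := by gcongr
    _ = (1 / σ) ^ d * (χ ^ (-((1 - 2 * δ) / 2))) ^ d := by
      rw [Real.rpow_neg hχ0.le, ← mul_pow]; congr 1; field_simp
    _ = _ := by
      rw [← Real.rpow_natCast (χ ^ _), ← Real.rpow_mul hχ0.le]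
      congr 2; ring

theorem quarter (y : ℝ) (hy : 0 < y) (hy2 : y ≤ 2) : 1 / 4 ≤ y ^ (-(5/4) : ℝ) := by
  have h1 : (2:ℝ) ^ (-(5/4) : ℝ) ≤ y ^ (-(5/4) : ℝ) := Real.rpow_le_rpow_of_nonpos hy hy2 (by norm_num)
  have h2 : (2:ℝ) ^ (-2 : ℝ) ≤ 2 ^ (-(5/4) : ℝ) := Real.rpow_le_rpow_of_exponent_le (by norm_num) (by norm_num)
  have h3 : (2:ℝ) ^ (-2 : ℝ) = 1 / 4 := by
    rw [show (-2:ℝ) = ((-2:ℤ):ℝ) by norm_num, Real.rpow_intCast]; norm_num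
  linarith

theorem keyb (hd : 3 ≤ d) (s σ ξ r χ ε δ : ℝ) (hs : 0 < s) (hσ : 0 < σ) (hξ : σ ≤ ξ) (hr : 0 ≤ r) (hχ : 1 ≤ χ)
    (hε : 0 < ε) (hε1 : ε < 1) (hδ : δ * d ≤ ε / 8)
    (h : σ ^ 2 * χ ^ (1 - 2 * δ) ≤ ξ ^ 2) :
    χ ^ (ε / 8) * ((1 / ξ) ^ d * Real.exp (-(s * r / ξ))) ≤ 4 * (1 + d.factorial / s ^ d) * (1 / σ) ^ d *
      (XX σ r ^ (-((d - 2 - ε) / 2) : ℝ) * ((XX σ r)⁻¹ * (1 + χ / XX σ r) ^ (-(5/4) : ℝ))) := by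
  have hξ0 : 0 < ξ := by linarith
  have hχ0 : 0 < χ := by linarith
  have hf : (0:ℝ) ≤ d.factorial / s ^ d := by positivity
  have hd' : (3:ℝ) ≤ d := by exact_mod_cast hd
  have hX := XX_one σ r
  have hA := keyA (d := d) s σ ξ r hs hσ hξ hr
  have hB := keyB (d := d) σ ξ χ δ hσ hξ0 hχ h
  set X := XX σ r with hXd
  have hX0 : 0 < X := by linarith
  have eX : X ^ (-((d - 2 - ε) / 2) : ℝ) * X⁻¹ = X ^ (-(d / 2) + ε / 2 : ℝ) := by
    rw [← Real.rpow_neg_one, ← Real.rpow_add hX0]; congr 1; ring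
  rw [← mul_assoc (X ^ (-((d - 2 - ε) / 2) : ℝ)), eX]
  rcases le_total χ X with hle | hle
  · have h1 : 1 / 4 ≤ (1 + χ / X) ^ (-(5/4) : ℝ) := by
      refine quarter _ (by positivity) ?_
      have : χ / X ≤ 1 := by rw [div_le_one hX0]; exact hle
      linarith
    calc χ ^ (ε / 8) * ((1 / ξ) ^ d * Real.exp (-(s * r / ξ)))
        ≤ X ^ (ε / 2) * ((1 + d.factorial / s ^ d) * (1 / σ) ^ d * X ^ (-(d / 2) : ℝ)) := by
          refine mul_le_mul ?_ hA (by positivity) (by positivity)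
          exact (Real.rpow_le_rpow hχ0.le hle (by positivity)).trans (Real.rpow_le_rpow_of_exponent_le hX (by linarith))
      _ = 4 * (1 + d.factorial / s ^ d) * (1 / σ) ^ d * (X ^ (-(d / 2) + ε / 2 : ℝ) * (1 / 4)) := by
          rw [Real.rpow_add hX0]; ring
      _ ≤ _ := by gcongr
  · have hq1 : 1 ≤ χ / X := by rw [one_le_div hX0]; exact hle
    have h1 : 1 / 4 * (χ / X) ^ (-(5/4) : ℝ) ≤ (1 + χ / X) ^ (-(5/4) : ℝ) := by
      have h3 : (1 / 4 : ℝ) ≤ 2 ^ (-(5/4) : ℝ) := quarter 2 (by norm_num) le_rfl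
      calc 1 / 4 * (χ / X) ^ (-(5/4) : ℝ) ≤ 2 ^ (-(5/4) : ℝ) * (χ / X) ^ (-(5/4) : ℝ) := by gcongr
        _ = (2 * (χ / X)) ^ (-(5/4) : ℝ) := (Real.mul_rpow (by norm_num) (by positivity)).symm
        _ ≤ _ := Real.rpow_le_rpow_of_nonpos (by positivity) (by linarith) (by norm_num)
    have hexp : Real.exp (-(s * r / ξ)) ≤ 1 := Real.exp_le_one_iff.2 (neg_nonpos.2 (by positivity))
    have h4 : χ ^ (ε / 8) * χ ^ (-(d / 2) + δ * d : ℝ) ≤ X ^ (-(d / 2) + ε / 2 : ℝ) * (χ / X) ^ (-(5/4) : ℝ) := by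
      set m : ℝ := ε / 8 + (-(d / 2) + δ * d) with hm
      have e1 : χ ^ (ε / 8) * χ ^ (-(d / 2) + δ * d : ℝ) = X ^ m * (χ / X) ^ m := by
        rw [← Real.rpow_add hχ0, ← Real.mul_rpow hX0.le (by positivity)]; congr 1; field_simp
      rw [e1]
      have h5 : X ^ m ≤ X ^ (-(d / 2) + ε / 2 : ℝ) := Real.rpow_le_rpow_of_exponent_le hX (by linarith)
      have h6 : (χ / X) ^ m ≤ (χ / X) ^ (-(5/4) : ℝ) := Real.rpow_le_rpow_of_exponent_le hq1 (by linarith)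
      gcongr
    calc χ ^ (ε / 8) * ((1 / ξ) ^ d * Real.exp (-(s * r / ξ)))
        ≤ χ ^ (ε / 8) * (((1 / σ) ^ d * χ ^ (-(d / 2) + δ * d : ℝ)) * 1) := by gcongr
      _ = (1 / σ) ^ d * (χ ^ (ε / 8) * χ ^ (-(d / 2) + δ * d : ℝ)) := by ring
      _ ≤ (1 / σ) ^ d * (X ^ (-(d / 2) + ε / 2 : ℝ) * (χ / X) ^ (-(5/4) : ℝ)) := by gcongr
      _ = 4 * 1 * (1 / σ) ^ d * (X ^ (-(d / 2) + ε / 2 : ℝ) * (1 / 4 * (χ / X) ^ (-(5/4) : ℝ))) := by ring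
      _ ≤ _ := by gcongr; linarith

theorem pow_step {F Fn : Cv d} {c : ℝ≥0∞} (hm : F ≤ Fn) (h : Fn ≤ F + c • (F * Fn)) (i : ℕ) :
    Fn ^ i ≤ F ^ i + (c * i) • Fn ^ (i + 1) := by
  induction i with
  | zero => simp
  | succ i ih =>
    calc Fn ^ (i+1) = Fn ^ i * Fn := pow_succ _ _
      _ ≤ (F ^ i + (c * i) • Fn ^ (i + 1)) * Fn := cmul_le ih le_rfl
      _ = F ^ i * Fn + (c * i) • Fn ^ (i + 1 + 1) := by rw [add_mul, smul_mul_assoc, ← pow_succ]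
      _ ≤ F ^ i * (F + c • (F * Fn)) + (c * i) • Fn ^ (i + 1 + 1) := cadd_le (cmul_le le_rfl h) le_rfl
      _ = F ^ (i + 1) + c • (F ^ (i + 1) * Fn) + (c * i) • Fn ^ (i + 1 + 1) := by
        rw [mul_add, mul_smul_comm, ← mul_assoc, ← pow_succ]
      _ ≤ F ^ (i + 1) + c • (Fn ^ (i + 1) * Fn) + (c * i) • Fn ^ (i + 1 + 1) :=
        cadd_le (cadd_le le_rfl (csmul_le le_rfl (cmul_le (cpow_le hm _) le_rfl))) le_rfl
      _ = _ := by
        rw [← pow_succ, add_assoc, ← add_smul]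
        congr 2
        push_cast
        ring

end NC

namespace NC
variable {d : ℕ}

def CT0 (d : ℕ) (c0 : ℝ) : ℝ := 2 ^ d * (c0⁻¹ * √d ^ d * 2 * (d / c0) ^ d)
def CE (d : ℕ) (c0 : ℝ) : ℝ := (d - 1) * 2 ^ (d - 2) * (Fam.B0 d c0 * C2 d (c0 / (4 * d)) ^ d) *
  (4 * (1 + d.factorial / (c0 / (8 * d)) ^ d))

theorem supNorm_le {x : Zd d} {A : ℝ} (hA : 0 ≤ A) (h : ∀ i, |(x i : ℝ)| ≤ A) : supNorm x ≤ A := by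
  unfold supNorm
  refine (Nat.cast_le.2 (Finset.sup_le (a := ⌊A⌋₊) fun i _ => ?_)).trans (Nat.floor_le hA)
  refine Nat.le_floor ?_
  have := h i
  rwa [← Int.cast_abs, Int.abs_eq_natAbs, Int.cast_natCast] at this

namespace Fam
variable {c0 R δ b : ℝ} {F : ℝ → Cv d} {χ ξ : ℝ → ℝ} (Φ : Fam d c0 R δ b F χ ξ)
include Φ

theorem pow_mass {z : ℝ} (h0 : 0 ≤ z) (h2 : z ≤ b) (i : ℕ) (x : Zd d) : (F z ^ i) x ≤ ENNReal.ofReal (χ z ^ i) := by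
  refine (apply_le_mass _ x).trans ?_
  have D := Φ.dat z h0 h2
  rw [mass_pow, D.mass, ENNReal.ofReal_pow D.chi_pos.le]

theorem pow_ne {z : ℝ} (h0 : 0 ≤ z) (h2 : z ≤ b) (i : ℕ) (x : Zd d) : (F z ^ i) x ≠ ∞ :=
  ne_top_of_le_ne_top ENNReal.ofReal_ne_top (Φ.pow_mass h0 h2 i x)

theorem re_step {t z : ℝ} (h0 : 0 ≤ t) (h1 : t ≤ z) (h2 : z ≤ b) (i : ℕ) (x : Zd d) :
    ((F z ^ i) x).toReal ≤ ((F t ^ i) x).toReal + (z - t) * i * ((F z ^ (i + 1)) x).toReal := by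
  have h := pow_step (Φ.mono t z h0 h1 h2) (Φ.step t z h0 h1 h2) i x
  rw [add_apply, smul_apply] at h
  have hz := Φ.pow_ne (h0.trans h1) h2 (i + 1) x
  have ht := Φ.pow_ne h0 (h1.trans h2) i x
  have hne : ENNReal.ofReal (z - t) * i * (F z ^ (i + 1)) x ≠ ∞ :=
    ENNReal.mul_ne_top (ENNReal.mul_ne_top ENNReal.ofReal_ne_top (by simp)) hz
  have := ENNReal.toReal_mono (ENNReal.add_ne_top.2 ⟨ht, hne⟩) h
  rw [ENNReal.toReal_add ht hne, ENNReal.toReal_mul, ENNReal.toReal_mul, ENNReal.toReal_ofReal (by linarith)] at this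
  simpa using this

theorem rem_le (hδ : δ ≤ 1 / 2) {z : ℝ} (h0 : 0 ≤ z) (h2 : z ≤ b) : b - z ≤ 2 / χ z := by
  have h := Φ.chi_low z b h0 h2 le_rfl
  have h3 := (Φ.dat b (h0.trans h2) le_rfl).chi_pos
  have h4 : 0 < 1 / χ b := by positivity
  rw [show 2 / χ z = 2 * (1 / χ z) by ring]
  nlinarith

theorem T0_bound (hd : 3 ≤ d) (hc : 0 < c0) (hc1 : c0 ≤ 1) (hδ' : δ ≤ 1 / 2) {ε : ℝ} (hε : 0 < ε) (hε1 : ε < 1)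
    (hb : 0 ≤ b) (x : Zd d) :
    ∑ i ∈ Finset.range (d - 2 + 1), b ^ i * ((F 0 ^ (i + 1)) x).toReal ≤
      CT0 d c0 * (1 / ξ 0) ^ d * XX (ξ 0) (supNorm x) ^ (-((d - 2 - ε) / 2) : ℝ) *
        Real.exp (-(c0 / (8 * d) * supNorm x / ξ b)) := by
  have D := Φ.dat 0 le_rfl hb
  have hσ := D.xi_pos
  have hξb := Φ.xi_mono hδ' le_rfl hb le_rfl
  have hd' : (3:ℝ) ≤ d := by exact_mod_cast hd
  have hd0 : (0:ℝ) < d := by linarith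
  have hR := Φ.R1
  have hR0 : 0 < R := by linarith
  have hcR := Φ.sig_low
  have hr := supNorm_nonneg x
  have hb2 : b ≤ 2 := by
    have := Φ.rem_le hδ' le_rfl hb
    rw [Φ.chi0] at this; linarith
  set X := XX (ξ 0) (supNorm x) with hXd
  have hX1 : 1 ≤ X := XX_one _ _
  have hX0 : 0 < X := by linarith
  set W := c0⁻¹ * √d ^ d * 2 * (d / c0) ^ d * (1 / ξ 0) ^ d * X ^ (-((d - 2 - ε) / 2) : ℝ) *
        Real.exp (-(c0 / (8 * d) * supNorm x / ξ b)) with hW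
  have hW0 : 0 ≤ W := by positivity
  have key : ∀ i ∈ Finset.range (d - 2 + 1), b ^ i * ((F 0 ^ (i + 1)) x).toReal ≤ 2 ^ i * W := by
    intro i hi
    have hid : i + 1 ≤ d := by have := Finset.mem_range.1 hi; omega
    refine mul_le_mul (by gcongr) ?_ ENNReal.toReal_nonneg (by positivity)
    by_cases hx : (F 0 ^ (i + 1)) x = 0
    · rw [hx]; simpa using hW0
    have h1 : ((F 0 ^ (i + 1)) x).toReal ≤ c0⁻¹ / R ^ d := by
      refine ENNReal.toReal_le_of_le_ofReal (by positivity) ?_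
      rw [pow_succ]
      refine (mul_le_mass _ _ _ Φ.base_le x).trans ?_
      rw [mass_pow, D.mass, Φ.chi0]; simp
    have hs2 := pow_supp (fun x hx i => Φ.base_abs hx i) (i + 1) x hx
    have hrd : supNorm x ≤ d * R := by
      refine supNorm_le (by positivity) fun j => (hs2 j).trans ?_
      gcongr
    have hrs : supNorm x / ξ 0 ≤ d / c0 := by
      rw [div_le_div_iff₀ hσ hc]
      nlinarith
    have hdc : 1 ≤ d / c0 := by rw [one_le_div hc]; linarith
    have hXle : X ≤ (d / c0) ^ 2 := by
      rw [hXd]; unfold XX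
      refine max_le (one_le_pow₀ hdc) ?_
      gcongr
    have h3 : (d / c0) ^ d * X ^ (-((d - 2 - ε) / 2) : ℝ) ≥ 1 := by
      have h5 : ((d / c0) ^ 2) ^ (-((d - 2 - ε) / 2) : ℝ) ≤ X ^ (-((d - 2 - ε) / 2) : ℝ) :=
        Real.rpow_le_rpow_of_nonpos hX0 hXle (by linarith)
      have h6 : (d / c0) ^ d * ((d / c0) ^ 2) ^ (-((d - 2 - ε) / 2) : ℝ) = (d / c0) ^ (2 + ε) := by
        rw [← Real.rpow_natCast, ← Real.rpow_natCast (n := 2), ← Real.rpow_mul (by positivity), ← Real.rpow_add (by positivity)]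
        congr 1; push_cast; ring
      have h7 : 1 ≤ (d / c0) ^ (2 + ε) := Real.one_le_rpow hdc (by linarith)
      calc (1:ℝ) ≤ (d / c0) ^ d * ((d / c0) ^ 2) ^ (-((d - 2 - ε) / 2) : ℝ) := by rw [h6]; exact h7
        _ ≤ _ := by gcongr
    have h4 : 2 * Real.exp (-(c0 / (8 * d) * supNorm x / ξ b)) ≥ 1 := by
      have h8 : c0 / (8 * d) * supNorm x / ξ b ≤ 1 / 8 := by
        calc c0 / (8 * d) * supNorm x / ξ b ≤ c0 / (8 * d) * supNorm x / ξ 0 := by gcongr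
          _ = c0 / (8 * d) * (supNorm x / ξ 0) := by ring
          _ ≤ c0 / (8 * d) * (d / c0) := by gcongr
          _ = 1 / 8 := by field_simp
      have := Real.add_one_le_exp (-(c0 / (8 * d) * supNorm x / ξ b))
      linarith
    have h9 : 1 / R ≤ √d / ξ 0 := by
      rw [div_le_div_iff₀ (by linarith) hσ, one_mul]
      refine le_of_sq_le_sq ?_ (by positivity)
      rw [mul_pow, Real.sq_sqrt hd0.le]; exact Φ.sig_up
    calc ((F 0 ^ (i + 1)) x).toReal ≤ c0⁻¹ / R ^ d := h1
      _ = c0⁻¹ * (1 / R) ^ d := by rw [div_pow, one_pow]; ring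
      _ ≤ c0⁻¹ * (√d / ξ 0) ^ d := by gcongr
      _ = c0⁻¹ * √d ^ d * (1 / ξ 0) ^ d * (1 * 1) := by simp only [div_pow, one_pow]; ring
      _ ≤ c0⁻¹ * √d ^ d * (1 / ξ 0) ^ d * (((d / c0) ^ d * X ^ (-((d - 2 - ε) / 2) : ℝ)) *
        (2 * Real.exp (-(c0 / (8 * d) * supNorm x / ξ b)))) := by gcongr
      _ = W := by rw [hW]; ring
  refine (Finset.sum_le_sum key).trans ?_
  rw [← Finset.sum_mul]
  have hsum : ∑ i ∈ Finset.range (d - 2 + 1), (2:ℝ) ^ i ≤ 2 ^ d := by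
    rw [geom_sum_eq (by norm_num)]
    have : (2:ℝ) ^ (d - 2 + 1) ≤ 2 ^ d := pow_le_pow_right₀ (by norm_num) (by omega)
    norm_num; linarith
  calc _ ≤ 2 ^ d * W := by gcongr
    _ = _ := by rw [hW]; unfold CT0; ring

set_option maxHeartbeats 1000000 in
theorem final (hd : 3 ≤ d) (hc : 0 < c0) (hc1 : c0 ≤ 1) (hδ : 0 ≤ δ) (hδ' : δ ≤ 1 / 2) {K ε : ℝ} (hε : 0 < ε) (hε1 : ε < 1)
    (hδd : δ * d ≤ ε / 8)
    (hK128 : 128 ≤ K) (hδK : δ * K ≤ 1 / 8) (hK2 : K ^ (2 * δ) ≤ 2) (hKε : C2 d (c0 / (4 * d)) ^ d ≤ K ^ (ε / 8))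
    (hb : 0 ≤ b) (x : Zd d) :
    F b x ≤ ENNReal.ofReal ((CT0 d c0 + 8 * CE d c0) * (1 / ξ 0) ^ d * XX (ξ 0) (supNorm x) ^ (-((d - 2 - ε) / 2) : ℝ) *
        Real.exp (-(c0 / (8 * d) * supNorm x / ξ b))) := by
  have hd0' : 0 < d := by omega
  have D := Φ.dat 0 le_rfl hb
  have Db := Φ.dat b hb le_rfl
  have hσ := D.xi_pos
  have hd' : (3:ℝ) ≤ d := by exact_mod_cast hd
  have hd0 : (0:ℝ) < d := by linarith
  have hr := supNorm_nonneg x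
  set X := XX (ξ 0) (supNorm x) with hXd
  have hX1 : 1 ≤ X := XX_one _ _
  have hX0 : 0 < X := by linarith
  set r := supNorm x with hrd
  set P := (1 / ξ 0) ^ d * X ^ (-((d - 2 - ε) / 2) : ℝ) * Real.exp (-(c0 / (8 * d) * r / ξ b)) with hP
  have hP0 : 0 < P := by positivity
  set f : ℕ → ℝ → ℝ := fun i t => ((F t ^ i) x).toReal with hf
  set n := d - 2 with hn
  have hnd : d = n + 2 := by omega
  set M1 := χ b with hM1
  have hM1p : 0 < M1 := Db.chi_pos
  obtain ⟨C, hC⟩ := incr (fun i => M1 ^ i) b n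
  set T : ℝ → ℝ := fun t => ∑ i ∈ Finset.range (n + 1), (b - t) ^ i * f (i + 1) t with hT
  set w : ℝ → ℝ := fun t => (1 + χ t / X) ^ (-(1/4) : ℝ) with hw
  set Q := CE d c0 * P with hQ
  have hA0 : 0 ≤ B0 d c0 * C2 d (c0 / (4 * d)) ^ d := by
    have := B0_pos hd0' hc
    unfold C2
    positivity
  have hCE : 0 ≤ CE d c0 := by
    unfold CE
    have : (0:ℝ) ≤ d - 1 := by linarith
    positivity
  have hQ0 : 0 ≤ Q := by positivity
  have hg : ∀ z, 0 ≤ z → z ≤ b → (n + 1) * (b - z) ^ n * f (n + 2) z ≤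
      Q * (χ z ^ 2 * (X⁻¹ * (1 + χ z / X) ^ (-(5/4) : ℝ))) := by
    intro z h0 h2
    have Dz := Φ.dat z h0 h2
    have hχ := Dz.chi_pos
    have hξ := Dz.xi_pos
    have hχ1 := Φ.one_le h0 h2
    have h1 : f (n + 2) z ≤ B0 d c0 * C2 d (c0 / (4 * d)) ^ d * χ z ^ (ε / 8) * (χ z / ξ z) ^ d * Real.exp (-(c0 / (4 * d)) / ξ z * r) := by
      refine ENNReal.toReal_le_of_le_ofReal (by positivity) ?_
      rw [← hnd]
      exact Φ.dbound hd0' hc hc1 hδ hδ' (by positivity) hK128 hδK hK2 hKε h0 h2 x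
    have h3 : b - z ≤ 2 / χ z := Φ.rem_le hδ' h0 h2
    have h4 : Real.exp (-(c0 / (4 * d)) / ξ z * r) ≤ Real.exp (-(c0 / (8 * d) * r / ξ b)) * Real.exp (-(c0 / (8 * d) * r / ξ z)) := by
      rw [← Real.exp_add, Real.exp_le_exp]
      have h5 : c0 / (8 * d) * r / ξ b ≤ c0 / (8 * d) * r / ξ z := by
        have := Φ.xi_mono hδ' h0 h2 le_rfl
        gcongr
      have h6 : -(c0 / (4 * d)) / ξ z * r = -(2 * (c0 / (8 * d) * r / ξ z)) := by field_simp; ring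
      rw [h6]; linarith
    have h5 := Φ.xi_low 0 z le_rfl h0 h2
    rw [Φ.chi0, div_one] at h5
    have h6 := keyb hd (c0 / (8 * d)) (ξ 0) (ξ z) r (χ z) ε δ (by positivity) hσ (Φ.xi_mono hδ' le_rfl h0 h2) hr hχ1 hε hε1 hδd h5
    rw [← hXd] at h6
    have hbz : 0 ≤ b - z := by linarith
    calc (n + 1) * (b - z) ^ n * f (n + 2) z
        ≤ (n + 1) * (2 / χ z) ^ n * (B0 d c0 * C2 d (c0 / (4 * d)) ^ d * χ z ^ (ε / 8) * (χ z / ξ z) ^ d *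
          (Real.exp (-(c0 / (8 * d) * r / ξ b)) * Real.exp (-(c0 / (8 * d) * r / ξ z)))) := by
          have : 0 ≤ f (n + 2) z := ENNReal.toReal_nonneg
          gcongr
          exact h1.trans (by gcongr)
      _ = (n + 1) * 2 ^ n * (B0 d c0 * C2 d (c0 / (4 * d)) ^ d) * Real.exp (-(c0 / (8 * d) * r / ξ b)) * χ z ^ 2 *
          (χ z ^ (ε / 8) * ((1 / ξ z) ^ d * Real.exp (-(c0 / (8 * d) * r / ξ z)))) := by
          have e : (2 / χ z) ^ n * (χ z / ξ z) ^ d = 2 ^ n * χ z ^ 2 * (1 / ξ z) ^ d := by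
            rw [hnd, div_pow, div_pow, div_pow, one_pow, pow_add (χ z)]
            field_simp
          calc _ = ((2 / χ z) ^ n * (χ z / ξ z) ^ d) * ((n + 1) * (B0 d c0 * C2 d (c0 / (4 * d)) ^ d) * χ z ^ (ε / 8) *
                 (Real.exp (-(c0 / (8 * d) * r / ξ b)) * Real.exp (-(c0 / (8 * d) * r / ξ z)))) := by ring
            _ = _ := by rw [e]; ring
      _ ≤ (n + 1) * 2 ^ n * (B0 d c0 * C2 d (c0 / (4 * d)) ^ d) * Real.exp (-(c0 / (8 * d) * r / ξ b)) * χ z ^ 2 *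
          (4 * (1 + d.factorial / (c0 / (8 * d)) ^ d) * (1 / ξ 0) ^ d *
      (X ^ (-((d - 2 - ε) / 2) : ℝ) * (X⁻¹ * (1 + χ z / X) ^ (-(5/4) : ℝ)))) := by
          refine mul_le_mul_of_nonneg_left h6 (by positivity)
      _ = _ := by
          have : (n:ℝ) + 1 = d - 1 := by rw [hnd]; push_cast; ring
          rw [hQ, hP, this]
          unfold CE
          ring
  have hstep : ∀ t z, 0 ≤ t → t ≤ z → z ≤ b →
      (T z + 8 * Q * w z) - (T t + 8 * Q * w t) ≤ (Q * (2 * M1 ^ 3) + C) * (z - t) ^ 2 := by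
    intro t z h0 h1 h2
    have Dt := Φ.dat t h0 (h1.trans h2)
    have Dz := Φ.dat z (h0.trans h1) h2
    have hχt := Dt.chi_pos
    have hχz := Dz.chi_pos
    have hm := Φ.chi_mono h0 h1 h2
    have hmb := Φ.chi_mono (h0.trans h1) h2 le_rfl
    have hΔ : 0 ≤ z - t := by linarith
    have hA := hC (fun i => f i t) (fun i => f i z) (b - z) (z - t) (by linarith) hΔ (by linarith)
      (fun i => ENNReal.toReal_nonneg) (fun i => ENNReal.toReal_nonneg) (fun i => Φ.re_step h0 h1 h2 i x)
      (fun i => (ENNReal.toReal_le_of_le_ofReal (by positivity) (Φ.pow_mass (h0.trans h1) h2 i x)).trans (by gcongr))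
    rw [show b - z + (z - t) = b - t by ring] at hA
    have hB := hg z (h0.trans h1) h2
    set h := X⁻¹ * (1 + χ z / X) ^ (-(5/4) : ℝ) with hh
    have hh0 : 0 ≤ h := by positivity
    have hh1 : h ≤ 1 := by
      have h3 : X⁻¹ ≤ 1 := inv_le_one_of_one_le₀ hX1
      have h4 : (1 + χ z / X) ^ (-(5/4) : ℝ) ≤ 1 := by
        refine Real.rpow_le_one_of_one_le_of_nonpos ?_ (by norm_num)
        have : 0 < χ z / X := by positivity
        linarith
      rw [hh]
      exact mul_le_one₀ h3 (by positivity) h4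
    have hup := Φ.chi_up t z h0 h1 h2
    have hlow := Φ.chi_low t z h0 h1 h2
    have e1 : 1 / χ t - 1 / χ z = (χ z - χ t) / (χ t * χ z) := by field_simp
    rw [e1] at hup hlow
    rw [div_le_iff₀ (by positivity)] at hup
    rw [le_div_iff₀ (by positivity)] at hlow
    -- Δ χ_z² ≤ 2 (χz - χt) + 2 M1^3 Δ²
    have hd1 : (z - t) * (χ t * χ z) ≤ 2 * (χ z - χ t) := by
      have : 0 ≤ (z - t) * (χ t * χ z) := by positivity
      nlinarith
    have hd2 : (z - t) * χ z ^ 2 ≤ 2 * (χ z - χ t) + 2 * M1 ^ 3 * (z - t) ^ 2 := by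
      have h5 : (z - t) * χ z * (χ z - χ t) ≤ (z - t) * χ z * ((z - t) * (χ t * χ z)) := by gcongr
      have h6 : (z - t) * χ z * ((z - t) * (χ t * χ z)) ≤ (z - t) * M1 * ((z - t) * (M1 * M1)) := by
        have : χ t ≤ M1 := hm.trans hmb
        gcongr
      have h7 : 0 ≤ M1 ^ 3 * (z - t) ^ 2 := by positivity
      nlinarith
    have hrw := rpow_w (x := 1 + χ t / X) (y := 1 + χ z / X) (by positivity) (by gcongr)
    have e2 : (1 + χ z / X - (1 + χ t / X)) * (1 + χ z / X) ^ (-(5/4) : ℝ) = (χ z - χ t) * h := by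
      rw [hh]; field_simp; ring
    rw [e2] at hrw
    have hrw' : (χ z - χ t) * h ≤ 4 * (w t - w z) := hrw
    have hfin : (z - t) * ((n + 1) * (b - z) ^ n * f (n + 2) z) ≤ Q * (8 * (w t - w z) + 2 * M1 ^ 3 * (z - t) ^ 2) := by
      calc (z - t) * ((n + 1) * (b - z) ^ n * f (n + 2) z) ≤ (z - t) * (Q * (χ z ^ 2 * h)) := by gcongr
        _ = Q * (((z - t) * χ z ^ 2) * h) := by ring
        _ ≤ Q * ((2 * (χ z - χ t) + 2 * M1 ^ 3 * (z - t) ^ 2) * h) := by gcongr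
        _ = Q * (2 * ((χ z - χ t) * h) + 2 * M1 ^ 3 * (z - t) ^ 2 * h) := by ring
        _ ≤ Q * (2 * (4 * (w t - w z)) + 2 * M1 ^ 3 * (z - t) ^ 2 * 1) := by gcongr
        _ = _ := by ring
    have hA' : T z - T t ≤ (z - t) * (n + 1) * (b - z) ^ n * f (n + 2) z + C * (z - t) ^ 2 := hA
    have e3 : (z - t) * (n + 1) * (b - z) ^ n * f (n + 2) z = (z - t) * ((n + 1) * (b - z) ^ n * f (n + 2) z) := by ring
    rw [e3] at hA'
    linarith
  have hmain := quad_telescope (f := fun t => T t + 8 * Q * w t) hb hstep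
  have hTb : T b = f 1 b := by
    simp only [hT, sub_self]
    rw [Finset.sum_range_succ', Finset.sum_eq_zero]
    · simp
    · intro i _; simp
  have hwb : 0 ≤ w b := by have := Db.chi_pos; positivity
  have hw0 : w 0 ≤ 1 := by
    refine Real.rpow_le_one_of_one_le_of_nonpos ?_ (by norm_num)
    have : 0 < χ 0 / X := div_pos D.chi_pos hX0
    linarith
  have hT0 : T 0 ≤ CT0 d c0 * P := by
    have := Φ.T0_bound hd hc hc1 hδ' hε hε1 hb x
    simp only [hT, sub_zero, hf]
    refine this.trans (le_of_eq ?_)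
    rw [hP]; ring
  have hres : f 1 b ≤ (CT0 d c0 + 8 * CE d c0) * P := by
    have h1 : T b + 8 * Q * w b ≤ T 0 + 8 * Q * w 0 := hmain
    have h2 : 8 * Q * w 0 ≤ 8 * Q * 1 := by gcongr
    have h3 : 0 ≤ 8 * Q * w b := by positivity
    rw [hTb] at h1
    rw [hQ] at h1 h2 h3
    linarith
  have hne := Φ.pow_ne hb le_rfl 1 x
  simp only [hf, pow_one] at hres
  rw [pow_one] at hne
  rw [← ENNReal.ofReal_toReal hne]
  refine ENNReal.ofReal_le_ofReal (hres.trans (le_of_eq ?_))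
  rw [hP]; ring

end Fam
end NC

namespace NC
variable {d : ℕ}

theorem tsum_pi (g : ℤ → ℝ≥0∞) (d : ℕ) : ∑' x : Fin d → ℤ, ∏ i, g (x i) = (∑' n, g n) ^ d := by
  induction d with
  | zero => simp
  | succ n ih =>
    rw [← (Fin.consEquiv (fun _ : Fin (n+1) => ℤ)).tsum_eq, ENNReal.tsum_prod']
    simp only [Fin.consEquiv_apply, Fin.prod_univ_succ, Fin.cons_zero, Fin.cons_succ]
    simp_rw [ENNReal.tsum_mul_left]
    rw [ih, ENNReal.tsum_mul_right, pow_succ, mul_comm]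

theorem tsum_exp_int {c : ℝ} (hc : 0 < c) : ∑' n : ℤ, ENNReal.ofReal (Real.exp (-c * |(n:ℝ)|)) ≠ ∞ := by
  have h1 : Summable fun n : ℕ => Real.exp (-c * (n:ℝ)) := by
    have : Summable fun n : ℕ => (Real.exp (-c)) ^ n :=
      summable_geometric_of_lt_one (Real.exp_pos _).le (Real.exp_lt_one_iff.2 (by linarith))
    refine this.congr fun n => ?_
    rw [← Real.exp_nat_mul]; congr 1; ring
  have h2 : Summable fun n : ℤ => Real.exp (-c * |(n:ℝ)|) := by
    refine Summable.of_nat_of_neg ?_ ?_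
    · simpa using h1
    · simpa using h1
  exact h2.tsum_ofReal_ne_top

theorem tsum_exp_sup (hd : 0 < d) {c : ℝ} (hc : 0 < c) : ∑' x : Zd d, ENNReal.ofReal (Real.exp (-c * supNorm x)) ≠ ∞ := by
  have hd' : (0:ℝ) < d := by exact_mod_cast hd
  have h1 := tsum_pi (fun n => ENNReal.ofReal (Real.exp (-(c / d) * |(n:ℝ)|))) d
  refine ne_top_of_le_ne_top (b := (∑' n : ℤ, ENNReal.ofReal (Real.exp (-(c / d) * |(n:ℝ)|))) ^ d)
    (ENNReal.pow_ne_top (tsum_exp_int (by positivity))) ?_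
  rw [← h1]
  refine ENNReal.tsum_le_tsum fun x => ?_
  rw [← ENNReal.ofReal_prod_of_nonneg (fun _ _ => (Real.exp_pos _).le), ← Real.exp_sum]
  refine ENNReal.ofReal_le_ofReal (Real.exp_le_exp.2 ?_)
  rw [← Finset.mul_sum]
  have : ∑ i, |(x i : ℝ)| ≤ d * supNorm x := by
    refine (Finset.sum_le_card_nsmul _ _ (supNorm x) fun i _ => abs_le_supNorm x i).trans ?_
    simp
  have h2 : c / d * ∑ i, |(x i : ℝ)| ≤ c / d * (d * supNorm x) := by gcongr
  rw [← mul_assoc, div_mul_cancel₀ _ hd'.ne'] at h2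
  linarith

theorem sqNorm_le (x : Zd d) : sqNorm x ≤ d * supNorm x ^ 2 := by
  unfold sqNorm
  refine (Finset.sum_le_card_nsmul _ _ (supNorm x ^ 2) fun i _ => ?_).trans (by simp)
  rw [← sq_abs]
  have := abs_le_supNorm x i
  gcongr

theorem exp_sums (hd : 0 < d) {C c : ℝ} (hC : 0 < C) (hc : 0 < c) {f : Cv d} 
    (hf : ∀ x, f x ≤ ENNReal.ofReal (C * Real.exp (-c * supNorm x))) : mass f ≠ ∞ ∧ cs sq f ≠ ∞ := by
  constructor
  · rw [mass_eq]
    refine ne_top_of_le_ne_top ?_ (ENNReal.tsum_le_tsum hf)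
    simp_rw [ENNReal.ofReal_mul hC.le]
    rw [ENNReal.tsum_mul_left]
    exact ENNReal.mul_ne_top ENNReal.ofReal_ne_top (tsum_exp_sup hd hc)
  · unfold cs
    have h1 : ∀ x : Zd d, f x * sq x ≤ ENNReal.ofReal (C * (d * (8 / c ^ 2))) * ENNReal.ofReal (Real.exp (-(c/2) * supNorm x)) := by
      intro x
      refine (mul_le_mul' (hf x) le_rfl).trans ?_
      unfold sq
      rw [← ENNReal.ofReal_mul (by positivity), ← ENNReal.ofReal_mul (by positivity)]
      refine ENNReal.ofReal_le_ofReal ?_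
      have hs := supNorm_nonneg x
      have h2 := Real.pow_div_factorial_le_exp (c / 2 * supNorm x) (by positivity) 2
      have h3 : supNorm x ^ 2 ≤ 8 / c ^ 2 * Real.exp (c / 2 * supNorm x) := by
        rw [div_mul_eq_mul_div, le_div_iff₀ (by positivity)]
        norm_num [Nat.factorial] at h2
        linarith
      have e : Real.exp (-c * supNorm x) = Real.exp (-(c/2) * supNorm x) * Real.exp (-(c/2) * supNorm x) := by
        rw [← Real.exp_add]; congr 1; ring
      have e2 : Real.exp (-(c/2) * supNorm x) * Real.exp (c/2 * supNorm x) = 1 := by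
        rw [← Real.exp_add]; simp
      calc C * Real.exp (-c * supNorm x) * sqNorm x ≤ C * Real.exp (-c * supNorm x) * (d * (8 / c ^ 2 * Real.exp (c / 2 * supNorm x))) := by
            gcongr; exact (sqNorm_le x).trans (by gcongr)
        _ = C * (d * (8 / c ^ 2)) * Real.exp (-(c/2) * supNorm x) * (Real.exp (-(c/2) * supNorm x) * Real.exp (c/2 * supNorm x)) := by
            rw [e]; ring
        _ = _ := by rw [e2, mul_one]
    refine ne_top_of_le_ne_top ?_ (ENNReal.tsum_le_tsum h1)
    rw [ENNReal.tsum_mul_left]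
    exact ENNReal.mul_ne_top ENNReal.ofReal_ne_top (tsum_exp_sup hd (by positivity))

theorem mono_of_local {f : ℝ → ℝ} {a b : ℝ} (hab : a ≤ b) (hc : ContinuousOn f (Set.Icc a b))
    (h : ∀ t ∈ Set.Ico a b, ∀ᶠ z in nhdsWithin t (Set.Ioi t), f z ≤ f t) : f b ≤ f a := by
  have hcl : IsClosed ({t | f t ≤ f a} ∩ Set.Icc a b) := by
    have := hc.preimage_isClosed_of_isClosed isClosed_Icc (isClosed_Iic (a := f a))
    rwa [Set.inter_comm] at this
  refine hcl.Icc_subset_of_forall_exists_gt (le_refl (f a)) ?_ (Set.right_mem_Icc.2 hab)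
  rintro t ⟨ht, ht2⟩ y hy
  have h1 := h t ht2
  have h2 : ∀ᶠ z in nhdsWithin t (Set.Ioi t), z ∈ Set.Ioc t y := Ioc_mem_nhdsGT hy
  obtain ⟨z, hz1, hz2⟩ := (h1.and h2).exists
  exact ⟨z, hz1.trans ht, hz2⟩

/-- real function as an element of `Cv` -/
def ofR (K : Zd d → ℝ) : Cv d := fun x => ENNReal.ofReal (K x)

theorem conv3 (f g h : Cv d) (x : Zd d) :
    ∑' p : Zd d × Zd d, f p.1 * g p.2 * h (x - p.1 - p.2) = (f * (g * h)) x := by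
  rw [ENNReal.tsum_prod', mul_apply]
  refine tsum_congr fun y => ?_
  rw [mul_apply, ← ENNReal.tsum_mul_left]
  exact tsum_congr fun z => mul_assoc _ _ _

theorem conv3_real {G : Cv d} {K : Zd d → ℝ} (hK : ∀ x, 0 ≤ K x) (hG : ∀ x, G x ≠ ∞) (x : Zd d)
    (hfin : (G * (ofR K * G)) x ≠ ∞) :
    (Summable fun p : Zd d × Zd d => (G p.1).toReal * K p.2 * (G (x - p.1 - p.2)).toReal) ∧
    ∑' p : Zd d × Zd d, (G p.1).toReal * K p.2 * (G (x - p.1 - p.2)).toReal = ((G * (ofR K * G)) x).toReal := by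
  rw [← conv3] at hfin ⊢
  have e : ∀ p : Zd d × Zd d, (G p.1).toReal * K p.2 * (G (x - p.1 - p.2)).toReal = 
      (G p.1 * ofR K p.2 * G (x - p.1 - p.2)).toReal := by
    intro p
    rw [ENNReal.toReal_mul, ENNReal.toReal_mul]
    unfold ofR
    rw [ENNReal.toReal_ofReal (hK _)]
  simp_rw [e]
  refine ⟨ENNReal.summable_toReal hfin, ?_⟩
  rw [ENNReal.tsum_toReal_eq]
  intro p
  exact ENNReal.mul_ne_top (ENNReal.mul_ne_top (hG _) ENNReal.ofReal_ne_top) (hG _)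

theorem slope_event {ι : Type*} (s : Finset ι) (w : ι → ℝ) (g : ι → ℝ → ℝ) (g' : ι → ℝ) (t L : ℝ)
    (hg : ∀ i ∈ s, HasDerivWithinAt (g i) (g' i) (Set.Ici t) t) (hL : L < ∑ i ∈ s, w i * g' i) :
    ∀ᶠ z in nhdsWithin t (Set.Ioi t), L * (z - t) ≤ ∑ i ∈ s, w i * (g i z - g i t) := by
  have h1 : HasDerivWithinAt (fun z => ∑ i ∈ s, w i * g i z) (∑ i ∈ s, w i * g' i) (Set.Ici t) t :=
    HasDerivWithinAt.fun_sum fun i hi => (hg i hi).const_mul (w i)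
  have h2 := (hasDerivWithinAt_iff_tendsto_slope' (s := Set.Ioi t) (by simp)).1 (h1.mono Set.Ioi_subset_Ici_self)
  filter_upwards [h2.eventually (lt_mem_nhds hL), self_mem_nhdsWithin] with z hz hz2
  have hz2' : 0 < z - t := sub_pos.2 hz2
  rw [slope_def_field, lt_div_iff₀ hz2'] at hz
  have e : ∑ i ∈ s, w i * (g i z - g i t) = ∑ i ∈ s, w i * g i z - ∑ i ∈ s, w i * g i t := by
    rw [← Finset.sum_sub_distrib]
    exact Finset.sum_congr rfl fun _ _ => mul_sub _ _ _
  rw [e]; exact hz.le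

end NC

namespace NC
variable {d : ℕ}

variable {c0 : ℝ} (M : Model d c0)

def Jc : Cv d := ofR M.K.J
def Gc (t : ℝ) : Cv d := M.G t
def Hc (t : ℝ) : Cv d := ofR (M.H t)

def Good (t : ℝ) : Prop := 0 ≤ t ∧ ENNReal.ofReal t < M.βc

theorem Good.mono {M : Model d c0} {t z : ℝ} (h : Good M z) (h0 : 0 ≤ t) (htz : t ≤ z) : Good M t :=
  ⟨h0, (ENNReal.ofReal_le_ofReal htz).trans_lt h.2⟩

theorem mass_J : mass (Jc M) = 1 := by
  rw [mass_eq]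
  unfold Jc ofR
  rw [← ENNReal.ofReal_tsum_of_nonneg M.K.nonneg M.K.summable, M.K.norm_one, ENNReal.ofReal_one]

theorem sigma_sq : M.sigma ^ 2 = ∑' x, sqNorm x * M.K.J x := by
  unfold Model.sigma AdmissibleKernel.sigma
  exact Real.sq_sqrt (tsum_nonneg fun x => mul_nonneg (sqNorm_nonneg x) (M.K.nonneg x))

theorem sq_J : cs sq (Jc M) = ENNReal.ofReal (M.sigma ^ 2) := by
  rw [sigma_sq, ENNReal.ofReal_tsum_of_nonneg (fun x => mul_nonneg (sqNorm_nonneg x) (M.K.nonneg x)) M.K.summable_sq]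
  unfold cs Jc ofR sq
  refine tsum_congr fun x => ?_
  rw [ENNReal.ofReal_mul (sqNorm_nonneg x), mul_comm]

theorem F_eq (t : ℝ) : M.F t = Jc M * Gc M t := by
  funext x
  rw [mul_apply]
  rfl

theorem chi_eq (t : ℝ) : M.chi t = mass (Gc M t) := by
  rw [mass_eq]; rfl

theorem J_symm : IsSymmFun (Jc M) := by
  intro p e x
  unfold Jc ofR
  rw [M.K.symm p e x]

theorem mass_F (t : ℝ) : mass (Jc M * Gc M t) = mass (Gc M t) := by
  rw [mass_mul, mass_J, one_mul]

theorem sq_F (t : ℝ) : cs sq (Jc M * Gc M t) = ENNReal.ofReal (M.sigma ^ 2) * mass (Gc M t) + cs sq (Gc M t) := by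
  rw [cs_sq_mul _ _ (symm_neg (J_symm M)), sq_J, mass_J, one_mul]

theorem xiSq_eq (t : ℝ) : M.xiSq t = cs sq (Jc M * Gc M t) / mass (Gc M t) := by
  unfold Model.xiSq
  rw [chi_eq, F_eq]
  congr 1
  unfold cs sq
  exact tsum_congr fun x => mul_comm _ _

theorem G_fin (hd : 0 < d) {t : ℝ} (h : Good M t) : mass (Gc M t) ≠ ∞ ∧ cs sq (Gc M t) ≠ ∞ := by
  obtain ⟨C, hC, c, hc, hx⟩ := M.expDecay h.1 h.2
  exact exp_sums hd hC hc hx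

theorem H_fin (hd : 0 < d) {t : ℝ} (h : Good M t) : mass (Hc M t) ≠ ∞ ∧ cs sq (Hc M t) ≠ ∞ := by
  obtain ⟨C, hC, c, hc, hx⟩ := M.H_expDecay h.1 h.2
  exact exp_sums hd hC hc fun x => ENNReal.ofReal_le_ofReal (hx x)

theorem G_mono {t z : ℝ} (h0 : 0 ≤ t) (htz : t ≤ z) (hz : ENNReal.ofReal z ≤ M.βc) : Gc M t ≤ Gc M z :=
  fun x => M.mono x h0 htz hz

theorem G_step {t z : ℝ} (h0 : 0 ≤ t) (htz : t ≤ z) (hz : Good M z) :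
    Gc M z ≤ Gc M t + ENNReal.ofReal (z - t) • (Gc M t * (Jc M * Gc M z)) := by
  intro x
  rw [add_apply, smul_apply, ← conv3]
  exact M.I1 h0 htz hz.2 x

theorem G_zero : Gc M 0 = 1 := by
  funext x
  rw [one_apply]
  exact M.init x

theorem G_symm (t : ℝ) : IsSymmFun (Gc M t) := M.symm t

theorem cs_toReal {w : Zd d → ℝ} (hw : ∀ x, 0 ≤ w x) {f : Cv d} (hf : ∀ x, f x ≠ ∞)
    (h : cs (fun x => ENNReal.ofReal (w x)) f ≠ ∞) :
    HasSum (fun x => w x * (f x).toReal) (cs (fun x => ENNReal.ofReal (w x)) f).toReal := by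
  have e : ∀ x, w x * (f x).toReal = (f x * ENNReal.ofReal (w x)).toReal := by
    intro x
    rw [ENNReal.toReal_mul, ENNReal.toReal_ofReal (hw x), mul_comm]
  simp_rw [e]
  unfold cs
  rw [ENNReal.tsum_toReal_eq (fun x => ENNReal.mul_ne_top (hf x) ENNReal.ofReal_ne_top)]
  exact (ENNReal.summable_toReal h).hasSum

theorem dini (hd : 0 < d) {t b L : ℝ} (h0 : 0 ≤ t) (htb : t < b) (hb : Good M b) {w : Zd d → ℝ}
    (hw : ∀ x, 0 ≤ w x)
    (hG : ∀ z, Good M z → cs (fun x => ENNReal.ofReal (w x)) (Gc M z) ≠ ∞)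
    (hA : cs (fun x => ENNReal.ofReal (w x)) (Gc M t * (Jc M * Gc M t)) ≠ ∞)
    (hB : cs (fun x => ENNReal.ofReal (w x)) (Gc M t * (Hc M t * Gc M t)) ≠ ∞)
    (hL : L < (cs (fun x => ENNReal.ofReal (w x)) (Gc M t * (Jc M * Gc M t))).toReal -
      (cs (fun x => ENNReal.ofReal (w x)) (Gc M t * (Hc M t * Gc M t))).toReal) :
    ∀ᶠ z in nhdsWithin t (Set.Ioi t), L * (z - t) ≤
      (cs (fun x => ENNReal.ofReal (w x)) (Gc M z)).toReal - (cs (fun x => ENNReal.ofReal (w x)) (Gc M t)).toReal := by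
  have ht : Good M t := hb.mono h0 htb.le
  have fG : ∀ z, Good M z → ∀ x, Gc M z x ≠ ∞ := fun z hz x =>
    ne_top_of_le_ne_top (G_fin M hd hz).1 (apply_le_mass _ x)
  have f1 : ∀ x, (Gc M t * (Jc M * Gc M t)) x ≠ ∞ := fun x =>
    ne_top_of_le_ne_top (b := mass (Gc M t * (Jc M * Gc M t)))
      (by rw [mass_mul, mass_mul, mass_J, one_mul]; exact ENNReal.mul_ne_top (G_fin M hd ht).1 (G_fin M hd ht).1)
      (apply_le_mass _ x)
  have f2 : ∀ x, (Gc M t * (Hc M t * Gc M t)) x ≠ ∞ := fun x =>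
    ne_top_of_le_ne_top (b := mass (Gc M t * (Hc M t * Gc M t)))
      (by rw [mass_mul, mass_mul]; exact ENNReal.mul_ne_top (G_fin M hd ht).1 (ENNReal.mul_ne_top (H_fin M hd ht).1 (G_fin M hd ht).1))
      (apply_le_mass _ x)
  have hs := (cs_toReal hw f1 hA).sub (cs_toReal hw f2 hB)
  obtain ⟨s, hs⟩ := (hs.eventually (lt_mem_nhds hL)).exists
  have hI : ∀ x, ((Gc M t * (Jc M * Gc M t)) x).toReal - ((Gc M t * (Hc M t * Gc M t)) x).toReal ≤ M.G' t x := by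
    intro x
    refine le_trans (le_of_eq ?_) (M.I2 ht.1 ht.2 x)
    have c1 := conv3_real (G := Gc M t) M.K.nonneg (fG t ht) x (f1 x)
    have c2 := conv3_real (G := Gc M t) (M.H_nonneg t) (fG t ht) x (f2 x)
    have e1 : ((Gc M t * (Jc M * Gc M t)) x).toReal = _ := c1.2.symm
    have e2 : ((Gc M t * (Hc M t * Gc M t)) x).toReal = _ := c2.2.symm
    rw [e1, e2, ← c1.1.tsum_sub c2.1]
    refine tsum_congr fun p => ?_
    show _ = (Gc M t p.1).toReal * (M.K.J p.2 - M.H t p.2) * (Gc M t (x - p.1 - p.2)).toReal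
    ring
  have hL2 : L < ∑ x ∈ s, w x * M.G' t x := by
    refine hs.trans_le (Finset.sum_le_sum fun x _ => ?_)
    rw [← mul_sub]
    exact mul_le_mul_of_nonneg_left (hI x) (hw x)
  have hev := slope_event s w (fun x z => (M.G z x).toReal) (M.G' t) t L
    (fun x _ => (M.deriv x ht.1 ht.2).mono (Set.Ici_subset_Ici.2 h0)) hL2
  have hev2 : ∀ᶠ z in nhdsWithin t (Set.Ioi t), z ∈ Set.Ioc t b := Ioc_mem_nhdsGT htb
  filter_upwards [hev, hev2] with z hz hz2
  refine hz.trans ?_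
  have gz : Good M z := hb.mono (h0.trans hz2.1.le) hz2.2
  have hs3 := (cs_toReal hw (fG z gz) (hG z gz)).sub (cs_toReal hw (fG t ht) (hG t ht))
  have := sum_le_hasSum s (fun x _ => ?_) hs3
  · refine le_trans (le_of_eq ?_) this
    refine Finset.sum_congr rfl fun x _ => ?_
    rw [← mul_sub]; rfl
  · rw [← mul_sub]
    exact mul_nonneg (hw x) (sub_nonneg.2 (ENNReal.toReal_mono (fG z gz x) (G_mono M h0 hz2.1.le gz.2.le x)))
end NC

namespace NC
variable {d : ℕ}

theorem lip_cont {f : ℝ → ℝ} {a b K : ℝ} (hK : 0 ≤ K) (hm : ∀ t ∈ Set.Icc a b, ∀ z ∈ Set.Icc a b, t ≤ z → f t ≤ f z)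
    (h : ∀ t ∈ Set.Icc a b, ∀ z ∈ Set.Icc a b, t ≤ z → f z ≤ f t + K * (z - t)) : ContinuousOn f (Set.Icc a b) := by
  have : LipschitzOnWith ⟨K, hK⟩ f (Set.Icc a b) := by
    refine LipschitzOnWith.of_dist_le_mul fun x hx y hy => ?_
    rw [Real.dist_eq, Real.dist_eq]
    show _ ≤ K * _
    have key : ∀ x ∈ Set.Icc a b, ∀ y ∈ Set.Icc a b, x ≤ y → |f x - f y| ≤ K * |x - y| := by
      intro x hx y hy h'
      rw [abs_sub_comm x y, abs_of_nonneg (sub_nonneg.2 h'), abs_sub_comm, abs_of_nonneg (sub_nonneg.2 (hm x hx y hy h'))]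
      linarith [h x hx y hy h']
    rcases le_total x y with h' | h'
    · exact key x hx y hy h'
    · rw [abs_sub_comm, abs_sub_comm x y]; exact key y hy x hx h'
  exact this.continuousOn

variable {c0 : ℝ} (M : Model d c0)

def Xr (t : ℝ) : ℝ := (mass (Gc M t)).toReal
def Sr (t : ℝ) : ℝ := (cs sq (Jc M * Gc M t)).toReal

theorem S_fin (hd : 0 < d) {t : ℝ} (h : Good M t) : cs sq (Jc M * Gc M t) ≠ ∞ := by
  rw [sq_F]
  exact ENNReal.add_ne_top.2 ⟨ENNReal.mul_ne_top ENNReal.ofReal_ne_top (G_fin M hd h).1, (G_fin M hd h).2⟩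

theorem mass_one : mass (1 : Cv d) = 1 := cs_one char_one

theorem X_zero : Xr M 0 = 1 := by
  unfold Xr; rw [G_zero, mass_one]; rfl

theorem X_mono (hd : 0 < d) {t z : ℝ} (h0 : 0 ≤ t) (htz : t ≤ z) (hz : Good M z) : Xr M t ≤ Xr M z :=
  ENNReal.toReal_mono (G_fin M hd hz).1 (cs_mono (G_mono M h0 htz hz.2.le))

theorem S_mono (hd : 0 < d) {t z : ℝ} (h0 : 0 ≤ t) (htz : t ≤ z) (hz : Good M z) : Sr M t ≤ Sr M z :=
  ENNReal.toReal_mono (S_fin M hd hz) (cs_mono (cmul_le le_rfl (G_mono M h0 htz hz.2.le)))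

theorem S_zero : Sr M 0 = M.sigma ^ 2 := by
  unfold Sr; rw [G_zero, mul_one, sq_J, ENNReal.toReal_ofReal (sq_nonneg _)]

theorem X_one (hd : 0 < d) {t : ℝ} (h : Good M t) : 1 ≤ Xr M t := by
  rw [← X_zero M]; exact X_mono M hd le_rfl h.1 h

theorem S_pos (hd : 0 < d) (hσ : 0 < M.sigma) {t : ℝ} (h : Good M t) : 0 < Sr M t := by
  have := S_mono M hd le_rfl h.1 h
  rw [S_zero] at this
  have : 0 < M.sigma ^ 2 := by positivity
  linarith

theorem F_step {t z : ℝ} (h0 : 0 ≤ t) (htz : t ≤ z) (hz : Good M z) :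
    Jc M * Gc M z ≤ Jc M * Gc M t + ENNReal.ofReal (z - t) • (Jc M * Gc M t * (Jc M * Gc M z)) := by
  have := cmul_le (le_refl (Jc M)) (G_step M h0 htz hz)
  rwa [mul_add, mul_smul_comm, ← mul_assoc (Jc M) (Gc M t)] at this

theorem mass_ofReal (hd : 0 < d) {t : ℝ} (h : Good M t) : mass (Gc M t) = ENNReal.ofReal (Xr M t) :=
  (ENNReal.ofReal_toReal (G_fin M hd h).1).symm

theorem S_ofReal (hd : 0 < d) {t : ℝ} (h : Good M t) : cs sq (Jc M * Gc M t) = ENNReal.ofReal (Sr M t) :=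
  (ENNReal.ofReal_toReal (S_fin M hd h)).symm

theorem X_step (hd : 0 < d) {t z : ℝ} (h0 : 0 ≤ t) (htz : t ≤ z) (hz : Good M z) :
    Xr M z ≤ Xr M t + (z - t) * (Xr M t * Xr M z) := by
  have ht := hz.mono h0 htz
  have p1 := X_one M hd ht
  have p2 := X_one M hd hz
  have h := cs_mono (w := fun _ => 1) (G_step M h0 htz hz)
  rw [cs_add, cs_smul] at h
  change mass _ ≤ mass _ + _ * mass _ at h
  rw [mass_mul, mass_mul, mass_J, one_mul, mass_ofReal M hd ht, mass_ofReal M hd hz,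
    ← ENNReal.ofReal_mul (by linarith), ← ENNReal.ofReal_mul (by linarith), ← ENNReal.ofReal_add (by linarith)] at h
  · refine (ENNReal.ofReal_le_ofReal_iff ?_).1 h
    have := mul_nonneg (sub_nonneg.2 htz) (mul_nonneg (zero_le_one.trans p1) (zero_le_one.trans p2))
    linarith
  · exact mul_nonneg (sub_nonneg.2 htz) (mul_nonneg (zero_le_one.trans p1) (zero_le_one.trans p2))

theorem F_symm (t : ℝ) : IsSymmFun (Jc M * Gc M t) := symm_mul (J_symm M) (G_symm M t)

theorem S_step (hd : 0 < d) {t z : ℝ} (h0 : 0 ≤ t) (htz : t ≤ z) (hz : Good M z) :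
    Sr M z ≤ Sr M t + (z - t) * (Sr M t * Xr M z + Xr M t * Sr M z) := by
  have ht := hz.mono h0 htz
  have p1 := X_one M hd ht
  have p2 := X_one M hd hz
  have p3 : 0 ≤ Sr M t := ENNReal.toReal_nonneg
  have p4 : 0 ≤ Sr M z := ENNReal.toReal_nonneg
  have p5 : 0 ≤ z - t := sub_nonneg.2 htz
  have p6 := zero_le_one.trans p1
  have p7 := zero_le_one.trans p2
  have h := cs_mono (w := sq) (F_step M h0 htz hz)
  rw [cs_add, cs_smul, cs_sq_mul _ _ (symm_neg (F_symm M t)), mass_F, mass_F, mass_ofReal M hd ht, mass_ofReal M hd hz,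
    S_ofReal M hd ht, S_ofReal M hd hz,
    ← ENNReal.ofReal_mul p3, ← ENNReal.ofReal_mul p6, ← ENNReal.ofReal_add (by positivity) (by positivity), ← ENNReal.ofReal_mul p5,
    ← ENNReal.ofReal_add p3 (by positivity)] at h
  exact (ENNReal.ofReal_le_ofReal_iff (by positivity)).1 h

theorem chi_up' (hd : 0 < d) {t z : ℝ} (h0 : 0 ≤ t) (htz : t ≤ z) (hz : Good M z) :
    1 / Xr M t - 1 / Xr M z ≤ z - t := by
  have p1 := zero_lt_one.trans_le (X_one M hd (hz.mono h0 htz))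
  have p2 := zero_lt_one.trans_le (X_one M hd hz)
  have := X_step M hd h0 htz hz
  rw [div_sub_div _ _ p1.ne' p2.ne', div_le_iff₀ (by positivity)]
  linarith

theorem Xinv_cont (hd : 0 < d) {b : ℝ} (hb : Good M b) : ContinuousOn (fun t => 1 / Xr M t) (Set.Icc 0 b) := by
  have : ContinuousOn (fun t => -(1 / Xr M t)) (Set.Icc 0 b) := by
    refine lip_cont zero_le_one (fun t ht z hz h => ?_) (fun t ht z hz h => ?_)
    · exact neg_le_neg (one_div_le_one_div_of_le (zero_lt_one.trans_le (X_one M hd (hb.mono ht.1 ht.2)))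
        (X_mono M hd ht.1 h (hb.mono hz.1 hz.2)))
    · have := chi_up' M hd ht.1 h (hb.mono hz.1 hz.2)
      linarith
  refine this.neg.congr fun t _ => ?_
  simp

theorem S_cont (hd : 0 < d) {b : ℝ} (hb : Good M b) : ContinuousOn (Sr M) (Set.Icc 0 b) := by
  have q1 := zero_le_one.trans (X_one M hd hb)
  have q2 : 0 ≤ Sr M b := ENNReal.toReal_nonneg
  refine lip_cont (K := Sr M b * Xr M b + Xr M b * Sr M b) (by positivity)
    (fun t ht z hz h => S_mono M hd ht.1 h (hb.mono hz.1 hz.2)) (fun t ht z hz h => ?_)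
  refine (S_step M hd ht.1 h (hb.mono hz.1 hz.2)).trans ?_
  have p3 : 0 ≤ Sr M t := ENNReal.toReal_nonneg
  have p4 : 0 ≤ Sr M z := ENNReal.toReal_nonneg
  have p6 := zero_le_one.trans (X_one M hd (hb.mono ht.1 ht.2))
  have p7 := zero_le_one.trans (X_one M hd (hb.mono hz.1 hz.2))
  have h1 := X_mono M hd ht.1 ht.2 hb
  have h2 := X_mono M hd hz.1 hz.2 hb
  have h3 := S_mono M hd ht.1 ht.2 hb
  have h4 := S_mono M hd hz.1 hz.2 hb
  rw [mul_comm (z - t)]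
  have := sub_nonneg.2 h
  gcongr

theorem mass_H (t : ℝ) : (mass (Hc M t)).toReal = ∑' x, M.H t x := by
  rw [mass_eq, ENNReal.tsum_toReal_eq (fun x => show Hc M t x ≠ ∞ from ENNReal.ofReal_ne_top)]
  exact tsum_congr fun x => ENNReal.toReal_ofReal (M.H_nonneg t x)

theorem sq_H (t : ℝ) : (cs sq (Hc M t)).toReal = ∑' x, sqNorm x * M.H t x := by
  unfold cs
  rw [ENNReal.tsum_toReal_eq (fun x => show Hc M t x * sq x ≠ ∞ from ENNReal.mul_ne_top ENNReal.ofReal_ne_top ENNReal.ofReal_ne_top)]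
  refine tsum_congr fun x => ?_
  unfold Hc ofR sq
  rw [ENNReal.toReal_mul, ENNReal.toReal_ofReal (M.H_nonneg t x), ENNReal.toReal_ofReal (sqNorm_nonneg x), mul_comm]

theorem err (hd : 0 < d) (hσ : 0 < M.sigma) {t b δ : ℝ} (h0 : 0 ≤ t) (htb : t ≤ b) (hb : Good M b) (hE : M.E b < ENNReal.ofReal δ) :
    (mass (Hc M t)).toReal + (cs sq (Hc M t)).toReal * Xr M t / Sr M t < δ := by
  have ht := hb.mono h0 htb
  have hX := zero_lt_one.trans_le (X_one M hd ht)
  have hS := S_pos M hd hσ ht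
  have h1 : ENNReal.ofReal (∑' x, M.H t x) + ENNReal.ofReal (∑' x, sqNorm x * M.H t x) / M.xiSq t ≤ M.E b :=
    le_iSup₂ (f := fun t (_ : t ∈ Set.Icc (0:ℝ) b) => ENNReal.ofReal (∑' x, M.H t x) + ENNReal.ofReal (∑' x, sqNorm x * M.H t x) / M.xiSq t)
      t ⟨h0, htb⟩
  have h2 := h1.trans_lt hE
  rw [← mass_H M t, ← sq_H M t, xiSq_eq, mass_ofReal M hd ht, S_ofReal M hd ht, ← ENNReal.ofReal_div_of_pos hX,
    ← ENNReal.ofReal_div_of_pos (div_pos hS hX), ← ENNReal.ofReal_add ENNReal.toReal_nonneg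
      (div_nonneg ENNReal.toReal_nonneg (div_pos hS hX).le)] at h2
  have h3 := (ENNReal.ofReal_lt_ofReal_iff_of_nonneg (add_nonneg ENNReal.toReal_nonneg
      (div_nonneg ENNReal.toReal_nonneg (div_pos hS hX).le))).1 h2
  rwa [div_div_eq_mul_div] at h3

theorem X_dini (hd : 0 < d) {t b L : ℝ} (h0 : 0 ≤ t) (htb : t < b) (hb : Good M b)
    (hL : L < (1 - (mass (Hc M t)).toReal) * Xr M t ^ 2) :
    ∀ᶠ z in nhdsWithin t (Set.Ioi t), L * (z - t) ≤ Xr M z - Xr M t := by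
  have ht := hb.mono h0 htb.le
  have fG := (G_fin M hd ht).1
  have fH := (H_fin M hd ht).1
  have e : (fun _ : Zd d => ENNReal.ofReal 1) = fun _ => 1 := by simp
  have := dini M hd (L := L) h0 htb hb (w := fun _ => 1) (fun _ => zero_le_one)
  rw [e] at this
  change _ → mass _ ≠ ∞ → mass _ ≠ ∞ → L < (mass _).toReal - (mass _).toReal → _ at this
  rw [mass_mul, mass_mul, mass_mul, mass_mul, mass_J, one_mul] at this
  refine this (fun z hz => (G_fin M hd hz).1) (ENNReal.mul_ne_top fG fG)
    (ENNReal.mul_ne_top fG (ENNReal.mul_ne_top fH fG)) ?_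
  rw [ENNReal.toReal_mul, ENNReal.toReal_mul, ENNReal.toReal_mul]
  refine hL.trans_le (le_of_eq ?_)
  unfold Xr; ring

theorem cs_w (f : Cv d) : cs (fun x => ENNReal.ofReal (sqNorm x + M.sigma ^ 2)) f = cs sq f + ENNReal.ofReal (M.sigma ^ 2) * mass f := by
  have e : ENNReal.ofReal (M.sigma ^ 2) * mass f = ∑' x, ENNReal.ofReal (M.sigma ^ 2) * f x := by
    rw [mass_eq]; exact ENNReal.tsum_mul_left.symm
  rw [e]
  unfold cs
  rw [← ENNReal.tsum_add]
  refine tsum_congr fun x => ?_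
  show f x * ENNReal.ofReal (sqNorm x + M.sigma ^ 2) = _
  rw [ENNReal.ofReal_add (sqNorm_nonneg x) (sq_nonneg _), mul_add, mul_comm (ENNReal.ofReal (M.sigma ^ 2))]
  rfl

theorem fin1 {a m S s : ℝ≥0∞} (ha : a ≠ ∞) (hm : m ≠ ∞) (hS : S ≠ ∞) (hs : s ≠ ∞) :
    a * m + m * S + s * (m * m) ≠ ∞ ∧ (a * m + m * S + s * (m * m)).toReal =
      a.toReal * m.toReal + m.toReal * S.toReal + s.toReal * (m.toReal * m.toReal) := by
  refine ⟨by finiteness, ?_⟩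
  rw [ENNReal.toReal_add (by finiteness) (by finiteness), ENNReal.toReal_add (by finiteness) (by finiteness)]
  simp only [ENNReal.toReal_mul]

theorem fin2 {a m h k s : ℝ≥0∞} (ha : a ≠ ∞) (hm : m ≠ ∞) (hh : h ≠ ∞) (hk : k ≠ ∞) (hs : s ≠ ∞) :
    a * (h * m) + m * (k * m + h * a) + s * (m * (h * m)) ≠ ∞ ∧ (a * (h * m) + m * (k * m + h * a) + s * (m * (h * m))).toReal =
      a.toReal * (h.toReal * m.toReal) + m.toReal * (k.toReal * m.toReal + h.toReal * a.toReal) + s.toReal * (m.toReal * (h.toReal * m.toReal)) := by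
  refine ⟨by finiteness, ?_⟩
  rw [ENNReal.toReal_add (by finiteness) (by finiteness), ENNReal.toReal_add (by finiteness) (by finiteness)]
  simp only [ENNReal.toReal_mul]
  rw [ENNReal.toReal_add (by finiteness) (by finiteness)]
  simp only [ENNReal.toReal_mul]

theorem S_dini (hd : 0 < d) {t b L : ℝ} (h0 : 0 ≤ t) (htb : t < b) (hb : Good M b)
    (hL : L < 2 * Xr M t * Sr M t - 2 * Xr M t * (mass (Hc M t)).toReal * Sr M t - Xr M t ^ 2 * (cs sq (Hc M t)).toReal) :
    ∀ᶠ z in nhdsWithin t (Set.Ioi t), L * (z - t) ≤ Sr M z - Sr M t := by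
  have ht := hb.mono h0 htb.le
  have fG := (G_fin M hd ht).1
  have fH := (H_fin M hd ht).1
  have gG := (G_fin M hd ht).2
  have gH := (H_fin M hd ht).2
  have gF := S_fin M hd ht
  have eS : ∀ z, cs sq (Gc M z) + ENNReal.ofReal (M.sigma ^ 2) * mass (Gc M z) = cs sq (Jc M * Gc M z) := by
    intro z; rw [sq_F, add_comm]
  have hHs : ∀ x, Hc M t (-x) = Hc M t x := by
    intro x; unfold Hc ofR; rw [M.H_symm]
  have hGs := symm_neg (G_symm M t)
  have := dini M hd (L := L) h0 htb hb (w := fun x => sqNorm x + M.sigma ^ 2) (fun x => add_nonneg (sqNorm_nonneg x) (sq_nonneg _))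
  simp only [cs_w] at this
  simp only [eS] at this
  rw [cs_sq_mul _ _ hGs, cs_sq_mul _ _ hGs, cs_sq_mul _ _ hHs, mass_mul (Gc M t) (Jc M * Gc M t), mass_mul (Gc M t) (Hc M t * Gc M t), mass_mul (Jc M), mass_mul (Hc M t), mass_J, one_mul] at this
  have eSr : Sr M t = M.sigma ^ 2 * Xr M t + (cs sq (Gc M t)).toReal := by
    unfold Sr Xr
    rw [sq_F, ENNReal.toReal_add (ENNReal.mul_ne_top ENNReal.ofReal_ne_top fG) gG, ENNReal.toReal_mul, ENNReal.toReal_ofReal (sq_nonneg _)]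
  have k1 := fin1 gG fG gF (ENNReal.ofReal_ne_top (r := M.sigma ^ 2))
  have k2 := fin2 gG fG fH gH (ENNReal.ofReal_ne_top (r := M.sigma ^ 2))
  refine this (fun z hz => S_fin M hd hz) k1.1 k2.1 ?_
  refine hL.trans_le ?_
  rw [k1.2, k2.2, ENNReal.toReal_ofReal (sq_nonneg _)]
  change _ ≤ _ * Xr M t + Xr M t * Sr M t + _ * (Xr M t * Xr M t) - (_ * (_ * Xr M t) + Xr M t * (_ * Xr M t + _) + _ * (Xr M t * (_ * Xr M t)))
  have hX := zero_le_one.trans (X_one M hd ht)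
  have hσ2 := sq_nonneg M.sigma
  have hh : 0 ≤ (mass (Hc M t)).toReal := ENNReal.toReal_nonneg
  clear this k1 k2 hL
  generalize (mass (Hc M t)).toReal = h at *
  generalize (cs sq (Hc M t)).toReal = h2 at *
  generalize (cs sq (Gc M t)).toReal = g at *
  rw [eSr]
  have : 0 ≤ M.sigma ^ 2 * h * Xr M t ^ 2 := by positivity
  linarith
end NC

namespace NC
variable {d : ℕ}
variable {c0 : ℝ} (M : Model d c0)

theorem sigma_pos (hc : 0 < c0) : 0 < M.sigma :=
  lt_of_lt_of_le (mul_pos hc (zero_lt_one.trans_le M.K.R_ge_one)) M.K.sigma_lower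

theorem chi_low' (hd : 0 < d) (hσ : 0 < M.sigma) {b δ : ℝ} (hδ' : δ ≤ 1 / 2) (hb : Good M b)
    (hE : M.E b < ENNReal.ofReal δ) {t z : ℝ} (h0 : 0 ≤ t) (htz : t ≤ z) (hz : z ≤ b) :
    (1 - δ) * (z - t) ≤ 1 / Xr M t - 1 / Xr M z := by
  have gz := hb.mono (h0.trans htz) hz
  have := mono_of_local (f := fun s => 1 / Xr M s + (1 - δ) * s) htz ?_ ?_
  · linarith
  · refine ContinuousOn.add ((Xinv_cont M hd gz).mono (Set.Icc_subset_Icc_left h0)) ?_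
    fun_prop
  · intro s hs
    have s0 := h0.trans hs.1
    have gs := gz.mono s0 hs.2.le
    have hX := zero_lt_one.trans_le (X_one M hd gs)
    have hS := S_pos M hd hσ gs
    have he := err M hd hσ s0 (hs.2.le.trans hz) hb hE
    have he2 : 0 ≤ (cs sq (Hc M s)).toReal * Xr M s / Sr M s :=
      div_nonneg (mul_nonneg ENNReal.toReal_nonneg hX.le) hS.le
    have hl : (1 - δ) * Xr M s ^ 2 < (1 - (mass (Hc M s)).toReal) * Xr M s ^ 2 := by
      refine mul_lt_mul_of_pos_right ?_ (by positivity)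
      linarith
    obtain ⟨L, hL1, hL2⟩ := exists_between hl
    have hLp : 0 < L := lt_of_le_of_lt (mul_nonneg (by linarith) (sq_nonneg _)) hL1
    have hlim : Filter.Tendsto (fun y : ℝ => L * (1 / Xr M s) - (1 - δ) * Xr M s - L * (1 - δ) * (y - s)) (nhdsWithin s (Set.Ioi s))
        (nhds (L * (1 / Xr M s) - (1 - δ) * Xr M s - L * (1 - δ) * (s - s))) := by
      refine Filter.Tendsto.mono_left ?_ nhdsWithin_le_nhds
      exact Continuous.tendsto (by fun_prop) s
    have hpos : 0 < L * (1 / Xr M s) - (1 - δ) * Xr M s - L * (1 - δ) * (s - s) := by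
      rw [sub_self, mul_zero, sub_zero, sub_pos, mul_one_div, lt_div_iff₀ hX]
      linarith
    have hIoc : ∀ᶠ y in nhdsWithin s (Set.Ioi s), y ∈ Set.Ioc s z := Ioc_mem_nhdsGT hs.2
    filter_upwards [X_dini M hd s0 hs.2 gz hL2, hlim.eventually (lt_mem_nhds hpos), hIoc] with y hy1 hy2 hy3
    have hD : 0 < y - s := sub_pos.2 hy3.1
    have hXL : 0 < Xr M s + L * (y - s) := by positivity
    have h1 : 1 / Xr M y ≤ 1 / (Xr M s + L * (y - s)) := one_div_le_one_div_of_le hXL (by linarith)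
    have h2 : 1 / (Xr M s + L * (y - s)) ≤ 1 / Xr M s - (1 - δ) * (y - s) := by
      rw [div_le_iff₀ hXL]
      have e : (1 / Xr M s - (1 - δ) * (y - s)) * (Xr M s + L * (y - s)) =
        1 + (y - s) * (L * (1 / Xr M s) - (1 - δ) * Xr M s - L * (1 - δ) * (y - s)) := by
        field_simp; ring
      rw [e]
      have := mul_pos hD hy2
      linarith
    linarith

theorem S_low' (hd : 0 < d) (hσ : 0 < M.sigma) {b δ : ℝ} (hδ' : δ ≤ 1 / 2) (hb : Good M b)
    (hE : M.E b < ENNReal.ofReal δ) {t z : ℝ} (h0 : 0 ≤ t) (htz : t ≤ z) (hz : z ≤ b) :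
    Sr M t * (1 / Xr M t) ^ (2 - 2 * δ) ≤ Sr M z * (1 / Xr M z) ^ (2 - 2 * δ) := by
  have gz := hb.mono (h0.trans htz) hz
  set m := 2 - 2 * δ with hm
  have hm1 : 1 ≤ m := by linarith
  have := mono_of_local (f := fun s => -(Sr M s * (1 / Xr M s) ^ m)) htz ?_ ?_
  · linarith
  · refine ContinuousOn.neg (ContinuousOn.mul ((S_cont M hd gz).mono (Set.Icc_subset_Icc_left h0)) ?_)
    exact ((Xinv_cont M hd gz).mono (Set.Icc_subset_Icc_left h0)).rpow_const fun _ _ => Or.inr (by linarith)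
  · intro s hs
    have s0 := h0.trans hs.1
    have gs := gz.mono s0 hs.2.le
    have hX := zero_lt_one.trans_le (X_one M hd gs)
    have hS := S_pos M hd hσ gs
    have he := err M hd hσ s0 (hs.2.le.trans hz) hb hE
    have hh : 0 ≤ (mass (Hc M s)).toReal := ENNReal.toReal_nonneg
    have hl : m * Xr M s * Sr M s < 2 * Xr M s * Sr M s - 2 * Xr M s * (mass (Hc M s)).toReal * Sr M s - Xr M s ^ 2 * (cs sq (Hc M s)).toReal := by
      have e : 2 * Xr M s * Sr M s - 2 * Xr M s * (mass (Hc M s)).toReal * Sr M s - Xr M s ^ 2 * (cs sq (Hc M s)).toReal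
        = (2 - 2 * (mass (Hc M s)).toReal - (cs sq (Hc M s)).toReal * Xr M s / Sr M s) * (Xr M s * Sr M s) := by
        field_simp
      rw [e, mul_assoc]
      refine mul_lt_mul_of_pos_right ?_ (by positivity)
      have : 0 ≤ (cs sq (Hc M s)).toReal * Xr M s / Sr M s := 
        div_nonneg (mul_nonneg ENNReal.toReal_nonneg hX.le) hS.le
      linarith
    obtain ⟨L, hL1, hL2⟩ := exists_between hl
    have hLp : 0 < L := lt_trans (by positivity) hL1
    have hlim : Filter.Tendsto (fun y : ℝ => L - m * Xr M s * Sr M s - L * m * Xr M s * (y - s)) (nhdsWithin s (Set.Ioi s))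
        (nhds (L - m * Xr M s * Sr M s - L * m * Xr M s * (s - s))) := by
      refine Filter.Tendsto.mono_left ?_ nhdsWithin_le_nhds
      exact Continuous.tendsto (by fun_prop) s
    have hpos : 0 < L - m * Xr M s * Sr M s - L * m * Xr M s * (s - s) := by
      rw [sub_self, mul_zero, sub_zero, sub_pos]; exact hL1
    have hlim2 : Filter.Tendsto (fun y : ℝ => Xr M s * (y - s)) (nhdsWithin s (Set.Ioi s)) (nhds (Xr M s * (s - s))) := by
      refine Filter.Tendsto.mono_left ?_ nhdsWithin_le_nhds
      exact Continuous.tendsto (by fun_prop) s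
    have hpos2 : Xr M s * (s - s) < 1 := by simp
    have hIoc : ∀ᶠ y in nhdsWithin s (Set.Ioi s), y ∈ Set.Ioc s z := Ioc_mem_nhdsGT hs.2
    filter_upwards [S_dini M hd s0 hs.2 gz hL2, hlim.eventually (lt_mem_nhds hpos), hlim2.eventually (gt_mem_nhds hpos2), hIoc] with y hy1 hy2 hy4 hy3
    have hD : 0 < y - s := sub_pos.2 hy3.1
    have gy := gz.mono (s0.trans hy3.1.le) hy3.2
    have hB := one_add_mul_self_le_rpow_one_add (s := -(Xr M s * (y - s))) (by linarith) hm1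
    have hu : 1 / Xr M s * (1 + -(Xr M s * (y - s))) ≤ 1 / Xr M y := by
      have := chi_up' M hd s0 hy3.1.le gy
      have e : 1 / Xr M s * (1 + -(Xr M s * (y - s))) = 1 / Xr M s - (y - s) := by field_simp; ring
      linarith
    have hSL : Sr M s + L * (y - s) ≤ Sr M y := by linarith
    have h3 : (1 / Xr M s) ^ m * (1 + m * -(Xr M s * (y - s))) ≤ (1 / Xr M y) ^ m := by
      refine (mul_le_mul_of_nonneg_left hB (by positivity)).trans ?_
      rw [← Real.mul_rpow (by positivity) (by linarith)]
      exact Real.rpow_le_rpow (mul_nonneg (by positivity) (by linarith)) hu (by linarith)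
    have h4 : Sr M s ≤ (Sr M s + L * (y - s)) * (1 + m * -(Xr M s * (y - s))) := by
      have := mul_pos hD hy2
      nlinarith
    rw [neg_le_neg_iff]
    have hSp : 0 < Sr M s + L * (y - s) := by positivity
    calc Sr M s * (1 / Xr M s) ^ m ≤ (Sr M s + L * (y - s)) * (1 + m * -(Xr M s * (y - s))) * (1 / Xr M s) ^ m := by gcongr
      _ = (Sr M s + L * (y - s)) * ((1 / Xr M s) ^ m * (1 + m * -(Xr M s * (y - s)))) := by ring
      _ ≤ (Sr M s + L * (y - s)) * (1 / Xr M y) ^ m := by gcongr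
      _ ≤ Sr M y * (1 / Xr M y) ^ m := by
          have hX := zero_lt_one.trans_le (X_one M hd gy)
          gcongr

theorem xi_sq (t : ℝ) : M.xi t ^ 2 = Sr M t / Xr M t := by
  unfold Model.xi
  rw [Real.sq_sqrt ENNReal.toReal_nonneg, xiSq_eq, ENNReal.toReal_div]
  rfl

theorem good_zero : Good M 0 := ⟨le_rfl, by simpa using M.βc_pos⟩

theorem xi_zero (hc : 0 < c0) : M.xi 0 = M.sigma := by
  have h := xi_sq M 0
  rw [S_zero, X_zero, div_one] at h
  exact (pow_left_inj₀ (Real.sqrt_nonneg _) (sigma_pos M hc).le two_ne_zero).1 h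

theorem xi_pos (hd : 0 < d) (hc : 0 < c0) {t : ℝ} (h : Good M t) : 0 < M.xi t := by
  have h1 := xi_sq M t
  have h2 : 0 < M.xi t ^ 2 := by
    rw [h1]; exact div_pos (S_pos M hd (sigma_pos M hc) h) (zero_lt_one.trans_le (X_one M hd h))
  exact lt_of_le_of_ne (Real.sqrt_nonneg _) fun h' => by rw [← h'] at h2; simp at h2

theorem fam (hd : 0 < d) (hc : 0 < c0) {b δ : ℝ} (hδ' : δ ≤ 1 / 2) (hb : Good M b)
    (hE : M.E b < ENNReal.ofReal δ) : Fam d c0 M.K.R δ b (fun t => Jc M * Gc M t) (Xr M) M.xi where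
  dat t h0 h1 := by
    have g := hb.mono h0 h1
    have hX := zero_lt_one.trans_le (X_one M hd g)
    refine ⟨F_symm M t, hX, xi_pos M hd hc g, ?_, ?_⟩
    · rw [mass_F, mass_ofReal M hd g]
    · rw [xi_sq M t, mul_div_cancel₀ _ hX.ne', S_ofReal M hd g]
  mono t z h0 h1 h2 := cmul_le le_rfl (G_mono M h0 h1 (hb.mono (h0.trans h1) h2).2.le)
  step t z h0 h1 h2 := F_step M h0 h1 (hb.mono (h0.trans h1) h2)
  chi0 := X_zero M
  chi_low t z h0 h1 h2 := chi_low' M hd (sigma_pos M hc) hδ' hb hE h0 h1 h2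
  chi_up t z h0 h1 h2 := chi_up' M hd h0 h1 (hb.mono (h0.trans h1) h2)
  xi_low t z h0 h1 h2 := by
    have gt := hb.mono h0 (h1.trans h2)
    have gz := hb.mono (h0.trans h1) h2
    have hX := zero_lt_one.trans_le (X_one M hd gt)
    have hXz := zero_lt_one.trans_le (X_one M hd gz)
    have h := S_low' M hd (sigma_pos M hc) hδ' hb hE h0 h1 h2
    have e : (2 - 2 * δ) = 1 + (1 - 2 * δ) := by ring
    rw [e, Real.rpow_add (by positivity), Real.rpow_add (by positivity), Real.rpow_one, Real.rpow_one] at h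
    rw [xi_sq M t, xi_sq M z]
    have e2 : (Xr M z / Xr M t) ^ (1 - 2 * δ) = (1 / Xr M t) ^ (1 - 2 * δ) * Xr M z ^ (1 - 2 * δ) := by
      rw [← Real.mul_rpow (by positivity) (by positivity)]; congr 1; field_simp
    have e3 : (1 / Xr M z) ^ (1 - 2 * δ) * Xr M z ^ (1 - 2 * δ) = 1 := by
      rw [← Real.mul_rpow (by positivity) (by positivity), one_div_mul_cancel hXz.ne', Real.one_rpow]
    have h' := mul_le_mul_of_nonneg_right h (Real.rpow_nonneg hXz.le (1 - 2 * δ))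
    calc Sr M t / Xr M t * (Xr M z / Xr M t) ^ (1 - 2 * δ)
        = Sr M t * (1 / Xr M t * (1 / Xr M t) ^ (1 - 2 * δ)) * Xr M z ^ (1 - 2 * δ) := by rw [e2]; ring
      _ ≤ _ := h'
      _ = Sr M z / Xr M z * ((1 / Xr M z) ^ (1 - 2 * δ) * Xr M z ^ (1 - 2 * δ)) := by ring
      _ = _ := by rw [e3, mul_one]
  base_le x := by
    rw [G_zero, mul_one]
    exact ENNReal.ofReal_le_ofReal (M.K.J_upper x)
  base_supp x hx := by
    rw [G_zero, mul_one] at hx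
    refine M.K.range_le x ?_
    by_contra h
    exact hx (ENNReal.ofReal_of_nonpos (not_lt.1 h))
  R1 := M.K.R_ge_one
  sig_low := by rw [xi_zero M hc]; exact M.K.sigma_lower
  sig_up := by
    rw [xi_zero M hc, sigma_sq]
    have h : ∀ x, sqNorm x * M.K.J x ≤ d * M.K.R ^ 2 * M.K.J x := by
      intro x
      rcases (M.K.nonneg x).eq_or_lt with h | h
      · rw [← h]; simp
      · refine mul_le_mul_of_nonneg_right ((sqNorm_le x).trans ?_) h.le
        have := M.K.range_le x h
        have := supNorm_nonneg x
        gcongr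
    refine (M.K.summable_sq.tsum_le_tsum h (M.K.summable.mul_left _)).trans ?_
    rw [tsum_mul_left, M.K.norm_one, mul_one]
end NC

namespace NC
variable {d : ℕ}

theorem XX_rpow {σ r p : ℝ} (hσ : 0 < σ) (hr : 0 ≤ r) : XX σ r ^ (-(p / 2)) = (σ / max σ r) ^ p := by
  have e : XX σ r = (max σ r / σ) ^ 2 := by
    unfold XX
    rcases le_total σ r with h | h
    · rw [max_eq_right h, max_eq_right]
      exact one_le_pow₀ ((one_le_div hσ).2 h)
    · rw [max_eq_left h, max_eq_left, div_self hσ.ne', one_pow]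
      exact pow_le_one₀ (by positivity) ((div_le_one hσ).2 h)
  have hm : 0 < max σ r := lt_max_of_lt_left hσ
  have hq : 0 < max σ r / σ := by positivity
  rw [e, ← Real.rpow_natCast, ← Real.rpow_mul hq.le]
  have : ((2:ℕ):ℝ) * -(p / 2) = -p := by push_cast; ring
  rw [this, Real.rpow_neg hq.le, ← Real.inv_rpow hq.le, inv_div]

theorem exists_const {Y : ℝ} (hY : 0 ≤ Y) (D : ℝ) (hD : 0 < D) {ε : ℝ} (hε : 0 < ε) :
    ∃ K δ : ℝ, 128 ≤ K ∧ Y ≤ K ^ (ε / 8) ∧ 0 < δ ∧ δ ≤ 1 / 2 ∧ δ * D ≤ ε / 8 ∧ δ * K ≤ 1 / 8 ∧ K ^ (2 * δ) ≤ 2 := by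
  set K := max 128 (Y ^ (8 / ε)) with hK
  have h128 : 128 ≤ K := le_max_left _ _
  have hK0 : 0 < K := by linarith
  have hlog : 0 < Real.log K := Real.log_pos (by linarith)
  have hl2 : 0 < Real.log 2 := Real.log_pos (by norm_num)
  set δ := min (1 / 2) (min (1 / (8 * K)) (min (ε / (8 * D)) (Real.log 2 / (2 * Real.log K)))) with hδ
  have hδ0 : 0 < δ := by
    refine lt_min (by norm_num) (lt_min (by positivity) (lt_min (by positivity) (by positivity)))
  have d1 : δ ≤ 1 / 2 := min_le_left _ _
  have d2 : δ ≤ 1 / (8 * K) := (min_le_right _ _).trans (min_le_left _ _)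
  have d3 : δ ≤ ε / (8 * D) := (min_le_right _ _).trans ((min_le_right _ _).trans (min_le_left _ _))
  have d4 : δ ≤ Real.log 2 / (2 * Real.log K) := (min_le_right _ _).trans ((min_le_right _ _).trans (min_le_right _ _))
  refine ⟨K, δ, h128, ?_, hδ0, d1, ?_, ?_, ?_⟩
  · have : Y ^ (8 / ε) ≤ K := le_max_right _ _
    have h2 := Real.rpow_le_rpow (by positivity) this (show 0 ≤ ε / 8 by positivity)
    rw [← Real.rpow_mul hY] at h2
    have e : 8 / ε * (ε / 8) = 1 := by field_simp
    rwa [e, Real.rpow_one] at h2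
  · rw [le_div_iff₀ (by positivity)] at d3; linarith
  · rw [le_div_iff₀ (by positivity)] at d2; linarith
  · rw [le_div_iff₀ (by positivity)] at d4
    rw [Real.rpow_def_of_pos hK0, ← Real.exp_log (show (0:ℝ) < 2 by norm_num)]
    refine Real.exp_le_exp.2 ?_
    rw [Real.exp_log (by norm_num)]
    linarith

variable {c0 : ℝ} (M : Model d c0)

theorem E_zero : M.E 0 = 0 := by
  unfold Model.E
  refine le_antisymm (iSup₂_le fun t ht => ?_) zero_le
  have : t = 0 := le_antisymm ht.2 ht.1
  subst this
  simp [M.H_zero]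

theorem E_mono {t z : ℝ} (h : t ≤ z) : M.E t ≤ M.E z := by
  unfold Model.E
  exact biSup_mono fun s hs => ⟨hs.1, hs.2.trans h⟩

theorem tsum_iSup_nat {α : Type*} (f : ℕ → α → ℝ≥0∞) (hf : Monotone f) : ∑' x, ⨆ n, f n x = ⨆ n, ∑' x, f n x := by
  let _ : MeasurableSpace α := ⊤
  have := MeasureTheory.lintegral_iSup (μ := MeasureTheory.Measure.count) (fun n => measurable_from_top) hf
  simpa [MeasureTheory.lintegral_count] using this

def bs (β : ℝ) (n : ℕ) : ℝ := β * (n / (n + 1))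

theorem bs_mono {β : ℝ} (hβ : 0 ≤ β) : Monotone (bs β) := by
  intro m n h
  unfold bs
  refine mul_le_mul_of_nonneg_left ?_ hβ
  have : (m:ℝ) ≤ n := by exact_mod_cast h
  rw [div_le_div_iff₀ (by positivity) (by positivity)]
  linarith

theorem bs_nonneg {β : ℝ} (hβ : 0 ≤ β) (n : ℕ) : 0 ≤ bs β n := by unfold bs; positivity

theorem bs_lt {β : ℝ} (hβ : 0 < β) (n : ℕ) : bs β n < β := by
  unfold bs
  refine mul_lt_of_lt_one_right hβ ?_
  rw [div_lt_one (by positivity)]; linarith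

theorem bs_tendsto (β : ℝ) : Filter.Tendsto (bs β) Filter.atTop (nhds β) := by
  have := (tendsto_natCast_div_add_atTop (1:ℝ)).const_mul β
  rwa [mul_one] at this

theorem G_sup (hd : 0 < d) {β : ℝ} (hβ : 0 < β) (hle : ENNReal.ofReal β ≤ M.βc) (x : Zd d) :
    M.G β x = ⨆ n, M.G (bs β n) x := by
  refine le_antisymm ?_ (iSup_le fun n => M.mono x (bs_nonneg hβ.le n) (bs_lt hβ n).le hle)
  rcases hle.lt_or_eq with h | h
  · have hfin : M.G β x ≠ ∞ := ne_top_of_le_ne_top (G_fin M hd ⟨hβ.le, h⟩).1 (apply_le_mass (Gc M β) x)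
    have hc := (M.deriv x hβ.le h).continuousWithinAt
    have ht : Filter.Tendsto (fun n => (M.G (bs β n) x).toReal) Filter.atTop (nhds (M.G β x).toReal) := by
      refine hc.tendsto.comp (tendsto_nhdsWithin_iff.2 ⟨bs_tendsto β, Filter.Eventually.of_forall fun n => bs_nonneg hβ.le n⟩)
    have hsup : ⨆ n, M.G (bs β n) x ≠ ∞ :=
      ne_top_of_le_ne_top hfin (iSup_le fun n => M.mono x (bs_nonneg hβ.le n) (bs_lt hβ n).le hle)
    rw [← ENNReal.toReal_le_toReal hfin hsup]
    exact le_of_tendsto' ht fun n => ENNReal.toReal_mono hsup (le_iSup (fun n => M.G (bs β n) x) n)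
  · have htop : M.βc ≠ ⊤ := by rw [← h]; exact ENNReal.ofReal_ne_top
    have hb : M.βc.toReal = β := by rw [← h, ENNReal.toReal_ofReal hβ.le]
    have := M.limit htop x
    rw [hb] at this
    rw [this]
    refine iSup₂_le fun t ht => ?_
    obtain ⟨n, hn⟩ := ((bs_tendsto β).eventually (lt_mem_nhds ht.2)).exists
    exact (M.mono x ht.1 hn.le ((ENNReal.ofReal_le_ofReal (bs_lt hβ n).le).trans hle)).trans (le_iSup (fun n => M.G (bs β n) x) n)

theorem G_seq_mono {β : ℝ} (hβ : 0 < β) (hle : ENNReal.ofReal β ≤ M.βc) : Monotone fun n => M.G (bs β n) := by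
  intro m n h x
  exact M.mono x (bs_nonneg hβ.le m) (bs_mono hβ.le h) ((ENNReal.ofReal_le_ofReal (bs_lt hβ n).le).trans hle)

theorem F_seq_mono {β : ℝ} (hβ : 0 < β) (hle : ENNReal.ofReal β ≤ M.βc) : Monotone fun n => M.F (bs β n) := by
  intro m n h x
  unfold Model.F
  exact ENNReal.tsum_le_tsum fun y => mul_le_mul_right (G_seq_mono M hβ hle h (x - y)) _

theorem F_sup (hd : 0 < d) {β : ℝ} (hβ : 0 < β) (hle : ENNReal.ofReal β ≤ M.βc) (x : Zd d) :
    M.F β x = ⨆ n, M.F (bs β n) x := by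
  unfold Model.F
  rw [← tsum_iSup_nat]
  · refine tsum_congr fun y => ?_
    rw [G_sup M hd hβ hle, ENNReal.mul_iSup]
  · intro m n h y
    exact mul_le_mul_right (G_seq_mono M hβ hle h (x - y)) _

theorem chi_sup (hd : 0 < d) {β : ℝ} (hβ : 0 < β) (hle : ENNReal.ofReal β ≤ M.βc) :
    M.chi β = ⨆ n, M.chi (bs β n) := by
  unfold Model.chi
  rw [← tsum_iSup_nat _ (G_seq_mono M hβ hle)]
  exact tsum_congr fun y => G_sup M hd hβ hle y

def Sm (β : ℝ) : ℝ≥0∞ := ∑' x, ENNReal.ofReal (sqNorm x) * M.F β x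

theorem Sm_sup (hd : 0 < d) {β : ℝ} (hβ : 0 < β) (hle : ENNReal.ofReal β ≤ M.βc) :
    Sm M β = ⨆ n, Sm M (bs β n) := by
  unfold Sm
  rw [← tsum_iSup_nat]
  · refine tsum_congr fun y => ?_
    rw [F_sup M hd hβ hle, ENNReal.mul_iSup]
  · intro m n h y
    exact mul_le_mul_right (F_seq_mono M hβ hle h y) _

theorem xi_tendsto (hd : 0 < d) {β : ℝ} (hβ : 0 < β) (hle : ENNReal.ofReal β ≤ M.βc) (h : M.xi β ≠ 0) :
    Filter.Tendsto (fun n => M.xi (bs β n)) Filter.atTop (nhds (M.xi β)) := by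
  have hx : M.xiSq β = Sm M β / M.chi β := rfl
  have h1 : M.xiSq β ≠ 0 ∧ M.xiSq β ≠ ∞ := by
    constructor <;> intro h' <;> exact h (by unfold Model.xi; rw [h']; simp)
  have hchi : M.chi β ≠ ∞ := by
    intro h'; rw [hx, h', ENNReal.div_top] at h1; exact h1.1 rfl
  have hS : Sm M β ≠ ∞ := by
    intro h'; rw [hx, h', ENNReal.top_div_of_ne_top hchi] at h1; exact h1.2 rfl
  have hS0 : Sm M β ≠ 0 := by
    intro h'; rw [hx, h', ENNReal.zero_div] at h1; exact h1.1 rfl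
  have t1 : Filter.Tendsto (fun n => M.chi (bs β n)) Filter.atTop (nhds (M.chi β)) := by
    rw [chi_sup M hd hβ hle]
    exact tendsto_atTop_iSup fun m n h => ENNReal.tsum_le_tsum (G_seq_mono M hβ hle h)
  have t2 : Filter.Tendsto (fun n => Sm M (bs β n)) Filter.atTop (nhds (Sm M β)) := by
    rw [Sm_sup M hd hβ hle]
    exact tendsto_atTop_iSup fun m n h => ENNReal.tsum_le_tsum fun x => mul_le_mul_right (F_seq_mono M hβ hle h x) _
  have t3 := ENNReal.Tendsto.div t2 (Or.inl hS0) t1 (Or.inl hchi)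
  exact (Real.continuous_sqrt.tendsto _).comp ((ENNReal.tendsto_toReal h1.2).comp t3)

theorem main_aux (hd : 0 < d) (hc : 0 < c0) {δ : ℝ} (hδ : 0 < δ) {A c : ℝ} (hA : 0 ≤ A) (hc' : 0 ≤ c) (x : Zd d)
    (h : ∀ b, Good M b → M.E b < ENNReal.ofReal δ → M.F b x ≤ ENNReal.ofReal (A * Real.exp (-c * supNorm x / M.xi b)))
    {β : ℝ} (h0 : 0 ≤ β) (hle : β ≤ M.betaOf δ) : M.F β x ≤ ENNReal.ofReal (A * Real.exp (-c * supNorm x / M.xi β)) := by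
  rcases h0.eq_or_lt with h0' | h0'
  · rw [← h0']
    exact h 0 (good_zero M) (by rw [E_zero]; exact ENNReal.ofReal_pos.2 hδ)
  have key : ∀ t, 0 ≤ t → t < M.betaOf δ → Good M t ∧ M.E t < ENNReal.ofReal δ := by
    intro t ht0 ht
    unfold Model.betaOf at ht
    obtain ⟨b, hb, htb⟩ := exists_lt_of_lt_csSup (s := {β : ℝ | 0 ≤ β ∧ ENNReal.ofReal β < M.βc ∧ M.E β < ENNReal.ofReal δ}) ⟨0, le_rfl, (good_zero M).2, by rw [E_zero]; exact ENNReal.ofReal_pos.2 hδ⟩ ht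
    exact ⟨Good.mono ⟨hb.1, hb.2.1⟩ ht0 htb.le, (E_mono M htb.le).trans_lt hb.2.2⟩
  rcases hle.lt_or_eq with h1 | h1
  · exact h β (key β h0 h1).1 (key β h0 h1).2
  have hbc : ENNReal.ofReal β ≤ M.βc := by
    by_contra hcon
    push Not at hcon
    have htop : M.βc ≠ ∞ := ne_top_of_lt hcon
    have := (ENNReal.lt_ofReal_iff_toReal_lt htop).1 hcon
    have := (key M.βc.toReal ENNReal.toReal_nonneg (this.trans_le hle)).1.2
    rw [ENNReal.ofReal_toReal htop] at this
    exact lt_irrefl _ this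
  have hseq : ∀ n, M.F (bs β n) x ≤ ENNReal.ofReal (A * Real.exp (-c * supNorm x / M.xi (bs β n))) := fun n =>
    have := key (bs β n) (bs_nonneg h0 n) ((bs_lt h0' n).trans_le hle)
    h _ this.1 this.2
  by_cases hxi : M.xi β = 0
  · rw [hxi, div_zero, Real.exp_zero, mul_one, F_sup M hd h0' hbc]
    refine iSup_le fun n => (hseq n).trans (ENNReal.ofReal_le_ofReal ?_)
    refine mul_le_of_le_one_right hA (Real.exp_le_one_iff.2 ?_)
    refine div_nonpos_of_nonpos_of_nonneg ?_ (Real.sqrt_nonneg _)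
    have := mul_nonneg hc' (supNorm_nonneg x)
    linarith
  · have t1 : Filter.Tendsto (fun n => M.F (bs β n) x) Filter.atTop (nhds (M.F β x)) := by
      rw [F_sup M hd h0' hbc]
      exact tendsto_atTop_iSup fun m n hmn => F_seq_mono M h0' hbc hmn x
    refine le_of_tendsto_of_tendsto' t1 ?_ hseq
    refine ENNReal.tendsto_ofReal (Filter.Tendsto.const_mul _ ?_)
    refine (Real.continuous_exp.tendsto _).comp ?_
    exact Filter.Tendsto.div tendsto_const_nhds (xi_tendsto M hd h0' hbc hxi) hxi

theorem main (d : ℕ) (hd : 2 < d) (c₀ : ℝ) (hc₀ : c₀ ∈ Set.Ioc (0:ℝ) 1) :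
    ∃ c > (0:ℝ), ∃ C > (0:ℝ), ∀ ε ∈ Set.Ioo (0:ℝ) 1, ∃ δ ∈ Set.Ioc (0:ℝ) (1/2),
      ∀ M : Model d c₀, ∀ β : ℝ, 0 ≤ β → β ≤ M.betaOf δ → ∀ x : Fin d → ℤ,
        M.F β x ≤ ENNReal.ofReal
          (1/2 * (C / M.sigma ^ d *
              (M.sigma / max M.sigma (supNorm x)) ^ ((d : ℝ) - 2 - ε) *
              Real.exp (-c * supNorm x / M.xi β))) := by
  have hd0 : 0 < d := by omega
  have hdR : (0:ℝ) < d := by exact_mod_cast hd0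
  have hc := hc₀.1
  refine ⟨c₀ / (8 * d), by positivity, 2 * |CT0 d c₀ + 8 * CE d c₀| + 1, by positivity, ?_⟩
  intro ε hε
  have hY : 0 ≤ C2 d (c₀ / (4 * d)) ^ d := by unfold C2; positivity
  obtain ⟨K, δ, hK, hKε, hδ, hδ', hδd, hδK, hK2⟩ := exists_const hY (d:ℝ) hdR hε.1
  refine ⟨δ, ⟨hδ, hδ'⟩, ?_⟩
  intro M β h0 hβ x
  have hσ := sigma_pos M hc
  have hm : 0 < max M.sigma (supNorm x) := lt_max_of_lt_left hσ
  have hp : 0 ≤ (M.sigma / max M.sigma (supNorm x)) ^ ((d : ℝ) - 2 - ε) := Real.rpow_nonneg (by positivity) _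
  rw [← mul_assoc]
  rw [← mul_assoc]
  refine main_aux M hd0 hc hδ (by positivity) (by positivity) x ?_ h0 hβ
  intro b hb hE
  have h := (fam M hd0 hc hδ' hb hE).final hd hc hc₀.2 hδ.le hδ' hε.1 hε.2 hδd hK hδK hK2 hKε hb.1 x
  rw [F_eq]
  refine h.trans (ENNReal.ofReal_le_ofReal ?_)
  rw [xi_zero M hc, XX_rpow hσ (supNorm_nonneg x)]
  have e : -(c₀ / (8 * d) * supNorm x / M.xi b) = -(c₀ / (8 * d)) * supNorm x / M.xi b := by ring
  rw [e]
  refine mul_le_mul_of_nonneg_right (mul_le_mul_of_nonneg_right ?_ hp) (Real.exp_pos _).le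
  rw [one_div, inv_pow, ← div_eq_mul_inv, ← mul_div_assoc]
  refine div_le_div_of_nonneg_right ?_ (by positivity)
  have := le_abs_self (CT0 d c₀ + 8 * CE d c₀)
  linarith
end NC

/-- near-critical upper bound for `F_β` (Theorem 3.1 / `thm:bound on F`). -/
theorem statement1 (d : ℕ) (hd : 2 < d) (c₀ : ℝ) (hc₀ : c₀ ∈ Set.Ioc (0:ℝ) 1) :
    ∃ c > (0:ℝ), ∃ C > (0:ℝ), ∀ ε ∈ Set.Ioo (0:ℝ) 1, ∃ δ ∈ Set.Ioc (0:ℝ) (1/2),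
      ∀ M : Model d c₀, ∀ β : ℝ, 0 ≤ β → β ≤ M.betaOf δ → ∀ x : Fin d → ℤ,
        M.F β x ≤ ENNReal.ofReal
          (1/2 * (C / M.sigma ^ d *
              (M.sigma / max M.sigma (supNorm x)) ^ ((d : ℝ) - 2 - ε) *
              Real.exp (-c * supNorm x / M.xi β))) := by
  exact NC.main d hd c₀ hc₀
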